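/- arXiv:2601.19230 — 3 statements merged into one kernel-verified Lean document; each statement's English description precedes it below -/
import Mathlib

section
/- Let k ≥ 1, h ≥ 0 and c ≥ 3 be integers. Let {I'_hdl, I'_crscp} be a partition of [2, h+c+1] with |I'_hdl| = h and |I'_crscp| = c, and suppose there is an integer i with i, i+1, i+2 ∈ I'_crscp. Define I''_hdl := {j ∈ I'_hdl | j < i} ∪ {i} ∪ {j−1 | j ∈ I'_hdl, j > i+2} and I''_crscp := {j ∈ I'_crscp | j < i} ∪ {i+1} ∪ {j−1 | j ∈ I'_crscp, j > i+2}; then {I''_hdl, I''_crscp} is a partition of [2, h+c] with |I''_hdl| = h+1 and |I''_crscp| = c−2, and the mixed surface grid H^{18k}_{I'_hdl,I'_crscp} of order 18k with h handles and c crosscaps contains the mixed surface grid H^k_{I''_hdl,I''_crscp} of order k with h+1 handles and c−2 crosscaps as a minor. -/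
open SimpleGraph

/-- `H` is a minor of `G`: there is a minor model of `H` in `G`, i.e. a family of pairwise
disjoint connected branch sets, one for each vertex of `H`, such that every edge of `H` is
realised by an edge of `G` between the corresponding branch sets. -/
def IsMinorOf {α β : Type*} (H : SimpleGraph α) (G : SimpleGraph β) : Prop :=
  ∃ X : α → Set β,
    (∀ u v : α, u ≠ v → Disjoint (X u) (X v)) ∧
    (∀ v : α, (G.induce (X v)).Connected) ∧
    (∀ u v : α, H.Adj u v → ∃ a ∈ X u, ∃ b ∈ X v, G.Adj a b)

/-- The mixed surface grid of order `k` built from the `(k, 4*n*k)`-cylindrical grid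
(where `n = h + c + 1`), with a handle added at every position in `Ih` and a crosscap added
at every position in `Ic`.  The vertex `v_j^i` (for `i ∈ [k]`, `j ∈ ℤ/(4nk)`) is encoded as
`(⟨i - 1⟩, j)`, so the top row `v^1` corresponds to first coordinate `0`. -/
def mixedGrid (k n : ℕ) (Ih Ic : Finset ℕ) :
    SimpleGraph (Fin k × ZMod (4 * n * k)) :=
  SimpleGraph.fromRel (fun p q =>
    (p.1 = q.1 ∧ q.2 = p.2 + 1) ∨
    (p.2 = q.2 ∧ (q.1 : ℕ) = (p.1 : ℕ) + 1) ∨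
    ((p.1 : ℕ) = 0 ∧ (q.1 : ℕ) = 0 ∧ ∃ i ∈ Ih, ∃ j ∈ Finset.Icc 1 k,
      ((p.2 = ((4 * k * (i - 1) + j : ℕ) : ZMod (4 * n * k)) ∧
        q.2 = ((4 * k * (i - 1) + 3 * k - j + 1 : ℕ) : ZMod (4 * n * k))) ∨
       (p.2 = ((4 * k * (i - 1) + k + j : ℕ) : ZMod (4 * n * k)) ∧
        q.2 = ((4 * k * (i - 1) + 4 * k - j + 1 : ℕ) : ZMod (4 * n * k))))) ∨
    ((p.1 : ℕ) = 0 ∧ (q.1 : ℕ) = 0 ∧ ∃ i ∈ Ic, ∃ j ∈ Finset.Icc 1 (2 * k),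
      p.2 = ((4 * k * (i - 1) + j : ℕ) : ZMod (4 * n * k)) ∧
      q.2 = ((4 * k * (i - 1) + 2 * k + j : ℕ) : ZMod (4 * n * k))))

/-- The Dyck grid `D_k^{(h,c)}`. -/
def dyckGrid (k h c : ℕ) : SimpleGraph (Fin k × ZMod (4 * (h + c + 1) * k)) :=
  mixedGrid k (h + c + 1) (Finset.Icc 2 (h + 1)) (Finset.Icc (h + 2) (h + c + 1))

namespace MixedAux

/-- Injective-on-domain reparametrisation transfers minor models. -/
theorem minor_of_param {α β γ : Type*} (H : SimpleGraph α) (G : SimpleGraph β) (φ : γ → β)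
    (D : Set γ) (hinj : Set.InjOn φ D) (Y : α → Set γ) (hD : ∀ u, Y u ⊆ D)
    (hdis : ∀ u v, u ≠ v → Disjoint (Y u) (Y v))
    (hcon : ∀ u, ((G.comap φ).induce (Y u)).Connected)
    (hadj : ∀ u v, H.Adj u v → ∃ a ∈ Y u, ∃ b ∈ Y v, (G.comap φ).Adj a b) :
    IsMinorOf H G := by
  refine ⟨fun u => φ '' (Y u), ?_, ?_, ?_⟩
  · intro u v huv
    rw [Set.disjoint_left]
    rintro _ ⟨a, ha, rfl⟩ ⟨b, hb, hab⟩
    have : b = a := hinj (hD v hb) (hD u ha) hab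
    subst this
    exact Set.disjoint_left.1 (hdis u v huv) ha hb
  · intro u
    refine (hcon u).map (H := G.induce (φ '' (Y u)))
      ⟨fun x => ⟨φ x.1, x.1, x.2, rfl⟩, ?_⟩ ?_
    · intro a b hab
      exact hab
    · rintro ⟨_, a, ha, rfl⟩
      exact ⟨⟨a, ha⟩, rfl⟩
  · intro u v huv
    obtain ⟨a, ha, b, hb, hab⟩ := hadj u v huv
    exact ⟨φ a, ⟨a, ha, rfl⟩, φ b, ⟨b, hb, rfl⟩, hab⟩

theorem connected_of_measure {γ : Type*} (G : SimpleGraph γ) (s : Set γ) (r : γ) (hr : r ∈ s)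
    (μ : γ → ℕ) (h : ∀ v ∈ s, v = r ∨ ∃ w ∈ s, μ w < μ v ∧ G.Adj v w) :
    (G.induce s).Connected := by
  have key : ∀ n, ∀ v : s, μ v.1 = n → (G.induce s).Reachable v ⟨r, hr⟩ := by
    intro n
    induction n using Nat.strong_induction_on with
    | _ n ih =>
      rintro ⟨v, hv⟩ hn
      rcases h v hv with rfl | ⟨w, hw, hlt, hadj⟩
      · exact Reachable.refl _
      · have h1 : (G.induce s).Adj ⟨v, hv⟩ ⟨w, hw⟩ := hadj
        exact h1.reachable.trans (ih (μ w) (by simp only at hn; omega) ⟨w, hw⟩ rfl)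
  have : Nonempty s := ⟨⟨r, hr⟩⟩
  refine ⟨fun a b => ?_⟩
  exact (key _ a rfl).trans (key _ b rfl).symm

theorem connected_union_adj {γ : Type*} {G : SimpleGraph γ} {s t : Set γ}
    (hs : (G.induce s).Connected) (ht : (G.induce t).Connected)
    {a b : γ} (ha : a ∈ s) (hb : b ∈ t) (hab : G.Adj a b) :
    (G.induce (s ∪ t)).Connected := by
  have h1 := induce_union_connected hs.preconnected
    (induce_pair_connected_of_adj hab).preconnected ⟨a, ha, by simp⟩
  have h2 := induce_union_connected h1.preconnected ht.preconnected ⟨b, by simp, hb⟩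
  have : s ∪ {a, b} ∪ t = s ∪ t := by
    ext x
    simp only [Set.mem_union, Set.mem_insert_iff, Set.mem_singleton_iff]
    constructor
    · rintro ((h | rfl | rfl) | h) <;> tauto
    · tauto
  rwa [this] at h2

/-- The vertical part of a strand. -/
def vert (R c : ℕ) : Set (ℕ × ℕ) := {p | p.1 < R ∧ p.2 = c}

/-- A horizontal segment. -/
def horiz (r c₀ c₁ : ℕ) : Set (ℕ × ℕ) := {p | p.1 = r ∧ c₀ ≤ p.2 ∧ p.2 < c₁}

/-- A U-turn of depth `d` hanging from columns `c₀ ≤ c₁` of the top row. -/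
def uturn (c₀ c₁ d : ℕ) : Set (ℕ × ℕ) :=
  {p | (p.1 ≤ d ∧ (p.2 = c₀ ∨ p.2 = c₁)) ∨ (p.1 = d ∧ c₀ ≤ p.2 ∧ p.2 ≤ c₁)}

/-- A graph on `ℕ × ℕ` containing the grid edges in the first `K` rows. -/
structure GridLike (G : SimpleGraph (ℕ × ℕ)) (K : ℕ) : Prop where
  v : ∀ r c, r + 1 < K → G.Adj (r, c) (r + 1, c)
  h : ∀ r c, G.Adj (r, c) (r, c + 1)

variable {G : SimpleGraph (ℕ × ℕ)} {K : ℕ}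

theorem GridLike.vert_conn (hG : GridLike G K) (R c : ℕ) (hR : R ≤ K) (h0 : 0 < R) :
    (G.induce (vert R c)).Connected := by
  refine connected_of_measure G _ (0, c) ⟨h0, rfl⟩ (fun p => p.1) ?_
  rintro ⟨r, c'⟩ ⟨h1, h2⟩
  simp only at h1 h2
  subst h2
  rcases r with _ | r
  · left; rfl
  · right
    exact ⟨(r, c'), ⟨by simp only; omega, rfl⟩, by simp, (hG.v r c' (by omega)).symm⟩

theorem GridLike.horiz_conn (hG : GridLike G K) (r c₀ c₁ : ℕ) (hc : c₀ < c₁) :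
    (G.induce (horiz r c₀ c₁)).Connected := by
  refine connected_of_measure G _ (r, c₀) ⟨rfl, by simp, hc⟩ (fun p => p.2) ?_
  rintro ⟨r', c⟩ ⟨h1, h2, h3⟩
  simp only at h1 h2 h3
  subst h1
  rcases h2.eq_or_lt with h4 | h4
  · left; rw [h4]
  · right
    obtain ⟨e, rfl⟩ : ∃ e, c = e + 1 := ⟨c - 1, by omega⟩
    exact ⟨(r', e), ⟨rfl, by simp only; omega, by simp only; omega⟩, by simp, (hG.h r' e).symm⟩

theorem GridLike.uturn_conn (hG : GridLike G K) (c₀ c₁ d : ℕ) (hc : c₀ ≤ c₁) (hd : d < K) :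
    (G.induce (uturn c₀ c₁ d)).Connected := by
  have e : uturn c₀ c₁ d = vert (d + 1) c₀ ∪ horiz d c₀ (c₁ + 1) ∪ vert (d + 1) c₁ := by
    ext ⟨r, c⟩
    simp only [uturn, vert, horiz, Set.mem_union, Set.mem_ofPred_eq]
    omega
  rw [e]
  refine induce_union_connected (induce_union_connected
    (hG.vert_conn _ _ (by omega) (by omega)).preconnected
    (hG.horiz_conn _ _ _ (by omega)).preconnected ⟨(d, c₀), ?_, ?_⟩).preconnected
    (hG.vert_conn _ _ (by omega) (by omega)).preconnected ⟨(d, c₁), ?_, ?_⟩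
  · simp [vert]
  · simp [horiz]; omega
  · simp [vert, horiz]; omega
  · simp [vert]

theorem uturn_disjoint {c₀ c₁ d c₀' c₁' d' : ℕ} (hc : c₀ ≤ c₁) (hc' : c₀' ≤ c₁')
    (h : c₁ < c₀' ∨ c₁' < c₀ ∨ (c₀ < c₀' ∧ c₁' < c₁ ∧ d' < d) ∨
      (c₀' < c₀ ∧ c₁ < c₁' ∧ d < d')) {p : ℕ × ℕ} (h1 : p ∈ uturn c₀ c₁ d)
    (h2 : p ∈ uturn c₀' c₁' d') : False := by
  simp only [uturn, Set.mem_ofPred_eq] at h1 h2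
  omega

/-- Parametrisation of the vertices of the big grid by pairs of naturals. -/
def phi (K N : ℕ) (hK : 0 < K) (p : ℕ × ℕ) : Fin K × ZMod N :=
  (⟨p.1 % K, Nat.mod_lt _ hK⟩, (p.2 : ZMod N))

theorem cast_inj {N a b : ℕ} (ha : 1 ≤ a) (ha' : a ≤ N) (hb : 1 ≤ b) (hb' : b ≤ N)
    (h : (a : ZMod N) = (b : ZMod N)) : a = b := by
  rw [ZMod.natCast_eq_natCast_iff'] at h
  rcases ha'.eq_or_lt with rfl | h1 <;> rcases hb'.eq_or_lt with h2 | h2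
  · exact h2.symm
  · rw [Nat.mod_self, Nat.mod_eq_of_lt h2] at h; omega
  · rw [h2, Nat.mod_self, Nat.mod_eq_of_lt h1] at h; omega
  · rwa [Nat.mod_eq_of_lt h2, Nat.mod_eq_of_lt h1] at h

theorem exists_col {N : ℕ} (hN : 0 < N) (x : ZMod N) :
    ∃ t : ℕ, 1 ≤ t ∧ t ≤ N ∧ (t : ZMod N) = x := by
  have : NeZero N := ⟨by omega⟩
  by_cases h : x.val = 0
  · refine ⟨N, hN, le_rfl, ?_⟩
    rw [ZMod.natCast_self]
    exact ((ZMod.val_eq_zero x).1 h).symm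
  · exact ⟨x.val, by omega, (ZMod.val_lt x).le, ZMod.natCast_zmod_val x⟩

theorem phi_injOn (K N : ℕ) (hK : 0 < K) :
    Set.InjOn (phi K N hK) {p | p.1 < K ∧ 1 ≤ p.2 ∧ p.2 ≤ N} := by
  rintro ⟨r, c⟩ ⟨h1, h2, h3⟩ ⟨r', c'⟩ ⟨h1', h2', h3'⟩ h
  simp only [phi, Prod.mk.injEq, Fin.mk.injEq] at h h1 h1' h2 h2' h3 h3'
  rw [Nat.mod_eq_of_lt h1, Nat.mod_eq_of_lt h1'] at h
  rw [h.1, cast_inj h2 h3 h2' h3' h.2]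

theorem source_gridLike (K n : ℕ) (hK : 0 < K) (hn : 0 < n) (Jh Jc : Finset ℕ) :
    GridLike ((mixedGrid K n Jh Jc).comap (phi K (4 * n * K) hK)) K := by
  have hN : 1 < 4 * n * K := by nlinarith [Nat.mul_pos hn hK]
  constructor
  · intro r c hr
    simp only [comap_adj, mixedGrid, fromRel_adj, phi]
    have h1 : (r + 1) % K = r + 1 := Nat.mod_eq_of_lt hr
    have h2 : r % K = r := Nat.mod_eq_of_lt (by omega)
    refine ⟨?_, Or.inl (Or.inr (Or.inl ⟨trivial, ?_⟩))⟩
    · simp [h1, h2]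
    · simp [h1, h2]
  · intro r c
    simp only [comap_adj, mixedGrid, fromRel_adj, phi]
    refine ⟨?_, Or.inl (Or.inl ⟨trivial, by simp⟩)⟩
    have : Fact (1 < 4 * n * K) := ⟨hN⟩
    simp

theorem source_wrap (K n : ℕ) (hK : 0 < K) (hn : 0 < n) (Jh Jc : Finset ℕ) (r : ℕ) :
    ((mixedGrid K n Jh Jc).comap (phi K (4 * n * K) hK)).Adj (r, 4 * n * K) (r, 1) := by
  have hN : 1 < 4 * n * K := by nlinarith [Nat.mul_pos hn hK]
  simp only [comap_adj, mixedGrid, fromRel_adj, phi]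
  have : Fact (1 < 4 * n * K) := ⟨hN⟩
  refine ⟨?_, Or.inl (Or.inl ⟨trivial, ?_⟩)⟩
  · simp only [ne_eq, Prod.mk.injEq, true_and]
    rw [ZMod.natCast_self]; simp
  · simp only [ZMod.natCast_self]; simp

theorem source_crosscap (K n : ℕ) (hK : 0 < K) (Jh Jc : Finset ℕ) (q c c' : ℕ)
    (hq : q + 1 ∈ Jc) (hqn : q + 1 ≤ n) (h1 : 4 * (K * q) < c) (h2 : c ≤ 4 * (K * q) + 2 * K)
    (h3 : c' = c + 2 * K) :
    ((mixedGrid K n Jh Jc).comap (phi K (4 * n * K) hK)).Adj (0, c) (0, c') := by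
  have hN : K * q + K ≤ n * K := by nlinarith
  have e : 4 * n * K = 4 * (n * K) := by ring
  have e' : 4 * K * q = 4 * (K * q) := by ring
  simp only [comap_adj, mixedGrid, fromRel_adj, phi]
  refine ⟨?_, Or.inl (Or.inr (Or.inr (Or.inr ⟨by simp, by simp, q + 1, hq, c - 4 * (K * q), ?_, ?_, ?_⟩)))⟩
  · intro h
    have := cast_inj (N := 4 * n * K) (by omega) (by omega) (by omega) (by omega) (Prod.ext_iff.1 h).2
    omega
  · rw [Finset.mem_Icc]; omega
  · congr 1; rw [Nat.add_sub_cancel, e']; omega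
  · congr 1; rw [Nat.add_sub_cancel, e']; omega

theorem source_handle (K n : ℕ) (hK : 0 < K) (Jh Jc : Finset ℕ) (q c c' : ℕ)
    (hq : q + 1 ∈ Jh) (hqn : q + 1 ≤ n)
    (h : (4 * (K * q) < c ∧ c ≤ 4 * (K * q) + K ∧ c + c' = 8 * (K * q) + 3 * K + 1) ∨
      (4 * (K * q) + K < c ∧ c ≤ 4 * (K * q) + 2 * K ∧ c + c' = 8 * (K * q) + 5 * K + 1)) :
    ((mixedGrid K n Jh Jc).comap (phi K (4 * n * K) hK)).Adj (0, c) (0, c') := by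
  have hN : K * q + K ≤ n * K := by nlinarith
  have e : 4 * n * K = 4 * (n * K) := by ring
  have e' : 4 * K * q = 4 * (K * q) := by ring
  simp only [comap_adj, mixedGrid, fromRel_adj, phi]
  refine ⟨?_, Or.inl (Or.inr (Or.inr (Or.inl ⟨by simp, by simp, q + 1, hq, ?_⟩)))⟩
  · intro h
    have := cast_inj (N := 4 * n * K) (by omega) (by omega) (by omega) (by omega) (Prod.ext_iff.1 h).2
    omega
  · rcases h with h | h
    · refine ⟨c - 4 * (K * q), by rw [Finset.mem_Icc]; omega, Or.inl ⟨?_, ?_⟩⟩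
      · congr 1; rw [Nat.add_sub_cancel, e']; omega
      · congr 1; rw [Nat.add_sub_cancel, e']; omega
    · refine ⟨c - 4 * (K * q) - K, by rw [Finset.mem_Icc]; omega, Or.inr ⟨?_, ?_⟩⟩
      · congr 1; rw [Nat.add_sub_cancel, e']; omega
      · congr 1; rw [Nat.add_sub_cancel, e']; omega

theorem linkage (k n n' R K : ℕ) (hk : 1 ≤ k) (hn : 1 ≤ n) (hn' : 1 ≤ n') (hR : 1 ≤ R)
    (hKR : K = R + k) (hK : 0 < K)
    (Ih Ic Jh Jc : Finset ℕ) (hIh : ∀ i ∈ Ih, 1 ≤ i ∧ i ≤ n) (hIc : ∀ i ∈ Ic, 1 ≤ i ∧ i ≤ n)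
    (f : ℕ → ℕ) (hf1 : f 1 = 1) (hfend : f (4 * n * k + 1) = 4 * n' * K + 1)
    (hmono : ∀ s t, 1 ≤ s → s < t → f s < f t)
    (P : ℕ → Set (ℕ × ℕ))
    (hPD : ∀ t, 1 ≤ t → t ≤ 4 * n * k → ∀ p ∈ P t, p.1 < R ∧ 1 ≤ p.2 ∧ p.2 ≤ 4 * n' * K)
    (hPmem : ∀ t, 1 ≤ t → t ≤ 4 * n * k → (R - 1, f t) ∈ P t)
    (hPdis : ∀ s t, 1 ≤ s → s ≤ 4 * n * k → 1 ≤ t → t ≤ 4 * n * k → s ≠ t →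
      ∀ p, p ∈ P s → p ∈ P t → False)
    (hPcon : ∀ t, 1 ≤ t → t ≤ 4 * n * k →
      (((mixedGrid K n' Jh Jc).comap (phi K (4 * n' * K) hK)).induce (P t)).Connected)
    (hPc : ∀ q s t, q + 1 ∈ Ic → 4 * (k * q) < s → s ≤ 4 * (k * q) + 2 * k → t = s + 2 * k →
      ∃ a ∈ P s, ∃ b ∈ P t, ((mixedGrid K n' Jh Jc).comap (phi K (4 * n' * K) hK)).Adj a b)
    (hPh : ∀ q s t, q + 1 ∈ Ih →
      ((4 * (k * q) < s ∧ s ≤ 4 * (k * q) + k ∧ s + t = 8 * (k * q) + 3 * k + 1) ∨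
      (4 * (k * q) + k < s ∧ s ≤ 4 * (k * q) + 2 * k ∧ s + t = 8 * (k * q) + 5 * k + 1)) →
      ∃ a ∈ P s, ∃ b ∈ P t, ((mixedGrid K n' Jh Jc).comap (phi K (4 * n' * K) hK)).Adj a b) :
    IsMinorOf (mixedGrid k n Ih Ic) (mixedGrid K n' Jh Jc) := by
  have hN : 0 < 4 * n * k := by positivity
  have hG := source_gridLike K n' hK hn' Jh Jc
  have hwrap := source_wrap K n' hK hn' Jh Jc
  set G := (mixedGrid K n' Jh Jc).comap (phi K (4 * n' * K) hK) with hGdef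
  choose col hcol1 hcol2 hcol3 using exists_col hN
  have hmono' : ∀ s t, 1 ≤ s → s ≤ t → f s ≤ f t := by
    intro s t h1 h2
    rcases h2.eq_or_lt with rfl | h
    · exact le_rfl
    · exact (hmono s t h1 h).le
  have coleq : ∀ (x : ZMod (4 * n * k)) (t : ℕ), 1 ≤ t → t ≤ 4 * n * k →
      x = (t : ZMod (4 * n * k)) → col x = t := by
    intro x t h1 h2 h3
    exact cast_inj (hcol1 x) (hcol2 x) h1 h2 ((hcol3 x).trans h3)
  let Y : Fin k × ZMod (4 * n * k) → Set (ℕ × ℕ) := fun u =>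
    horiz (R + u.1) (f (col u.2)) (f (col u.2 + 1)) ∪ {p | (u.1 : ℕ) = 0 ∧ p ∈ P (col u.2)}
  have hYmem : ∀ u : Fin k × ZMod (4 * n * k), ∀ c, f (col u.2) ≤ c → c < f (col u.2 + 1) →
      (R + (u.1 : ℕ), c) ∈ Y u := fun u c h1 h2 => Or.inl ⟨rfl, h1, h2⟩
  have hstep : ∀ x, f (col x) < f (col x + 1) := fun x => hmono _ _ (hcol1 x) (by omega)
  have hadj : ∀ u v : Fin k × ZMod (4 * n * k),
      ((u.1 = v.1 ∧ v.2 = u.2 + 1) ∨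
    (u.2 = v.2 ∧ (v.1 : ℕ) = (u.1 : ℕ) + 1) ∨
    ((u.1 : ℕ) = 0 ∧ (v.1 : ℕ) = 0 ∧ ∃ i ∈ Ih, ∃ j ∈ Finset.Icc 1 k,
      ((u.2 = ((4 * k * (i - 1) + j : ℕ) : ZMod (4 * n * k)) ∧
        v.2 = ((4 * k * (i - 1) + 3 * k - j + 1 : ℕ) : ZMod (4 * n * k))) ∨
       (u.2 = ((4 * k * (i - 1) + k + j : ℕ) : ZMod (4 * n * k)) ∧
        v.2 = ((4 * k * (i - 1) + 4 * k - j + 1 : ℕ) : ZMod (4 * n * k))))) ∨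
    ((u.1 : ℕ) = 0 ∧ (v.1 : ℕ) = 0 ∧ ∃ i ∈ Ic, ∃ j ∈ Finset.Icc 1 (2 * k),
      u.2 = ((4 * k * (i - 1) + j : ℕ) : ZMod (4 * n * k)) ∧
      v.2 = ((4 * k * (i - 1) + 2 * k + j : ℕ) : ZMod (4 * n * k)))) →
      ∃ a ∈ Y u, ∃ b ∈ Y v, G.Adj a b := by
    intro u v huv
    rcases huv with ⟨h1, h2⟩ | ⟨h1, h2⟩ | ⟨h1, h2, i, hi, j, hj, h⟩ | ⟨h1, h2, i, hi, j, hj, h3, h4⟩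
    · rcases (hcol2 u.2).eq_or_lt with h | h
      · have hv : col v.2 = 1 := by
          refine coleq _ 1 le_rfl hN ?_
          rw [h2, ← hcol3 u.2, h, ZMod.natCast_self]; simp
        refine ⟨_, hYmem u (4 * n' * K) ?_ ?_, _, hYmem v 1 ?_ ?_, ?_⟩
        · have := hstep u.2
          rw [h, hfend] at this
          rw [h]; omega
        · rw [h, hfend]; omega
        · rw [hv, hf1]
        · have := hstep v.2
          rw [hv, hf1] at this
          rw [hv]; omega
        · rw [h1]
          exact hwrap _
      · have hv : col v.2 = col u.2 + 1 := by
          refine coleq _ _ (by omega) h ?_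
          rw [h2]; push_cast; rw [hcol3 u.2]
        have hs := hstep u.2
        have hs' := hstep v.2
        refine ⟨_, hYmem u (f (col u.2 + 1) - 1) (by omega) (by omega), _,
          hYmem v (f (col u.2 + 1)) (by rw [hv]) (by rw [← hv]; exact hs'), ?_⟩
        rw [h1]
        have := hG.h (R + v.1) (f (col u.2 + 1) - 1)
        rwa [Nat.sub_add_cancel (by omega)] at this
    · refine ⟨_, hYmem u (f (col u.2)) le_rfl (hstep _), _,
          hYmem v (f (col u.2)) (by rw [h1]) (by rw [h1]; exact hstep _), ?_⟩
      rw [h2]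
      have := v.1.2
      exact hG.v _ _ (by omega)
    · obtain ⟨hi1, hi2⟩ := hIh i hi
      obtain ⟨q, rfl⟩ : ∃ q, i = q + 1 := ⟨i - 1, by omega⟩
      rw [Finset.mem_Icc] at hj
      have hb : k * q + k ≤ n * k := by nlinarith
      have e : 4 * n * k = 4 * (n * k) := by ring
      have e' : 4 * k * (q + 1 - 1) = 4 * (k * q) := by rw [Nat.add_sub_cancel]; ring
      rw [e'] at h
      rcases h with ⟨h3, h4⟩ | ⟨h3, h4⟩
      · have h3' := coleq _ _ (by omega) (by omega) h3
        have h4' := coleq _ _ (by omega) (by omega) h4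
        obtain ⟨a, ha, b, hb, hab⟩ := hPh q (col u.2) (col v.2) hi (by omega)
        exact ⟨a, Or.inr ⟨h1, ha⟩, b, Or.inr ⟨h2, hb⟩, hab⟩
      · have h3' := coleq _ _ (by omega) (by omega) h3
        have h4' := coleq _ _ (by omega) (by omega) h4
        obtain ⟨a, ha, b, hb, hab⟩ := hPh q (col u.2) (col v.2) hi (by omega)
        exact ⟨a, Or.inr ⟨h1, ha⟩, b, Or.inr ⟨h2, hb⟩, hab⟩
    · obtain ⟨hi1, hi2⟩ := hIc i hi
      obtain ⟨q, rfl⟩ : ∃ q, i = q + 1 := ⟨i - 1, by omega⟩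
      rw [Finset.mem_Icc] at hj
      have hb : k * q + k ≤ n * k := by nlinarith
      have e : 4 * n * k = 4 * (n * k) := by ring
      have e' : 4 * k * (q + 1 - 1) = 4 * (k * q) := by rw [Nat.add_sub_cancel]; ring
      rw [e'] at h3 h4
      have h3' := coleq _ _ (by omega) (by omega) h3
      have h4' := coleq _ _ (by omega) (by omega) h4
      obtain ⟨a, ha, b, hb, hab⟩ := hPc q (col u.2) (col v.2) hi (by omega) (by omega) (by omega)
      exact ⟨a, Or.inr ⟨h1, ha⟩, b, Or.inr ⟨h2, hb⟩, hab⟩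
  refine minor_of_param _ _ (phi K (4 * n' * K) hK) _ (phi_injOn K _ hK) Y ?_ ?_ ?_ ?_
  · rintro u ⟨r, c⟩ (⟨h1, h2, h3⟩ | ⟨h1, h2⟩)
    · simp only at h1 h2 h3
      have := u.1.2
      have a1 := hmono' 1 (col u.2) le_rfl (hcol1 _)
      have a2 := hmono' (col u.2 + 1) (4 * n * k + 1) (by omega) (by have := hcol2 u.2; omega)
      refine ⟨?_, ?_, ?_⟩ <;> simp only <;> omega
    · have := hPD _ (hcol1 _) (hcol2 _) _ h2
      exact ⟨by omega, this.2⟩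
  · intro u v huv
    have hne : (u.1 : ℕ) = v.1 → col u.2 ≠ col v.2 := by
      intro h1 h2
      apply huv
      refine Prod.ext (Fin.ext h1) ?_
      rw [← hcol3 u.2, h2, hcol3]
    rw [Set.disjoint_left]
    rintro p (⟨h1, h2, h3⟩ | ⟨h1, h2⟩) (⟨h1', h2', h3'⟩ | ⟨h1', h2'⟩)
    · rcases Nat.lt_or_gt_of_ne (hne (by omega)) with h | h
      · have := hmono' (col u.2 + 1) (col v.2) (by omega) h
        omega
      · have := hmono' (col v.2 + 1) (col u.2) (by omega) h
        omega
    · have := hPD _ (hcol1 _) (hcol2 _) _ h2'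
      omega
    · have := hPD _ (hcol1 _) (hcol2 _) _ h2
      omega
    · exact hPdis _ _ (hcol1 _) (hcol2 _) (hcol1 _) (hcol2 _) (hne (by omega)) p h2 h2'
  · intro u
    by_cases h0 : (u.1 : ℕ) = 0
    · have e : Y u = horiz R (f (col u.2)) (f (col u.2 + 1)) ∪ P (col u.2) := by
        ext p
        simp only [Y, h0, Set.mem_union, Set.mem_ofPred_eq, true_and, Nat.add_zero]
      rw [e]
      refine connected_union_adj (hG.horiz_conn _ _ _ (hstep _)) (hPcon _ (hcol1 _) (hcol2 _))
        (a := (R, f (col u.2))) ⟨rfl, le_rfl, hstep _⟩ (hPmem _ (hcol1 _) (hcol2 _)) ?_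
      have := hG.v (R - 1) (f (col u.2)) (by omega)
      rw [Nat.sub_add_cancel hR] at this
      exact this.symm
    · have e : Y u = horiz (R + u.1) (f (col u.2)) (f (col u.2 + 1)) := by
        ext p
        simp only [Y, h0, Set.mem_union, Set.mem_ofPred_eq, false_and, or_false]
      rw [e]
      exact hG.horiz_conn _ _ _ (hstep _)
  · intro u v huv
    rw [mixedGrid, fromRel_adj] at huv
    rcases huv.2 with h | h
    · exact hadj u v h
    · obtain ⟨a, ha, b, hb, hab⟩ := hadj v u h
      exact ⟨b, hb, a, ha, hab.symm⟩

open Classical in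
/-- Offsets of the selected columns inside an ordinary block. -/
noncomputable def gcol (k : ℕ) (hd : Prop) (o : ℕ) : ℕ :=
  if hd then (if o ≤ k then o else if o ≤ 2 * k then o + 17 * k
    else if o ≤ 3 * k then o + 51 * k else o + 68 * k)
  else (if o ≤ 2 * k then o else o + 34 * k)

/-- The selected column for offset `o` of block `q`; `a` is the (0-based) special block. -/
noncomputable def Fcol (k a : ℕ) (Ih : Finset ℕ) (q o : ℕ) : ℕ :=
  if q < a then 72 * (k * q) + gcol k (q + 1 ∈ Ih) o
  else if q = a then 72 * (k * a) + (if o ≤ k then o else if o ≤ 2 * k then 77 * k + o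
    else if o ≤ 3 * k then 108 * k + o else 179 * k + o)
  else if q = a + 1 then 72 * (k * a) + 184 * k + o
  else 72 * (k * q) + 72 * k + gcol k (q + 1 ∈ Ih) o

/-- The selected column for the column `t` of the small grid. -/
noncomputable def fcol (k a : ℕ) (Ih : Finset ℕ) (t : ℕ) : ℕ :=
  Fcol k a Ih ((t - 1) / (4 * k)) (t - 4 * (k * ((t - 1) / (4 * k))))

theorem fcol_eq (k a : ℕ) (hk : 1 ≤ k) (Ih : Finset ℕ) (q o : ℕ) (h1 : 1 ≤ o) (h2 : o ≤ 4 * k) :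
    fcol k a Ih (4 * (k * q) + o) = Fcol k a Ih q o := by
  have : (4 * (k * q) + o - 1) / (4 * k) = q := by
    rw [Nat.div_eq_iff (by omega)]
    have : q * (4 * k) = 4 * (k * q) := by ring
    omega
  rw [fcol, this]
  congr 1
  omega

theorem exists_qo (k : ℕ) (hk : 1 ≤ k) (t : ℕ) (ht : 1 ≤ t) :
    ∃ q o, 1 ≤ o ∧ o ≤ 4 * k ∧ t = 4 * (k * q) + o := by
  have h1 := Nat.div_add_mod (t - 1) (4 * k)
  have h2 := Nat.mod_lt (t - 1) (show 0 < 4 * k by omega)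
  refine ⟨(t - 1) / (4 * k), (t - 1) % (4 * k) + 1, by omega, by omega, ?_⟩
  have : 4 * k * ((t - 1) / (4 * k)) = 4 * (k * ((t - 1) / (4 * k))) := by ring
  omega

theorem gcol_bd (k : ℕ) (hd : Prop) (o : ℕ) (h1 : 1 ≤ o) (h2 : o ≤ 4 * k) :
    1 ≤ gcol k hd o ∧ gcol k hd o ≤ 72 * k := by
  unfold gcol
  split_ifs <;> omega

theorem gcol_mono (k : ℕ) (hd : Prop) (o o' : ℕ) (h : o < o') :
    gcol k hd o < gcol k hd o' := by
  unfold gcol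
  split_ifs <;> omega

/-- Left ends of the column ranges of the blocks. -/
def Lcol (k a q : ℕ) : ℕ :=
  if q ≤ a then 72 * (k * q) else if q = a + 1 then 72 * (k * a) + 184 * k
  else 72 * (k * q) + 72 * k

theorem Lcol_le {k a q : ℕ} (h : q ≤ a) : Lcol k a q = 72 * (k * q) := by
  simp [Lcol, h]

theorem Lcol_mid (k a : ℕ) : Lcol k a (a + 1) = 72 * (k * a) + 184 * k := by
  simp [Lcol]

theorem Lcol_gt {k a q : ℕ} (h : a + 1 < q) : Lcol k a q = 72 * (k * q) + 72 * k := by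
  rw [Lcol, if_neg (by omega), if_neg (by omega)]

theorem Fcol_lt {k a : ℕ} {Ih : Finset ℕ} {q : ℕ} (o : ℕ) (h : q < a) :
    Fcol k a Ih q o = 72 * (k * q) + gcol k (q + 1 ∈ Ih) o := by
  rw [Fcol, if_pos h]

theorem Fcol_a (k a : ℕ) (Ih : Finset ℕ) (o : ℕ) :
    Fcol k a Ih a o = 72 * (k * a) + (if o ≤ k then o else if o ≤ 2 * k then 77 * k + o
    else if o ≤ 3 * k then 108 * k + o else 179 * k + o) := by
  rw [Fcol, if_neg (lt_irrefl a), if_pos rfl]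

theorem Fcol_mid (k a : ℕ) (Ih : Finset ℕ) (o : ℕ) :
    Fcol k a Ih (a + 1) o = 72 * (k * a) + 184 * k + o := by
  rw [Fcol, if_neg (by omega), if_neg (by omega), if_pos rfl]

theorem Fcol_gt {k a : ℕ} {Ih : Finset ℕ} {q : ℕ} (o : ℕ) (h : a + 1 < q) :
    Fcol k a Ih q o = 72 * (k * q) + 72 * k + gcol k (q + 1 ∈ Ih) o := by
  rw [Fcol, if_neg (by omega), if_neg (by omega), if_neg (by omega)]

theorem Fcol_bd (k a : ℕ) (Ih : Finset ℕ) (q o : ℕ) (h1 : 1 ≤ o)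
    (h2 : o ≤ 4 * k) : Lcol k a q < Fcol k a Ih q o ∧ Fcol k a Ih q o ≤ Lcol k a (q + 1) := by
  have hg := gcol_bd k (q + 1 ∈ Ih) o h1 h2
  have e : k * (q + 1) = k * q + k := by ring
  rcases Nat.lt_trichotomy q a with h | rfl | h
  · rw [Lcol_le h.le, Lcol_le h, Fcol_lt o h, e]
    omega
  · rw [Lcol_le le_rfl, Lcol_mid, Fcol_a]
    split_ifs <;> omega
  · rcases Nat.eq_or_lt_of_le h with h' | h'
    · obtain rfl : q = a + 1 := by omega
      have e2 : k * (a + 1) = k * a + k := by ring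
      rw [Lcol_mid, Lcol_gt (by omega), Fcol_mid, e, e2]
      omega
    · rw [Lcol_gt h', Lcol_gt (by omega), Fcol_gt o h', e]
      omega

theorem Lcol_mono (k a q q' : ℕ) (h : q ≤ q') : Lcol k a q ≤ Lcol k a q' := by
  have key : ∀ q, Lcol k a q ≤ Lcol k a (q + 1) := by
    intro q
    have e : k * (q + 1) = k * q + k := by ring
    rcases Nat.lt_trichotomy q a with h | rfl | h
    · rw [Lcol_le h.le, Lcol_le h, e]
      omega
    · rw [Lcol_le le_rfl, Lcol_mid]
      omega
    · rcases Nat.eq_or_lt_of_le h with h' | h'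
      · obtain rfl : q = a + 1 := by omega
        have e2 : k * (a + 1) = k * a + k := by ring
        rw [Lcol_mid, Lcol_gt (by omega), e, e2]
        omega
      · rw [Lcol_gt h', Lcol_gt (by omega), e]
        omega
  exact monotone_nat_of_le_succ key h

theorem fcol_mono (k a : ℕ) (hk : 1 ≤ k) (Ih : Finset ℕ) (s t : ℕ) (hs : 1 ≤ s) (hst : s < t) :
    fcol k a Ih s < fcol k a Ih t := by
  obtain ⟨q, o, h1, h2, rfl⟩ := exists_qo k hk s hs
  obtain ⟨q', o', h1', h2', rfl⟩ := exists_qo k hk t (by omega)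
  rw [fcol_eq k a hk Ih q o h1 h2, fcol_eq k a hk Ih q' o' h1' h2']
  rcases Nat.lt_trichotomy q q' with h | rfl | h
  · have b1 := Fcol_bd k a Ih q o h1 h2
    have b2 := Fcol_bd k a Ih q' o' h1' h2'
    have := Lcol_mono k a (q + 1) q' h
    omega
  · have hg := gcol_mono k (q + 1 ∈ Ih) o o' (by omega)
    unfold Fcol
    split_ifs <;> omega
  · have : k * q' + k ≤ k * q := by nlinarith
    omega

theorem fcol_spec (k a : ℕ) (hk : 1 ≤ k) (Ih : Finset ℕ) (t : ℕ) (ht : 1 ≤ t) :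
    fcol k a Ih t ≤ 72 * (k * a) ∨
    (72 * (k * a) < fcol k a Ih t ∧ fcol k a Ih t ≤ 72 * (k * a) + k) ∨
    (72 * (k * a) + 78 * k < fcol k a Ih t ∧ fcol k a Ih t ≤ 72 * (k * a) + 79 * k) ∨
    (72 * (k * a) + 110 * k < fcol k a Ih t ∧ fcol k a Ih t ≤ 72 * (k * a) + 111 * k) ∨
    72 * (k * a) + 182 * k < fcol k a Ih t := by
  obtain ⟨q, o, h1, h2, rfl⟩ := exists_qo k hk t ht
  rw [fcol_eq k a hk Ih q o h1 h2]
  rcases Nat.lt_trichotomy q a with h | rfl | h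
  · left
    have b1 := Fcol_bd k a Ih q o h1 h2
    have := Lcol_mono k a (q + 1) a h
    have e : Lcol k a a = 72 * (k * a) := by simp [Lcol]
    omega
  · unfold Fcol
    rw [if_neg (by omega), if_pos rfl]
    split_ifs <;> omega
  · have b1 := Fcol_bd k a Ih q o h1 h2
    have := Lcol_mono k a (a + 1) q h
    have e : Lcol k a (a + 1) = 72 * (k * a) + 184 * k := by simp [Lcol]
    omega

/-- The U-turns used by the strand starting at column `t` of the small grid. -/
def US (k m t c₀ c₁ d : ℕ) : Prop :=
  (4 * m < t ∧ t ≤ 4 * m + k ∧ ∃ j, t = 4 * m + j ∧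
    c₀ = 72 * m + 36 * k + j ∧ c₁ + j = 72 * m + 75 * k + 1 ∧ d + j = 5 * k) ∨
  (4 * m + k < t ∧ t ≤ 4 * m + 2 * k ∧ ∃ j, t = 4 * m + k + j ∧
    c₀ = 72 * m + 114 * k + j ∧ c₁ + j = 72 * m + 147 * k + 1 ∧ d + j = 5 * k) ∨
  (4 * m + 4 * k < t ∧ t ≤ 4 * m + 6 * k ∧ ∃ j, t = 4 * m + 4 * k + j ∧
    ((c₀ + j = 72 * m + 114 * k + 1 ∧ c₁ = 72 * m + 148 * k + j ∧ d + 1 = 6 * k + j) ∨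
     (c₀ = 72 * m + 2 * k + j ∧ c₁ + j = 72 * m + 78 * k + 1 ∧ d + j = 8 * k) ∨
     (c₀ = 72 * m + 38 * k + j ∧ c₁ + j = 72 * m + 74 * k + 1 ∧ d + j = 2 * k) ∨
     (c₀ = 72 * m + 80 * k + j ∧ c₁ + j = 72 * m + 110 * k + 1 ∧ d + j = 2 * k) ∨
     (c₀ = 72 * m + 116 * k + j ∧ c₁ + j = 72 * m + 146 * k + 1 ∧ d + j = 2 * k) ∨
     (c₀ = 72 * m + 150 * k + j ∧ c₁ + j = 72 * m + 182 * k + 1 ∧ d + j = 2 * k)))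

theorem US_bd {k m t c₀ c₁ d : ℕ} (h : US k m t c₀ c₁ d) :
    c₀ ≤ c₁ ∧ d < 17 * k ∧ 72 * m < c₀ ∧ c₁ ≤ 72 * m + 182 * k := by
  rcases h with ⟨h1, h2, j, h3, h4⟩ | ⟨h1, h2, j, h3, h4⟩ |
    ⟨h1, h2, j, h3, (h4 | h4 | h4 | h4 | h4 | h4)⟩ <;> omega

theorem US_f {k m t c₀ c₁ d : ℕ} (h : US k m t c₀ c₁ d) (c : ℕ)
    (hc : c ≤ 72 * m ∨ (72 * m < c ∧ c ≤ 72 * m + k) ∨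
    (72 * m + 78 * k < c ∧ c ≤ 72 * m + 79 * k) ∨
    (72 * m + 110 * k < c ∧ c ≤ 72 * m + 111 * k) ∨
    72 * m + 182 * k < c) : c < c₀ ∨ c₁ < c := by
  rcases h with ⟨h1, h2, j, h3, h4⟩ | ⟨h1, h2, j, h3, h4⟩ |
    ⟨h1, h2, j, h3, (h4 | h4 | h4 | h4 | h4 | h4)⟩ <;> omega

theorem US_disj {k m t c₀ c₁ d t' c₀' c₁' d' : ℕ} (h : US k m t c₀ c₁ d)
    (h' : US k m t' c₀' c₁' d') (hne : t ≠ t') :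
    c₁ < c₀' ∨ c₁' < c₀ ∨ (c₀ < c₀' ∧ c₁' < c₁ ∧ d' < d) ∨ (c₀' < c₀ ∧ c₁ < c₁' ∧ d < d') := by
  rcases h with ⟨h1, h2, j, h3, h4⟩ | ⟨h1, h2, j, h3, h4⟩ |
    ⟨h1, h2, j, h3, (h4 | h4 | h4 | h4 | h4 | h4)⟩ <;>
  rcases h' with ⟨h1', h2', j', h3', h4'⟩ | ⟨h1', h2', j', h3', h4'⟩ |
    ⟨h1', h2', j', h3', (h4' | h4' | h4' | h4' | h4' | h4')⟩ <;> omega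

/-- The strand attached to column `t` of the small grid. -/
def strand (k a : ℕ) (Ih : Finset ℕ) (t : ℕ) : Set (ℕ × ℕ) :=
  vert (17 * k) (fcol k a Ih t) ∪ {p | ∃ c₀ c₁ d, US k (k * a) t c₀ c₁ d ∧ p ∈ uturn c₀ c₁ d}

theorem strand_disj (k a : ℕ) (hk : 1 ≤ k) (Ih : Finset ℕ) (s t : ℕ) (hs : 1 ≤ s) (ht : 1 ≤ t)
    (hst : s ≠ t) (p : ℕ × ℕ) (h1 : p ∈ strand k a Ih s) (h2 : p ∈ strand k a Ih t) : False := by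
  rcases h1 with ⟨h1, h1'⟩ | ⟨c₀, c₁, d, h1, h1'⟩ <;>
  rcases h2 with ⟨h2, h2'⟩ | ⟨c₀', c₁', d', h2, h2'⟩
  · rcases Nat.lt_or_gt_of_ne hst with h | h
    · have := fcol_mono k a hk Ih s t hs h; omega
    · have := fcol_mono k a hk Ih t s ht h; omega
  · have := US_f h2 _ (fcol_spec k a hk Ih s hs)
    have := US_bd h2
    simp only [uturn, Set.mem_ofPred_eq] at h2'
    omega
  · have := US_f h1 _ (fcol_spec k a hk Ih t ht)
    have := US_bd h1
    simp only [uturn, Set.mem_ofPred_eq] at h1'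
    omega
  · exact uturn_disjoint (US_bd h1).1 (US_bd h2).1 (US_disj h1 h2 hst) h1' h2'

theorem left_mem (c₀ c₁ d : ℕ) : (0, c₀) ∈ uturn c₀ c₁ d := by simp [uturn]

theorem right_mem (c₀ c₁ d : ℕ) : (0, c₁) ∈ uturn c₀ c₁ d := by simp [uturn]

theorem GridLike.chain (hG : GridLike G K) {V : Set (ℕ × ℕ)} (hV : (G.induce V).Connected)
    {c : ℕ} (hc : (0, c) ∈ V) {x₁ y₁ d₁ x₂ y₂ d₂ x₃ y₃ d₃ x₄ y₄ d₄ x₅ y₅ d₅ x₆ y₆ d₆ : ℕ}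
    (h₁ : x₁ ≤ y₁ ∧ d₁ < K) (h₂ : x₂ ≤ y₂ ∧ d₂ < K) (h₃ : x₃ ≤ y₃ ∧ d₃ < K)
    (h₄ : x₄ ≤ y₄ ∧ d₄ < K) (h₅ : x₅ ≤ y₅ ∧ d₅ < K) (h₆ : x₆ ≤ y₆ ∧ d₆ < K)
    (a₁ : G.Adj (0, c) (0, y₁)) (a₂ : G.Adj (0, x₁) (0, y₂)) (a₃ : G.Adj (0, x₂) (0, x₃))
    (a₄ : G.Adj (0, y₃) (0, y₄)) (a₅ : G.Adj (0, x₄) (0, x₅)) (a₆ : G.Adj (0, y₅) (0, y₆)) :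
    (G.induce (V ∪ uturn x₁ y₁ d₁ ∪ uturn x₂ y₂ d₂ ∪ uturn x₃ y₃ d₃ ∪ uturn x₄ y₄ d₄ ∪
      uturn x₅ y₅ d₅ ∪ uturn x₆ y₆ d₆)).Connected := by
  have u₁ := hG.uturn_conn x₁ y₁ d₁ h₁.1 h₁.2
  have u₂ := hG.uturn_conn x₂ y₂ d₂ h₂.1 h₂.2
  have u₃ := hG.uturn_conn x₃ y₃ d₃ h₃.1 h₃.2
  have u₄ := hG.uturn_conn x₄ y₄ d₄ h₄.1 h₄.2
  have u₅ := hG.uturn_conn x₅ y₅ d₅ h₅.1 h₅.2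
  have u₆ := hG.uturn_conn x₆ y₆ d₆ h₆.1 h₆.2
  have r₁ := connected_union_adj hV u₁ hc (right_mem _ _ _) a₁
  have r₂ := connected_union_adj r₁ u₂ (Or.inr (left_mem _ _ _)) (right_mem _ _ _) a₂
  have r₃ := connected_union_adj r₂ u₃ (Or.inr (left_mem _ _ _)) (left_mem _ _ _) a₃
  have r₄ := connected_union_adj r₃ u₄ (Or.inr (right_mem _ _ _)) (right_mem _ _ _) a₄
  have r₅ := connected_union_adj r₄ u₅ (Or.inr (left_mem _ _ _)) (left_mem _ _ _) a₅
  exact connected_union_adj r₅ u₆ (Or.inr (right_mem _ _ _)) (right_mem _ _ _) a₆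

set_option maxHeartbeats 1000000 in
theorem strand_conn (k a : ℕ) (hk : 1 ≤ k) (Ih : Finset ℕ) (G : SimpleGraph (ℕ × ℕ))
    (hG : GridLike G (18 * k))
    (hcc : ∀ x c c', x ≤ 2 → 72 * (k * a) + 72 * k * x < c →
      c ≤ 72 * (k * a) + 72 * k * x + 36 * k → c' = c + 36 * k → G.Adj (0, c) (0, c'))
    (t : ℕ) (ht : 1 ≤ t) : (G.induce (strand k a Ih t)).Connected := by
  have ca := fun c c' => hcc 0 c c' (by omega)
  have cb := fun c c' => hcc 1 c c' (by omega)
  have cc := fun c c' => hcc 2 c c' (by omega)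
  have hv := hG.vert_conn (17 * k) (fcol k a Ih t) (by omega) (by omega)
  have hv0 : (0, fcol k a Ih t) ∈ vert (17 * k) (fcol k a Ih t) := ⟨by simp only; omega, rfl⟩
  have e1 : k * (a + 1) = k * a + k := by ring
  by_cases hA : 4 * (k * a) < t ∧ t ≤ 4 * (k * a) + k
  · obtain ⟨j, rfl⟩ : ∃ j, t = 4 * (k * a) + j := ⟨t - 4 * (k * a), by omega⟩
    have hf : fcol k a Ih (4 * (k * a) + j) = 72 * (k * a) + j := by
      rw [fcol_eq k a hk Ih a j (by omega) (by omega), Fcol_a,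
        if_pos (by omega)]
    have e : strand k a Ih (4 * (k * a) + j) = vert (17 * k) (fcol k a Ih (4 * (k * a) + j)) ∪
        uturn (72 * (k * a) + 36 * k + j) (72 * (k * a) + 75 * k + 1 - j) (5 * k - j) := by
      ext p
      rw [strand, Set.mem_union, Set.mem_union]
      refine or_congr Iff.rfl ⟨?_, ?_⟩
      · rintro ⟨c₀, c₁, d, h, hp⟩
        obtain ⟨q1, q2, q3⟩ : c₀ = 72 * (k * a) + 36 * k + j ∧ c₁ = 72 * (k * a) + 75 * k + 1 - j ∧ d = 5 * k - j := by
          rcases h with ⟨h1, h2, j', h3, h4⟩ | ⟨h1, h2, j', h3, h4⟩ | ⟨h1, h2, j', h3, h4⟩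
          · omega
          · omega
          · clear h4; omega
        rwa [← q1, ← q2, ← q3]
      · intro hp
        exact ⟨_, _, _, Or.inl ⟨by omega, by omega, j, rfl, rfl, by omega, by omega⟩, hp⟩
    rw [e]
    refine connected_union_adj hv (hG.uturn_conn _ _ _ (by omega) (by omega)) hv0
      (left_mem _ _ _) ?_
    rw [hf]
    exact ca _ _ (by omega) (by omega) (by omega)
  by_cases hB : 4 * (k * a) + k < t ∧ t ≤ 4 * (k * a) + 2 * k
  · obtain ⟨j, rfl⟩ : ∃ j, t = 4 * (k * a) + k + j := ⟨t - 4 * (k * a) - k, by omega⟩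
    have hf : fcol k a Ih (4 * (k * a) + k + j) = 72 * (k * a) + 78 * k + j := by
      rw [add_assoc, fcol_eq k a hk Ih a (k + j) (by omega) (by omega), Fcol_a,
        if_neg (by omega), if_pos (by omega)]
      omega
    have e : strand k a Ih (4 * (k * a) + k + j) =
        vert (17 * k) (fcol k a Ih (4 * (k * a) + k + j)) ∪
        uturn (72 * (k * a) + 114 * k + j) (72 * (k * a) + 147 * k + 1 - j) (5 * k - j) := by
      ext p
      rw [strand, Set.mem_union, Set.mem_union]
      refine or_congr Iff.rfl ⟨?_, ?_⟩
      · rintro ⟨c₀, c₁, d, h, hp⟩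
        obtain ⟨q1, q2, q3⟩ : c₀ = 72 * (k * a) + 114 * k + j ∧ c₁ = 72 * (k * a) + 147 * k + 1 - j ∧ d = 5 * k - j := by
          rcases h with ⟨h1, h2, j', h3, h4⟩ | ⟨h1, h2, j', h3, h4⟩ | ⟨h1, h2, j', h3, h4⟩
          · omega
          · omega
          · clear h4; omega
        rwa [← q1, ← q2, ← q3]
      · intro hp
        exact ⟨_, _, _, Or.inr (Or.inl ⟨by omega, by omega, j, rfl, rfl, by omega, by omega⟩), hp⟩
    rw [e]
    refine connected_union_adj hv (hG.uturn_conn _ _ _ (by omega) (by omega)) hv0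
      (left_mem _ _ _) ?_
    rw [hf]
    exact cb _ _ (by omega) (by omega) (by omega)
  by_cases hC : 4 * (k * a) + 4 * k < t ∧ t ≤ 4 * (k * a) + 6 * k
  · obtain ⟨j, rfl⟩ : ∃ j, t = 4 * (k * a) + 4 * k + j := ⟨t - 4 * (k * a) - 4 * k, by omega⟩
    have hf : fcol k a Ih (4 * (k * a) + 4 * k + j) = 72 * (k * a) + 184 * k + j := by
      have := fcol_eq k a hk Ih (a + 1) j (by omega) (by omega)
      rw [e1, Fcol_mid, mul_add] at this
      exact this
    have e : strand k a Ih (4 * (k * a) + 4 * k + j) =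
        vert (17 * k) (fcol k a Ih (4 * (k * a) + 4 * k + j)) ∪
        uturn (72 * (k * a) + 114 * k + 1 - j) (72 * (k * a) + 148 * k + j) (6 * k + j - 1) ∪
        uturn (72 * (k * a) + 2 * k + j) (72 * (k * a) + 78 * k + 1 - j) (8 * k - j) ∪
        uturn (72 * (k * a) + 38 * k + j) (72 * (k * a) + 74 * k + 1 - j) (2 * k - j) ∪
        uturn (72 * (k * a) + 80 * k + j) (72 * (k * a) + 110 * k + 1 - j) (2 * k - j) ∪
        uturn (72 * (k * a) + 116 * k + j) (72 * (k * a) + 146 * k + 1 - j) (2 * k - j) ∪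
        uturn (72 * (k * a) + 150 * k + j) (72 * (k * a) + 182 * k + 1 - j) (2 * k - j) := by
      ext p
      rw [strand]
      simp only [Set.mem_union, or_assoc]
      refine or_congr Iff.rfl ⟨?_, ?_⟩
      · rintro ⟨c₀, c₁, d, h | h | ⟨h1, h2, j', h3, h⟩, hp⟩
        · omega
        · omega
        · obtain rfl : j' = j := by omega
          have sub : ∀ x y z, c₀ = x → c₁ = y → d = z → p ∈ uturn x y z := by
            rintro x y z rfl rfl rfl; exact hp
          rcases h with h | h | h | h | h | h
          · exact Or.inl (sub _ _ _ (by omega) (by omega) (by omega))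
          · exact Or.inr (Or.inl (sub _ _ _ (by omega) (by omega) (by omega)))
          · exact Or.inr (Or.inr (Or.inl (sub _ _ _ (by omega) (by omega) (by omega))))
          · exact Or.inr (Or.inr (Or.inr (Or.inl (sub _ _ _ (by omega) (by omega) (by omega)))))
          · exact Or.inr (Or.inr (Or.inr (Or.inr (Or.inl
              (sub _ _ _ (by omega) (by omega) (by omega))))))
          · exact Or.inr (Or.inr (Or.inr (Or.inr (Or.inr
              (sub _ _ _ (by omega) (by omega) (by omega))))))
      · rintro (hp | hp | hp | hp | hp | hp) <;>
          refine ⟨_, _, _, Or.inr (Or.inr ⟨by omega, by omega, j, rfl, ?_⟩), hp⟩ <;> omega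
    rw [e]
    refine hG.chain hv hv0 (by omega) (by omega) (by omega) (by omega) (by omega) (by omega)
      ?_ ?_ ?_ ?_ ?_ ?_
    · rw [hf]
      exact (cc _ _ (by omega) (by omega) (by omega)).symm
    · exact (cb _ _ (by omega) (by omega) (by omega)).symm
    · exact ca _ _ (by omega) (by omega) (by omega)
    · exact cb _ _ (by omega) (by omega) (by omega)
    · exact cb _ _ (by omega) (by omega) (by omega)
    · exact cc _ _ (by omega) (by omega) (by omega)
  · have e : strand k a Ih t = vert (17 * k) (fcol k a Ih t) := by
      ext p
      rw [strand, Set.mem_union]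
      refine ⟨?_, Or.inl⟩
      rintro (h | ⟨c₀, c₁, d, h, hp⟩)
      · exact h
      · rcases h with ⟨h1, h2, _⟩ | ⟨h1, h2, _⟩ | ⟨h1, h2, _⟩ <;> omega
    rw [e]
    exact hv

theorem minor_main (k a n : ℕ) (hk : 1 ≤ k) (han : a + 2 ≤ n) (Ih Ic Jh Jc : Finset ℕ)
    (hIh : ∀ i ∈ Ih, 1 ≤ i ∧ i ≤ n) (hIc : ∀ i ∈ Ic, 1 ≤ i ∧ i ≤ n) (hd : Disjoint Ih Ic)
    (haIh : a + 1 ∈ Ih) (haIc : a + 2 ∈ Ic)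
    (hh1 : ∀ q, q < a → q + 1 ∈ Ih → q + 1 ∈ Jh)
    (hh2 : ∀ q, a + 1 < q → q + 1 ∈ Ih → q + 2 ∈ Jh)
    (hc1 : ∀ q, q < a → q + 1 ∈ Ic → q + 1 ∈ Jc)
    (hc2 : ∀ q, a + 1 < q → q + 1 ∈ Ic → q + 2 ∈ Jc)
    (ha1 : a + 1 ∈ Jc) (ha2 : a + 2 ∈ Jc) (ha3 : a + 3 ∈ Jc) :
    IsMinorOf (mixedGrid k n Ih Ic) (mixedGrid (18 * k) (n + 1) Jh Jc) := by
  have hK : 0 < 18 * k := by omega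
  have hG := source_gridLike (18 * k) (n + 1) hK (by omega) Jh Jc
  have hsc := source_crosscap (18 * k) (n + 1) hK Jh Jc
  have hsh := source_handle (18 * k) (n + 1) hK Jh Jc
  have em : ∀ q, 18 * k * q = 18 * (k * q) := fun q => by ring
  have e1 : k * (a + 1) = k * a + k := by ring
  have e2 : k * (a + 2) = k * a + 2 * k := by ring
  simp only [em] at hsc hsh
  have hv0 : ∀ t, (0, fcol k a Ih t) ∈ strand k a Ih t :=
    fun t => Or.inl ⟨by simp only; omega, rfl⟩
  have eN : 4 * (n + 1) * (18 * k) = 72 * (k * n) + 72 * k := by ring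
  have eN' : 4 * n * k = 4 * (k * n) := by ring
  have hend : fcol k a Ih (4 * n * k + 1) = 4 * (n + 1) * (18 * k) + 1 := by
    rw [eN', fcol_eq k a hk Ih n 1 le_rfl (by omega), eN]
    rcases Nat.eq_or_lt_of_le han with h | h
    · rw [Fcol_gt 1 (by omega), gcol]
      split_ifs <;> omega
    · rw [Fcol_gt 1 (by omega), gcol]
      split_ifs <;> omega
  have h11 : fcol k a Ih 1 = 1 := by
    have := fcol_eq k a hk Ih 0 1 le_rfl (by omega)
    rw [Nat.mul_zero] at this
    rw [this]
    rcases Nat.eq_zero_or_pos a with h | h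
    · subst h
      rw [Fcol_a, if_pos hk]; simp
    · rw [Fcol_lt 1 h, gcol]
      split_ifs <;> omega
  refine linkage k n (n + 1) (17 * k) (18 * k) hk (by omega) (by omega) (by omega) (by omega) hK
    Ih Ic Jh Jc hIh hIc (fcol k a Ih) h11 hend (fcol_mono k a hk Ih) (strand k a Ih)
    ?_ ?_ ?_ ?_ ?_ ?_
  · intro t ht1 ht2 p hp
    have hlo : 1 ≤ fcol k a Ih t := by
      rcases ht1.eq_or_lt with rfl | h
      · exact h11.ge
      · have := fcol_mono k a hk Ih 1 t le_rfl h
        omega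
    have hhi := fcol_mono k a hk Ih t (4 * n * k + 1) ht1 (by omega)
    rw [hend] at hhi
    rcases hp with ⟨h1, h2⟩ | ⟨c₀, c₁, d, h, hp⟩
    · exact ⟨h1, by omega, by omega⟩
    · have hb := US_bd h
      have : k * (a + 2) ≤ k * n := Nat.mul_le_mul_left k han
      rw [eN]
      simp only [uturn, Set.mem_ofPred_eq] at hp
      omega
  · intro t _ _
    exact Or.inl ⟨by simp only; omega, rfl⟩
  · intro s t hs _ ht _ hst p h1 h2
    exact strand_disj k a hk Ih s t hs ht hst p h1 h2
  · intro t ht _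
    refine strand_conn k a hk Ih _ hG ?_ t ht
    intro x c c' hx h1 h2 h3
    obtain rfl | rfl | rfl : x = 0 ∨ x = 1 ∨ x = 2 := by omega
    · exact hsc a c c' ha1 (by omega) (by omega) (by omega) (by omega)
    · exact hsc (a + 1) c c' ha2 (by omega) (by omega) (by omega) (by omega)
    · exact hsc (a + 2) c c' ha3 (by omega) (by omega) (by omega) (by omega)
  · intro q s t hq h1 h2 h3
    have hqn := (hIc _ hq).2
    have hnh : q + 1 ∉ Ih := fun h => Finset.disjoint_left.1 hd h hq
    obtain ⟨o, rfl⟩ : ∃ o, s = 4 * (k * q) + o := ⟨s - 4 * (k * q), by omega⟩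
    obtain rfl : t = 4 * (k * q) + (o + 2 * k) := by omega
    have f1 := fcol_eq k a hk Ih q o (by omega) (by omega)
    have f2 := fcol_eq k a hk Ih q (o + 2 * k) (by omega) (by omega)
    rcases Nat.lt_trichotomy q a with h | rfl | h
    · refine ⟨_, hv0 _, _, hv0 _, ?_⟩
      rw [f1, f2, Fcol_lt _ h, Fcol_lt _ h, gcol, gcol, if_neg hnh, if_neg hnh,
        if_pos (by omega), if_neg (by omega)]
      exact hsc q _ _ (hc1 q h hq) (by omega) (by omega) (by omega) (by omega)
    · exact absurd haIh hnh
    · rcases Nat.eq_or_lt_of_le h with h' | h'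
      · obtain rfl : q = a + 1 := by omega
        refine ⟨(0, 72 * (k * a) + 150 * k + o), Or.inr ⟨_, 72 * (k * a) + 182 * k + 1 - o,
          2 * k - o, Or.inr (Or.inr ⟨?_, ?_, o, ?_, Or.inr (Or.inr (Or.inr (Or.inr (Or.inr
          ⟨rfl, ?_, ?_⟩))))⟩), left_mem _ _ _⟩, _, hv0 _, ?_⟩
        · omega
        · omega
        · omega
        · omega
        · omega
        · rw [f2, Fcol_mid]
          exact hsc (a + 2) _ _ ha3 (by omega) (by omega) (by omega) (by omega)
      · refine ⟨_, hv0 _, _, hv0 _, ?_⟩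
        have eq : k * (q + 1) = k * q + k := by ring
        rw [f1, f2, Fcol_gt _ h', Fcol_gt _ h', gcol, gcol, if_neg hnh, if_neg hnh,
          if_pos (by omega), if_neg (by omega)]
        exact hsc (q + 1) _ _ (hc2 q h' hq) (by omega) (by omega) (by omega) (by omega)
  · intro q s t hq hst
    have hqn := (hIh _ hq).2
    obtain ⟨o, rfl⟩ : ∃ o, s = 4 * (k * q) + o := ⟨s - 4 * (k * q), by omega⟩
    obtain ⟨o', rfl⟩ : ∃ o', t = 4 * (k * q) + o' := ⟨t - 4 * (k * q), by omega⟩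
    have f1 := fcol_eq k a hk Ih q o (by omega) (by omega)
    have f2 := fcol_eq k a hk Ih q o' (by omega) (by omega)
    rcases Nat.lt_trichotomy q a with h | rfl | h
    · refine ⟨_, hv0 _, _, hv0 _, ?_⟩
      rw [f1, f2, Fcol_lt _ h, Fcol_lt _ h, gcol, gcol, if_pos hq, if_pos hq]
      refine hsh q _ _ (hh1 q h hq) (by omega) ?_
      rcases hst with hst | hst
      · left
        rw [if_pos (by omega), if_neg (by omega), if_neg (by omega), if_pos (by omega)]
        omega
      · right
        rw [if_neg (by omega), if_pos (by omega), if_neg (by omega), if_neg (by omega),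
          if_neg (by omega)]
        omega
    · rcases hst with hst | hst
      · refine ⟨(0, 72 * (k * q) + 75 * k + 1 - o), Or.inr ⟨72 * (k * q) + 36 * k + o, _,
          5 * k - o, Or.inl ⟨by omega, by omega, o, rfl, rfl, by omega, by omega⟩,
          right_mem _ _ _⟩, _, hv0 _, ?_⟩
        rw [f2, Fcol_a, if_neg (by omega), if_neg (by omega), if_pos (by omega)]
        exact hsc (q + 1) _ _ ha2 (by omega) (by omega) (by omega) (by omega)
      · refine ⟨(0, 72 * (k * q) + 147 * k + 1 - (o - k)), Or.inr
          ⟨72 * (k * q) + 114 * k + (o - k), _, 5 * k - (o - k), Or.inr (Or.inl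
          ⟨by omega, by omega, o - k, by omega, rfl, by omega, by omega⟩),
          right_mem _ _ _⟩, _, hv0 _, ?_⟩
        rw [f2, Fcol_a, if_neg (by omega), if_neg (by omega), if_neg (by omega)]
        exact hsc (q + 2) _ _ ha3 (by omega) (by omega) (by omega) (by omega)
    · rcases Nat.eq_or_lt_of_le h with h' | h'
      · obtain rfl : q = a + 1 := by omega
        exact absurd haIc (Finset.disjoint_left.1 hd hq)
      · refine ⟨_, hv0 _, _, hv0 _, ?_⟩
        have eq : k * (q + 1) = k * q + k := by ring
        rw [f1, f2, Fcol_gt _ h', Fcol_gt _ h', gcol, gcol, if_pos hq, if_pos hq]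
        refine hsh (q + 1) _ _ (hh2 q h' hq) (by omega) ?_
        rcases hst with hst | hst
        · left
          rw [if_pos (by omega), if_neg (by omega), if_neg (by omega), if_pos (by omega)]
          omega
        · right
          rw [if_neg (by omega), if_pos (by omega), if_neg (by omega), if_neg (by omega),
            if_neg (by omega)]
          omega

end MixedAux

/-- Let `k ≥ 1`, `h ≥ 0`, `c ≥ 3` and let `{I'_hdl, I'_crscp}` be a
partition of `[2, h+c+1]` with `|I'_hdl| = h`, `|I'_crscp| = c`, and suppose
`i, i+1, i+2 ∈ I'_crscp`.  With
`I''_hdl := {j ∈ I'_hdl | j < i} ∪ {i} ∪ {j−1 | j ∈ I'_hdl, j > i+2}` and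
`I''_crscp := {j ∈ I'_crscp | j < i} ∪ {i+1} ∪ {j−1 | j ∈ I'_crscp, j > i+2}`,
the pair `{I''_hdl, I''_crscp}` is a partition of `[2, h+c]` with `|I''_hdl| = h+1` and
`|I''_crscp| = c−2`, and the mixed surface grid of order `18k` with positions
`I'_hdl, I'_crscp` contains the mixed surface grid of order `k` with positions
`I''_hdl, I''_crscp` as a minor. -/
theorem mixedGrid_three_crosscaps_to_handle (k h c : ℕ) (hk : 1 ≤ k) (hc : 3 ≤ c)
    (I'h I'c : Finset ℕ)
    (hpart : I'h ∪ I'c = Finset.Icc 2 (h + c + 1)) (hdisj : Disjoint I'h I'c)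
    (hIh : I'h.card = h) (hIc : I'c.card = c)
    (i : ℕ) (hi : i ∈ I'c) (hi1 : i + 1 ∈ I'c) (hi2 : i + 2 ∈ I'c)
    (I''h I''c : Finset ℕ)
    (hI''h : I''h = (I'h.filter (fun j => j < i)) ∪ {i} ∪
      ((I'h.filter (fun j => i + 2 < j)).image (fun j => j - 1)))
    (hI''c : I''c = (I'c.filter (fun j => j < i)) ∪ {i + 1} ∪
      ((I'c.filter (fun j => i + 2 < j)).image (fun j => j - 1))) :
    (I''h ∪ I''c = Finset.Icc 2 (h + c) ∧ Disjoint I''h I''c ∧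
      I''h.card = h + 1 ∧ I''c.card = c - 2) ∧
    IsMinorOf (mixedGrid k (h + c) I''h I''c) (mixedGrid (18 * k) (h + c + 1) I'h I'c) := by
  have memU : ∀ j, j ∈ I'h ∨ j ∈ I'c ↔ 2 ≤ j ∧ j ≤ h + c + 1 := by
    intro j
    rw [← Finset.mem_union, hpart, Finset.mem_Icc]
  have dj : ∀ j, j ∈ I'h → j ∈ I'c → False := fun j h1 h2 => Finset.disjoint_left.1 hdisj h1 h2
  have bi := (memU i).1 (Or.inr hi)
  have bi2 := (memU (i + 2)).1 (Or.inr hi2)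
  have mh : ∀ j, j ∈ I''h ↔ (j ∈ I'h ∧ j < i) ∨ j = i ∨ (j + 1 ∈ I'h ∧ i + 1 < j) := by
    intro j
    rw [hI''h]
    simp only [Finset.mem_union, Finset.mem_filter, Finset.mem_singleton, Finset.mem_image,
      or_assoc]
    refine or_congr Iff.rfl (or_congr Iff.rfl ⟨?_, ?_⟩)
    · rintro ⟨x, ⟨h1, h2⟩, rfl⟩
      rw [Nat.sub_add_cancel (by omega)]
      exact ⟨h1, by omega⟩
    · rintro ⟨h1, h2⟩
      exact ⟨j + 1, ⟨h1, by omega⟩, by omega⟩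
  have mc : ∀ j, j ∈ I''c ↔ (j ∈ I'c ∧ j < i) ∨ j = i + 1 ∨ (j + 1 ∈ I'c ∧ i + 1 < j) := by
    intro j
    rw [hI''c]
    simp only [Finset.mem_union, Finset.mem_filter, Finset.mem_singleton, Finset.mem_image,
      or_assoc]
    refine or_congr Iff.rfl (or_congr Iff.rfl ⟨?_, ?_⟩)
    · rintro ⟨x, ⟨h1, h2⟩, rfl⟩
      rw [Nat.sub_add_cancel (by omega)]
      exact ⟨h1, by omega⟩
    · rintro ⟨h1, h2⟩
      exact ⟨j + 1, ⟨h1, by omega⟩, by omega⟩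
  have hunion : I''h ∪ I''c = Finset.Icc 2 (h + c) := by
    ext j
    rw [Finset.mem_union, Finset.mem_Icc, mh, mc]
    have u1 := memU j
    have u2 := memU (j + 1)
    constructor
    · rintro ((h1 | h1 | h1) | (h1 | h1 | h1))
      · have := u1.1 (Or.inl h1.1); omega
      · omega
      · have := u2.1 (Or.inl h1.1); omega
      · have := u1.1 (Or.inr h1.1); omega
      · omega
      · have := u2.1 (Or.inr h1.1); omega
    · intro hj
      by_cases c1 : j < i
      · rcases u1.2 (by omega) with h1 | h1
        · exact Or.inl (Or.inl ⟨h1, c1⟩)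
        · exact Or.inr (Or.inl ⟨h1, c1⟩)
      by_cases c2 : j = i
      · exact Or.inl (Or.inr (Or.inl c2))
      by_cases c3 : j = i + 1
      · exact Or.inr (Or.inr (Or.inl c3))
      rcases u2.2 (by omega) with h1 | h1
      · exact Or.inl (Or.inr (Or.inr ⟨h1, by omega⟩))
      · exact Or.inr (Or.inr (Or.inr ⟨h1, by omega⟩))
  have hdis : Disjoint I''h I''c := by
    rw [Finset.disjoint_left]
    intro j h1 h2
    rw [mh] at h1
    rw [mc] at h2
    rcases h1 with h1 | h1 | h1 <;> rcases h2 with h2 | h2 | h2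
    · exact dj _ h1.1 h2.1
    · omega
    · omega
    · omega
    · omega
    · omega
    · omega
    · omega
    · exact dj _ h1.1 h2.1
  have hcardh : I''h.card = h + 1 := by
    have e1 : I'h.filter (fun j => ¬ j < i) = I'h.filter (fun j => i + 2 < j) := by
      refine Finset.filter_congr fun j hj => ?_
      constructor
      · intro h1
        by_contra h2
        obtain rfl | rfl | rfl : j = i ∨ j = i + 1 ∨ j = i + 2 := by omega
        · exact dj _ hj hi
        · exact dj _ hj hi1
        · exact dj _ hj hi2
      · intro h1
        omega
    have e2 := Finset.card_filter_add_card_filter_not (s := I'h) (fun j => j < i)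
    rw [e1, hIh] at e2
    rw [hI''h, Finset.card_union_of_disjoint, Finset.card_union_of_disjoint,
      Finset.card_image_of_injOn, Finset.card_singleton]
    · omega
    · intro x hx y hy hxy
      simp only [Finset.coe_filter, Set.mem_ofPred_eq] at hx hy hxy
      omega
    · rw [Finset.disjoint_singleton_right, Finset.mem_filter]
      omega
    · rw [Finset.disjoint_left]
      intro j h1 h2
      simp only [Finset.mem_union, Finset.mem_filter, Finset.mem_singleton,
        Finset.mem_image] at h1 h2
      obtain ⟨x, h3, h4⟩ := h2
      omega
  have hcardc : I''c.card = c - 2 := by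
    have e := Finset.card_union_of_disjoint hdis
    rw [hunion, Nat.card_Icc, hcardh] at e
    omega
  refine ⟨⟨hunion, hdis, hcardh, hcardc⟩, ?_⟩
  have bd : ∀ j, j ∈ I''h ∨ j ∈ I''c → 1 ≤ j ∧ j ≤ h + c := by
    intro j hj
    rw [← Finset.mem_union, hunion, Finset.mem_Icc] at hj
    omega
  obtain ⟨a, rfl⟩ : ∃ a, i = a + 1 := ⟨i - 1, by omega⟩
  refine MixedAux.minor_main k a (h + c) hk (by omega) I''h I''c I'h I'c
    (fun j hj => bd j (Or.inl hj)) (fun j hj => bd j (Or.inr hj)) hdis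
    ((mh _).2 (Or.inr (Or.inl rfl))) ((mc _).2 (Or.inr (Or.inl rfl))) ?_ ?_ ?_ ?_ hi hi1 hi2
  · intro q hq h1
    rcases (mh _).1 h1 with h2 | h2 | h2
    · exact h2.1
    · omega
    · omega
  · intro q hq h1
    rcases (mh _).1 h1 with h2 | h2 | h2
    · omega
    · omega
    · exact h2.1
  · intro q hq h1
    rcases (mc _).1 h1 with h2 | h2 | h2
    · exact h2.1
    · omega
    · omega
  · intro q hq h1
    rcases (mc _).1 h1 with h2 | h2 | h2
    · omega
    · omega
    · exact h2.1
end

section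
/- Let k ≥ 1, h ≥ 0 and c ≥ 3 be integers. Let {I''_hdl, I''_crscp} be a partition of [2, h+c] with |I''_hdl| = h+1 and |I''_crscp| = c−2, and suppose there is an integer i with i ∈ I''_hdl and i+1 ∈ I''_crscp. Define I'_hdl := {j ∈ I''_hdl | j < i} ∪ {j+1 | j ∈ I''_hdl, j > i+1} and I'_crscp := {j ∈ I''_crscp | j < i} ∪ {i, i+1, i+2} ∪ {j+1 | j ∈ I''_crscp, j > i+1}; then {I'_hdl, I'_crscp} is a partition of [2, h+c+1] with |I'_hdl| = h and |I'_crscp| = c, and the mixed surface grid H^{18k}_{I''_hdl,I''_crscp} of order 18k with h+1 handles and c−2 crosscaps contains the mixed surface grid H^k_{I'_hdl,I'_crscp} of order k with h handles and c crosscaps as a minor. -/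
open SimpleGraph

/-! ### The base layout

The two modified segments of the host grid (a handle followed by a crosscap) are cut into
`18 × 144` square blocks of side `k`.  The lowest block row carries the `k` rows of the target
grid.  The upper `17` block rows carry six wires, each consisting of `k` parallel strands,
which are routed through the handle and the crosscap and which realise the three new crosscaps. -/

/-- The four sides of a block. -/
inductive Side
  | L | R | T | B

/-- A piece of a wire in a block: it belongs to the wire starting at pin `q`, the side closer to
the root of the wire is `inn`, the other one is `out`; `flip` tells how strands are numbered and
`p` is the distance of the block from the root along the wire. -/
structure Tile where
  q : ℕ
  inn : Side
  out : Side
  flip : Bool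
  p : ℕ

/-- A part of a wire between two consecutive visits of the upper or lower boundary of the layout:
it starts in column `c1` (at the bottom if `startB`, at the top otherwise), goes vertically to
row `d`, horizontally to column `c2`, and then vertically to the bottom or the top. -/
structure Net where
  q : ℕ
  fl : Bool
  r0 : ℕ
  startB : Bool
  endB : Bool
  c1 : ℕ
  d : ℕ
  c2 : ℕ

/-- Whether the numbering of the strands is reversed in a corner. -/
def cornerFlip : Side → Side → Bool
  | Side.T, Side.R => true
  | Side.R, Side.T => true
  | Side.B, Side.L => true
  | Side.L, Side.B => true
  | _, _ => false

def vside (b : Bool) : Side := bif b then Side.B else Side.T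
def hside (b : Bool) : Side := bif b then Side.R else Side.L

def ndist (a b : ℕ) : ℕ := (a - b) + (b - a)

/-- The tile of a net in block row `I` and block column `J`. -/
def Net.tile (e : Net) (I J : ℕ) : Option Tile :=
  let right := Nat.blt e.c1 e.c2
  let v1 := vside e.startB
  let v2 := vside e.endB
  let f2 := xor e.fl (cornerFlip v1 (hside right))
  let f3 := xor f2 (cornerFlip v2 (hside (!right)))
  let len1 := bif e.startB then 16 - e.d else e.d
  bif Nat.beq I e.d then
    bif Nat.beq J e.c1 then some ⟨e.q, v1, hside right, e.fl, e.r0 + len1⟩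
    else bif Nat.beq J e.c2 then
      some ⟨e.q, hside (!right), v2, f3, e.r0 + len1 + ndist e.c1 e.c2⟩
    else bif (Nat.blt e.c1 J && Nat.blt J e.c2) || (Nat.blt e.c2 J && Nat.blt J e.c1) then
      some ⟨e.q, hside (!right), hside right, f2, e.r0 + len1 + ndist e.c1 J⟩
    else none
  else bif Nat.beq J e.c1 && (bif e.startB then Nat.blt e.d I else Nat.blt I e.d) then
    some ⟨e.q, v1, vside (!e.startB), e.fl, e.r0 + (bif e.startB then 16 - I else I)⟩
  else bif Nat.beq J e.c2 && (bif e.endB then Nat.blt e.d I else Nat.blt I e.d) then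
    some ⟨e.q, vside (!e.endB), v2, f3, e.r0 + len1 + ndist e.c1 e.c2 + ndist I e.d⟩
  else none

def findTile (I J : ℕ) : List Net → Option Tile
  | [] => none
  | e :: l => match e.tile I J with
    | some τ => some τ
    | none => findTile I J l

/-- The routing of the six wires. -/
def nets : List Net := [
  ⟨0, false, 0, true, false, 0, 0, 1⟩,
  ⟨0, true, 200, false, false, 52, 0, 55⟩,
  ⟨0, true, 400, false, false, 34, 8, 112⟩,
  ⟨0, false, 600, false, false, 76, 2, 66⟩,
  ⟨0, false, 800, false, true, 23, 13, 24⟩,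
  ⟨1, false, 0, true, false, 12, 2, 5⟩,
  ⟨1, true, 200, false, false, 48, 1, 57⟩,
  ⟨1, true, 400, false, false, 32, 9, 113⟩,
  ⟨1, false, 600, false, false, 77, 3, 65⟩,
  ⟨1, false, 800, false, true, 24, 12, 36⟩,
  ⟨4, false, 0, true, false, 48, 11, 28⟩,
  ⟨4, true, 200, false, false, 61, 4, 78⟩,
  ⟨4, false, 400, false, true, 114, 10, 72⟩,
  ⟨5, false, 0, true, false, 60, 10, 29⟩,
  ⟨5, true, 200, false, false, 60, 5, 79⟩,
  ⟨5, false, 400, false, true, 115, 11, 84⟩,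
  ⟨8, false, 0, true, false, 96, 12, 116⟩,
  ⟨8, false, 200, false, false, 80, 6, 44⟩,
  ⟨8, false, 400, false, false, 9, 1, 21⟩,
  ⟨8, false, 600, false, false, 68, 1, 74⟩,
  ⟨8, true, 800, false, false, 110, 1, 82⟩,
  ⟨8, false, 1000, false, true, 118, 0, 120⟩,
  ⟨9, false, 0, true, false, 108, 13, 117⟩,
  ⟨9, false, 200, false, false, 81, 7, 37⟩,
  ⟨9, false, 400, false, false, 16, 0, 20⟩,
  ⟨9, false, 600, false, false, 69, 0, 72⟩,
  ⟨9, true, 800, false, false, 108, 0, 85⟩,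
  ⟨9, false, 1000, false, true, 121, 0, 132⟩]

/-- The tile in block row `I` and block column `J` of the layout. -/
def tile (I J : ℕ) : Option Tile := findTile I J nets

/-- The relation between the strand number and the coordinate along a side. -/
def Tile.portFlip (τ : Tile) (d : Side) : Bool :=
  match d with
  | Side.T => τ.flip
  | Side.B => τ.flip
  | Side.L => xor τ.flip (cornerFlip τ.inn τ.out)
  | Side.R => xor τ.flip (cornerFlip τ.inn τ.out)

def Side.beq : Side → Side → Bool
  | Side.L, Side.L => true
  | Side.R, Side.R => true
  | Side.T, Side.T => true
  | Side.B, Side.B => true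
  | _, _ => false

/-- `τ` continues in the block `(I, J)`, which is entered at side `d`, and the coordinate along
the side is reversed iff `f`. -/
def contAt (τ : Tile) (I J : ℕ) (d : Side) (f : Bool) : Bool :=
  match tile I J with
  | none => false
  | some σ => Nat.beq σ.q τ.q && Nat.blt σ.p τ.p && Side.beq σ.out d &&
      Bool.not (xor (xor (σ.portFlip d) (τ.portFlip τ.inn)) f)

/-- Local correctness of the layout at a block. -/
def tileOK (I J : ℕ) : Bool :=
  match tile I J with
  | none => true
  | some τ => Bool.not (Side.beq τ.inn τ.out) && match τ.inn with
    | Side.L => Nat.blt 0 J && contAt τ I (J - 1) Side.R false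
    | Side.R => Nat.blt J 143 && contAt τ I (J + 1) Side.L false
    | Side.B => bif Nat.beq I 16 then Nat.beq J (12 * τ.q) && Bool.not τ.flip
        else contAt τ (I + 1) J Side.T false
    | Side.T => bif Nat.beq I 0 then
          (bif Nat.blt J 18 then contAt τ 0 (53 - J) Side.T true
          else bif Nat.blt J 36 then contAt τ 0 (89 - J) Side.T true
          else bif Nat.blt J 54 then contAt τ 0 (53 - J) Side.T true
          else bif Nat.blt J 72 then contAt τ 0 (89 - J) Side.T true
          else bif Nat.blt J 108 then contAt τ 0 (J + 36) Side.T false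
          else contAt τ 0 (J - 36) Side.T false)
        else contAt τ (I - 1) J Side.B false

/-- The wire starting at pin `q` ends at pin `q + 2`. -/
def endOK (q : ℕ) : Bool :=
  match tile 16 (12 * (q + 2)) with
  | none => false
  | some τ => Nat.beq τ.q q && Side.beq τ.out Side.B && Bool.not τ.flip

def allBelow (f : ℕ → Bool) : ℕ → Bool
  | 0 => true
  | n + 1 => f n && allBelow f n

theorem allBelow_spec (f : ℕ → Bool) (n : ℕ) (h : allBelow f n = true) (m : ℕ) (hm : m < n) :
    f m = true := by
  induction n with
  | zero => omega
  | succ n ih =>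
    simp only [allBelow, Bool.and_eq_true] at h
    rcases Nat.lt_succ_iff_lt_or_eq.mp hm with h1 | h1
    · exact ih h.2 h1
    · rw [h1]; exact h.1

theorem tileOK_all : allBelow (fun I => allBelow (fun J => tileOK I J) 144) 17 = true := by
  decide +kernel

theorem tileOK_of {I J : ℕ} (hI : I < 17) (hJ : J < 144) : tileOK I J = true :=
  allBelow_spec _ _ (allBelow_spec _ _ tileOK_all I hI) J hJ

theorem endOK_all : endOK 0 = true ∧ endOK 1 = true ∧ endOK 4 = true ∧ endOK 5 = true ∧
    endOK 8 = true ∧ endOK 9 = true := by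
  decide +kernel

/-! ### Strands inside a block -/

/-- The distance of a cell from a side of its block. -/
def sdist (k : ℕ) (d : Side) (s t : ℕ) : ℕ :=
  match d with
  | Side.L => t
  | Side.R => k - 1 - t
  | Side.T => s
  | Side.B => k - 1 - s

/-- The coordinate of a cell along a side. -/
def scoord (d : Side) (s t : ℕ) : ℕ :=
  match d with
  | Side.L => s
  | Side.R => s
  | Side.T => t
  | Side.B => t

/-- The number of the strand through a cell, up to reversal. -/
def baseIdx (k : ℕ) (d e : Side) (s t : ℕ) : ℕ :=
  match d, e with
  | Side.T, Side.B => t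
  | Side.B, Side.T => t
  | Side.L, Side.R => s
  | Side.R, Side.L => s
  | Side.T, Side.L => max s t
  | Side.L, Side.T => max s t
  | Side.T, Side.R => k - 1 - max s (k - 1 - t)
  | Side.R, Side.T => k - 1 - max s (k - 1 - t)
  | Side.B, Side.L => max (k - 1 - s) t
  | Side.L, Side.B => max (k - 1 - s) t
  | Side.B, Side.R => k - 1 - max (k - 1 - s) (k - 1 - t)
  | Side.R, Side.B => k - 1 - max (k - 1 - s) (k - 1 - t)
  | _, _ => 0

def isCorner (d e : Side) : Bool :=
  match d, e with
  | Side.T, Side.B => false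
  | Side.B, Side.T => false
  | Side.L, Side.R => false
  | Side.R, Side.L => false
  | _, _ => true

/-- The distance of a cell from side `d` along its strand. -/
def locRank (k : ℕ) (d e : Side) (s t : ℕ) : ℕ :=
  if isCorner d e = true then
    if sdist k d s t ≤ sdist k e s t then sdist k d s t
    else 2 * sdist k d s t - sdist k e s t
  else sdist k d s t

def Tile.idx (k : ℕ) (τ : Tile) (s t : ℕ) : ℕ :=
  if τ.flip = true then k - 1 - baseIdx k τ.inn τ.out s t else baseIdx k τ.inn τ.out s t

theorem locRank_lt (k : ℕ) (d e : Side) (s t : ℕ) (hs : s < k) (ht : t < k) :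
    locRank k d e s t < 2 * k := by
  have h : sdist k d s t < k := by cases d <;> simp only [sdist] <;> omega
  unfold locRank
  split_ifs <;> omega

theorem baseIdx_port_inn (k : ℕ) (d e : Side) (s t : ℕ) (hs : s < k) (ht : t < k)
    (hde : Side.beq d e = false) (h0 : sdist k d s t = 0) :
    baseIdx k d e s t = match d with
      | Side.T => t
      | Side.B => t
      | Side.L => if cornerFlip d e = true then k - 1 - s else s
      | Side.R => if cornerFlip d e = true then k - 1 - s else s := by
  cases d <;> cases e <;> simp [Side.beq] at hde <;> simp only [sdist] at h0 <;>
    simp [baseIdx, cornerFlip] <;> omega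

theorem baseIdx_comm (k : ℕ) (d e : Side) (s t : ℕ) : baseIdx k d e s t = baseIdx k e d s t := by
  cases d <;> cases e <;> rfl

theorem cornerFlip_comm (d e : Side) : cornerFlip d e = cornerFlip e d := by
  cases d <;> cases e <;> rfl

theorem Side.beq_comm (d e : Side) : Side.beq d e = Side.beq e d := by
  cases d <;> cases e <;> rfl

theorem Side.eq_of_beq {d e : Side} (h : Side.beq d e = true) : d = e := by
  cases d <;> cases e <;> simp [Side.beq] at h <;> rfl

theorem idx_port_inn (k : ℕ) (τ : Tile) (s t : ℕ) (hs : s < k) (ht : t < k)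
    (hde : Side.beq τ.inn τ.out = false) (h0 : sdist k τ.inn s t = 0) :
    τ.idx k s t = if τ.portFlip τ.inn = true then k - 1 - scoord τ.inn s t
      else scoord τ.inn s t := by
  have := baseIdx_port_inn k _ _ s t hs ht hde h0
  obtain ⟨q, d, e, f, p⟩ := τ
  simp only [Tile.idx, this]
  cases d <;> cases f <;> cases hc : cornerFlip _ e <;> simp [Tile.portFlip, scoord, hc] <;> omega

theorem idx_port_out (k : ℕ) (τ : Tile) (s t : ℕ) (hs : s < k) (ht : t < k)
    (hde : Side.beq τ.inn τ.out = false) (h0 : sdist k τ.out s t = 0) :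
    τ.idx k s t = if τ.portFlip τ.out = true then k - 1 - scoord τ.out s t
      else scoord τ.out s t := by
  have := idx_port_inn k ⟨τ.q, τ.out, τ.inn, τ.flip, τ.p⟩ s t hs ht
    (by rw [Side.beq_comm]; exact hde) h0
  simp only [Tile.idx] at this ⊢
  rw [baseIdx_comm, this]
  simp only [Tile.portFlip, cornerFlip_comm τ.inn]
  cases τ.out <;> rfl

/-- Cells adjacent inside a block. -/
def cellAdj (s t s' t' : ℕ) : Prop :=
  (s' = s ∧ (t' = t + 1 ∨ t = t' + 1)) ∨ (t' = t ∧ (s' = s + 1 ∨ s = s' + 1))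

theorem locRank_corner_fst (k : ℕ) (d e : Side) (s t : ℕ)
    (h : sdist k d s t ≤ sdist k e s t) : locRank k d e s t = sdist k d s t := by
  unfold locRank
  split_ifs <;> rfl

theorem locRank_corner_snd (k : ℕ) (d e : Side) (s t : ℕ) (hc : isCorner d e = true)
    (h : sdist k e s t ≤ sdist k d s t) :
    locRank k d e s t = 2 * sdist k d s t - sdist k e s t := by
  unfold locRank
  split_ifs <;> omega

theorem locRank_straight (k : ℕ) (d e : Side) (s t : ℕ) (hc : isCorner d e = false) :
    locRank k d e s t = sdist k d s t := by
  unfold locRank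
  simp [hc]

/-- The neighbour of a cell in a given direction. -/
def Side.mv (d : Side) (s t : ℕ) : ℕ × ℕ :=
  match d with
  | Side.L => (s, t - 1)
  | Side.R => (s, t + 1)
  | Side.T => (s - 1, t)
  | Side.B => (s + 1, t)

def Side.opp (d : Side) : Side :=
  match d with
  | Side.L => Side.R
  | Side.R => Side.L
  | Side.T => Side.B
  | Side.B => Side.T

theorem base_step (k : ℕ) (d e : Side) (s t : ℕ) (hs : s < k) (ht : t < k)
    (hde : Side.beq d e = false) (h0 : sdist k d s t ≠ 0) :
    ∃ s' t', s' < k ∧ t' < k ∧ cellAdj s t s' t' ∧ baseIdx k d e s' t' = baseIdx k d e s t ∧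
      locRank k d e s' t' < locRank k d e s t := by
  by_cases hc : isCorner d e = true
  · by_cases hl : sdist k d s t ≤ sdist k e s t
    · refine ⟨(d.mv s t).1, (d.mv s t).2, ?_⟩
      rw [locRank_corner_fst k d e s t hl, locRank_corner_fst k d e]
      all_goals
        cases d <;> cases e <;> simp only [Side.beq, isCorner, reduceCtorEq] at hde hc <;>
          simp only [sdist, Side.mv, cellAdj, baseIdx, true_and, true_or, or_true] at h0 hl ⊢ <;> omega
    · refine ⟨(e.opp.mv s t).1, (e.opp.mv s t).2, ?_⟩
      rw [locRank_corner_snd k d e s t hc (by omega), locRank_corner_snd k d e _ _ hc]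
      all_goals
        cases d <;> cases e <;> simp only [Side.beq, isCorner, reduceCtorEq] at hde hc <;>
          simp only [sdist, Side.mv, Side.opp, cellAdj, baseIdx, true_and, true_or, or_true] at h0 hl ⊢ <;> omega
  · refine ⟨(d.mv s t).1, (d.mv s t).2, ?_⟩
    have hc' : isCorner d e = false := by simpa using hc
    rw [locRank_straight k d e s t hc', locRank_straight k d e _ _ hc']
    cases d <;> cases e <;> simp only [Side.beq, isCorner, reduceCtorEq] at hde hc' <;>
      simp only [sdist, Side.mv, cellAdj, baseIdx, true_and, true_or, or_true] at h0 ⊢ <;> omega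

theorem idx_step (k : ℕ) (τ : Tile) (s t : ℕ) (hs : s < k) (ht : t < k)
    (hde : Side.beq τ.inn τ.out = false) (h0 : sdist k τ.inn s t ≠ 0) :
    ∃ s' t', s' < k ∧ t' < k ∧ cellAdj s t s' t' ∧ τ.idx k s' t' = τ.idx k s t ∧
      locRank k τ.inn τ.out s' t' < locRank k τ.inn τ.out s t := by
  obtain ⟨s', t', h1, h2, h3, h4, h5⟩ := base_step k _ _ s t hs ht hde h0
  exact ⟨s', t', h1, h2, h3, by simp only [Tile.idx, h4], h5⟩

/-! ### The column function of the target rows -/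

/-- The target column to which column `x` of the lowest `k` rows of the host belongs. -/
def colG (k a x : ℕ) : ℕ :=
  if x < 72 * a then x / 18
  else if x < 72 * a + 144 * k then
    4 * a + ((x - 72 * a) / (12 * k)) * k + min ((x - 72 * a) % (12 * k)) (k - 1)
  else x / 18 + 4 * k

theorem colG_mid (k a q r : ℕ) (hk : 1 ≤ k) (hq : q < 12) (hr : r < 12 * k) :
    colG k a (72 * a + (12 * (q * k) + r)) = 4 * a + q * k + min r (k - 1) := by
  have h1 : 12 * (q * k) + r < 144 * k := by
    have : q * k ≤ 11 * k := Nat.mul_le_mul_right k (by omega)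
    omega
  have h2 : 12 * (q * k) + r = (12 * k) * q + r := by ring
  unfold colG
  rw [if_neg (by omega), if_pos (by omega), Nat.add_sub_cancel_left, h2,
    Nat.mul_add_div (by omega), Nat.mul_add_mod, Nat.div_eq_of_lt hr, Nat.mod_eq_of_lt hr,
    Nat.add_zero]

theorem mid_decomp (k z : ℕ) (hk : 1 ≤ k) (hz : z < 144 * k) :
    ∃ q r, q < 12 ∧ r < 12 * k ∧ z = 12 * (q * k) + r := by
  refine ⟨z / (12 * k), z % (12 * k), ?_, Nat.mod_lt _ (by omega), ?_⟩
  · rw [Nat.div_lt_iff_lt_mul (by omega)]; omega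
  · have := Nat.div_add_mod z (12 * k)
    calc z = 12 * k * (z / (12 * k)) + z % (12 * k) := this.symm
      _ = _ := by ring

theorem colG_step (k a x : ℕ) (hk : 1 ≤ k) :
    colG k a (x + 1) = colG k a x ∨ colG k a (x + 1) = colG k a x + 1 := by
  by_cases h1 : x < 72 * a
  · have e1 : colG k a x = x / 18 := by unfold colG; rw [if_pos h1]
    by_cases h2 : x + 1 < 72 * a
    · have e2 : colG k a (x + 1) = (x + 1) / 18 := by unfold colG; rw [if_pos h2]
      omega
    · have e2 := colG_mid k a 0 0 hk (by omega) (by omega)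
      rw [show 72 * a + (12 * (0 * k) + 0) = x + 1 by omega] at e2
      omega
  · by_cases h2 : x < 72 * a + 144 * k
    · obtain ⟨q, r, hq, hr, hz⟩ := mid_decomp k (x - 72 * a) hk (by omega)
      have hx : x = 72 * a + (12 * (q * k) + r) := by omega
      have e1 := colG_mid k a q r hk hq hr
      rw [← hx] at e1
      by_cases h3 : r + 1 < 12 * k
      · have e2 := colG_mid k a q (r + 1) hk hq h3
        rw [show 72 * a + (12 * (q * k) + (r + 1)) = x + 1 by omega] at e2
        omega
      · by_cases h4 : q + 1 < 12
        · have e2 := colG_mid k a (q + 1) 0 hk h4 (by omega)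
          have e3 : (q + 1) * k = q * k + k := by ring
          rw [e3] at e2
          rw [show 72 * a + (12 * (q * k + k) + 0) = x + 1 by omega] at e2
          omega
        · have hq' : q = 11 := by omega
          subst hq'
          have e2 : colG k a (x + 1) = (x + 1) / 18 + 4 * k := by
            unfold colG; rw [if_neg (by omega), if_neg (by omega)]
          omega
    · have e1 : colG k a x = x / 18 + 4 * k := by
        unfold colG; rw [if_neg (by omega), if_neg (by omega)]
      have e2 : colG k a (x + 1) = (x + 1) / 18 + 4 * k := by
        unfold colG; rw [if_neg (by omega), if_neg (by omega)]
      omega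

theorem colG_mono (k a : ℕ) (hk : 1 ≤ k) : Monotone (colG k a) :=
  monotone_nat_of_le_succ (fun x => by rcases colG_step k a x hk with h | h <;> omega)

theorem colG_zero (k a : ℕ) (hk : 1 ≤ k) : colG k a 0 = 0 := by
  by_cases h : 0 < 72 * a
  · unfold colG; rw [if_pos h]
  · have e2 := colG_mid k a 0 0 hk (by omega) (by omega)
    rw [show 72 * a + (12 * (0 * k) + 0) = 0 by omega] at e2
    omega

/-- The last column of the host belongs to the last column of the target. -/
theorem colG_last (k a b : ℕ) (hk : 1 ≤ k) (hb : a + 2 * k ≤ b) :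
    colG k a (72 * b - 1) = 4 * b + 4 * k - 1 := by
  by_cases h : 72 * b - 1 < 72 * a + 144 * k
  · have e2 := colG_mid k a 11 (12 * k - 1) hk (by omega) (by omega)
    rw [show 72 * a + (12 * (11 * k) + (12 * k - 1)) = 72 * b - 1 by omega] at e2
    omega
  · unfold colG; rw [if_neg (by omega), if_neg (by omega)]; omega

/-- Discrete intermediate value theorem for `colG`: the first column with a given value. -/
theorem colG_first (k a b j : ℕ) (hk : 1 ≤ k) (hb : a + 2 * k ≤ b) (hj : j < 4 * b + 4 * k) :
    ∃ x, x < 72 * b ∧ colG k a x = j ∧ (x = 0 ∨ colG k a (x - 1) + 1 = j) := by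
  have hex : ∃ x, j ≤ colG k a x := ⟨72 * b - 1, by rw [colG_last k a b hk hb]; omega⟩
  classical
  have h1 := Nat.find_spec hex
  have h2 := fun m hm => Nat.find_min hex (m := m) hm
  have h3 : Nat.find hex ≤ 72 * b - 1 :=
    Nat.find_min' hex (by rw [colG_last k a b hk hb]; omega)
  generalize Nat.find hex = x at h1 h2 h3
  refine ⟨x, by omega, ?_⟩
  rcases Nat.eq_zero_or_pos x with h | h
  · subst h
    have := colG_zero k a hk
    exact ⟨by omega, Or.inl rfl⟩
  · have h4 := h2 (x - 1) (by omega)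
    have h5 := colG_step k a (x - 1) hk
    rw [Nat.sub_add_cancel h] at h5
    exact ⟨by omega, Or.inr (by omega)⟩

/-! ### Labels and ranks of the host vertices -/

def cellLab (k a : ℕ) (o : Option Tile) (s t : ℕ) : Option (ℕ × ℕ) :=
  match o with
  | none => none
  | some τ => some (0, 4 * a + τ.q * k + τ.idx k s t)

def cellRank (k : ℕ) (o : Option Tile) (s t : ℕ) : ℕ :=
  match o with
  | none => 0
  | some τ => τ.p * (2 * k) + locRank k τ.inn τ.out s t

/-- The target vertex (in coordinates) to whose branch set the host vertex in row `y` and column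
`x` belongs. -/
def lab (k a y x : ℕ) : Option (ℕ × ℕ) :=
  if 17 * k ≤ y then some (y - 17 * k, colG k a x)
  else if x < 72 * a ∨ 72 * a + 144 * k ≤ x then some (0, colG k a x)
  else cellLab k a (tile (y / k) ((x - 72 * a) / k)) (y % k) ((x - 72 * a) % k)

/-- A function which decreases towards the root of each branch set. -/
def rk (k a N y x : ℕ) : ℕ :=
  if 17 * k ≤ y then x
  else if x < 72 * a ∨ 72 * a + 144 * k ≤ x then N + (17 * k - y)
  else N + cellRank k (tile (y / k) ((x - 72 * a) / k)) (y % k) ((x - 72 * a) % k)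

/-- The adjacencies of the host grid that are used. -/
structure HostAdj (k a N : ℕ) (A : ℕ → ℕ → ℕ → ℕ → Prop) : Prop where
  symm : ∀ y x y' x', A y x y' x' → A y' x' y x
  hor : ∀ y x, y < 18 * k → x + 1 < N → A y x y (x + 1)
  ver : ∀ y x, y + 1 < 18 * k → x < N → A y x (y + 1) x
  hdl1 : ∀ e, e < 18 * k → A 0 (72 * a + e) 0 (72 * a + (54 * k - 1 - e))
  hdl2 : ∀ e, e < 18 * k → A 0 (72 * a + (18 * k + e)) 0 (72 * a + (72 * k - 1 - e))
  crs : ∀ e, e < 36 * k → A 0 (72 * a + (72 * k + e)) 0 (72 * a + (108 * k + e))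

theorem natBeq_iff {m n : ℕ} : Nat.beq m n = true ↔ m = n :=
  ⟨Nat.eq_of_beq_eq_true, by rintro rfl; exact Nat.beq_refl _⟩

theorem natBeq_self (m : ℕ) : Nat.beq m m = true := Nat.beq_refl m

theorem cell_lt {k J t n : ℕ} (hJ : J < n) (ht : t < k) : J * k + t < n * k := by
  have : (J + 1) * k ≤ n * k := Nat.mul_le_mul_right k hJ
  rw [Nat.add_mul, Nat.one_mul] at this
  omega

theorem cell_div {k J t : ℕ} (ht : t < k) : (J * k + t) / k = J := by
  rw [Nat.mul_comm, Nat.mul_add_div (by omega), Nat.div_eq_of_lt ht, Nat.add_zero]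

theorem cell_mod {k J t : ℕ} (ht : t < k) : (J * k + t) % k = t := by
  rw [Nat.mul_comm, Nat.mul_add_mod, Nat.mod_eq_of_lt ht]

theorem lab_cell {k a I J s t : ℕ} (hI : I < 17) (hJ : J < 144) (hs : s < k) (ht : t < k) :
    lab k a (I * k + s) (72 * a + (J * k + t)) = cellLab k a (tile I J) s t := by
  have h1 := cell_lt hI hs
  have h2 := cell_lt hJ ht
  unfold lab
  rw [if_neg (by omega), if_neg (by omega), Nat.add_sub_cancel_left, cell_div hs, cell_div ht,
    cell_mod hs, cell_mod ht]

theorem rk_cell {k a N I J s t : ℕ} (hI : I < 17) (hJ : J < 144) (hs : s < k) (ht : t < k) :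
    rk k a N (I * k + s) (72 * a + (J * k + t)) = N + cellRank k (tile I J) s t := by
  have h1 := cell_lt hI hs
  have h2 := cell_lt hJ ht
  unfold rk
  rw [if_neg (by omega), if_neg (by omega), Nat.add_sub_cancel_left, cell_div hs, cell_div ht,
    cell_mod hs, cell_mod ht]

theorem contAt_spec {τ : Tile} {I J : ℕ} {d : Side} {f : Bool} (h : contAt τ I J d f = true) :
    ∃ σ, tile I J = some σ ∧ σ.q = τ.q ∧ σ.p < τ.p ∧ σ.out = d ∧
      σ.portFlip d = xor (τ.portFlip τ.inn) f := by
  unfold contAt at h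
  cases hσ : tile I J with
  | none => rw [hσ] at h; simp at h
  | some σ =>
    rw [hσ] at h
    simp only [Bool.and_eq_true, natBeq_iff, Bool.not_eq_true'] at h
    obtain ⟨⟨⟨h1, h2⟩, h3⟩, h4⟩ := h
    refine ⟨σ, rfl, h1, ?_, Side.eq_of_beq h3, ?_⟩
    · simpa [Nat.blt_eq] using h2
    · revert h4
      cases σ.portFlip d <;> cases τ.portFlip τ.inn <;> cases f <;> simp

theorem inn_ne_out {I J : ℕ} {τ : Tile} (hI : I < 17) (hJ : J < 144) (h : tile I J = some τ) :
    Side.beq τ.inn τ.out = false := by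
  have h1 := tileOK_of hI hJ
  unfold tileOK at h1
  rw [h] at h1
  simp only [Bool.and_eq_true, Bool.not_eq_true'] at h1
  exact h1.1

theorem portFlip_lt {k c : ℕ} (hc : c < k) (f g : Bool) :
    (if xor f g = true then k - 1 - (if g = true then k - 1 - c else c)
      else (if g = true then k - 1 - c else c)) = if f = true then k - 1 - c else c := by
  cases f <;> cases g <;> simp <;> omega

/-- Crossing from a block to the next one. -/
theorem cross {k a N I J s t I' J' s' t' : ℕ} {τ : Tile} {d : Side} {f : Bool}
    (hI : I < 17) (hJ : J < 144) (hs : s < k) (ht : t < k) (h : tile I J = some τ)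
    (h0 : sdist k τ.inn s t = 0)
    (hI' : I' < 17) (hJ' : J' < 144) (hs' : s' < k) (ht' : t' < k)
    (hc : contAt τ I' J' d f = true) (h0' : sdist k d s' t' = 0)
    (hco : scoord d s' t' = if f = true then k - 1 - scoord τ.inn s t else scoord τ.inn s t) :
    lab k a (I' * k + s') (72 * a + (J' * k + t')) =
      lab k a (I * k + s) (72 * a + (J * k + t)) ∧
    rk k a N (I' * k + s') (72 * a + (J' * k + t')) <
      rk k a N (I * k + s) (72 * a + (J * k + t)) := by
  obtain ⟨σ, h1, h2, h3, h4, h5⟩ := contAt_spec hc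
  rw [lab_cell hI hJ hs ht, lab_cell hI' hJ' hs' ht', rk_cell hI hJ hs ht,
    rk_cell hI' hJ' hs' ht', h, h1]
  simp only [cellLab, cellRank]
  constructor
  · have e1 := idx_port_inn k τ s t hs ht (inn_ne_out hI hJ h) h0
    have e2 := idx_port_out k σ s' t' hs' ht' (inn_ne_out hI' hJ' h1) (by rw [h4]; exact h0')
    rw [h4, h5, hco, portFlip_lt] at e2
    · rw [e1, e2, h2]
    · cases τ.inn <;> simp only [scoord] <;> assumption
  · have e1 := locRank_lt k σ.inn σ.out s' t' hs' ht'
    have e2 : (σ.p + 1) * (2 * k) ≤ τ.p * (2 * k) := Nat.mul_le_mul_right _ h3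
    rw [Nat.add_mul, Nat.one_mul] at e2
    omega

/-- The first part of the band through the top of column block `J`. -/
theorem mid_step {k a N : ℕ} {A : ℕ → ℕ → ℕ → ℕ → Prop} (hA : HostAdj k a N A)
    (hk : 1 ≤ k) (hN : 72 * a + 144 * k ≤ N) {I J s t : ℕ} {τ : Tile}
    (hI : I < 17) (hJ : J < 144) (hs : s < k) (ht : t < k) (h : tile I J = some τ) :
    ∃ y' x', y' < 18 * k ∧ x' < N ∧ A (I * k + s) (72 * a + (J * k + t)) y' x' ∧
      lab k a y' x' = lab k a (I * k + s) (72 * a + (J * k + t)) ∧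
      rk k a N y' x' < rk k a N (I * k + s) (72 * a + (J * k + t)) := by
  have hy := cell_lt hI hs
  have hx := cell_lt hJ ht
  by_cases h0 : sdist k τ.inn s t = 0
  · have hok := tileOK_of hI hJ
    unfold tileOK at hok
    rw [h] at hok
    simp only [Bool.and_eq_true] at hok
    have hok := hok.2
    -- the general way to finish
    have fin : ∀ (I' J' s' t' : ℕ) (d : Side) (f : Bool), I' < 17 → J' < 144 → s' < k → t' < k →
        contAt τ I' J' d f = true → sdist k d s' t' = 0 →
        scoord d s' t' = (if f = true then k - 1 - scoord τ.inn s t else scoord τ.inn s t) →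
        A (I * k + s) (72 * a + (J * k + t)) (I' * k + s') (72 * a + (J' * k + t')) →
        ∃ y' x', y' < 18 * k ∧ x' < N ∧ A (I * k + s) (72 * a + (J * k + t)) y' x' ∧
          lab k a y' x' = lab k a (I * k + s) (72 * a + (J * k + t)) ∧
          rk k a N y' x' < rk k a N (I * k + s) (72 * a + (J * k + t)) := by
      intro I' J' s' t' d f hI' hJ' hs' ht' hc h0' hco hadj
      have hy' := cell_lt hI' hs'
      have hx' := cell_lt hJ' ht'
      have := cross (a := a) (N := N) hI hJ hs ht h h0 hI' hJ' hs' ht' hc h0' hco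
      exact ⟨_, _, by omega, by omega, hadj, this.1, this.2⟩
    cases hinn : τ.inn with
    | L =>
      rw [hinn] at hok h0 fin
      simp only [sdist, scoord, Bool.and_eq_true, Nat.blt_eq] at hok h0 fin
      obtain ⟨J, rfl⟩ : ∃ J', J = J' + 1 := ⟨J - 1, by omega⟩
      refine fin I J s (k - 1) Side.R false hI (by omega) hs (by omega) hok.2 (by simp [sdist])
        (by simp [scoord]) ?_
      have := hA.hor (I * k + s) (72 * a + (J * k + (k - 1))) (by omega)
        (by rw [Nat.add_mul] at hx; omega)
      rw [show 72 * a + (J * k + (k - 1)) + 1 = 72 * a + ((J + 1) * k + t) by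
        rw [Nat.add_mul]; omega] at this
      exact hA.symm _ _ _ _ this
    | R =>
      rw [hinn] at hok h0 fin
      simp only [sdist, scoord, Bool.and_eq_true, Nat.blt_eq] at hok h0 fin
      refine fin I (J + 1) s 0 Side.L false hI (by omega) hs (by omega) hok.2 (by simp [sdist])
        (by simp [scoord]) ?_
      have := cell_lt (k := k) (J := J + 1) (t := 0) (n := 144) (by omega) (by omega)
      rw [Nat.add_mul] at this ⊢
      have e : 72 * a + (J * k + 1 * k + 0) = 72 * a + (J * k + t) + 1 := by omega
      rw [e]
      exact hA.hor _ _ (by omega) (by omega)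
    | B =>
      rw [hinn] at hok h0 fin
      simp only [sdist, scoord] at hok h0 fin
      by_cases h16 : I = 16
      · subst h16
        simp only [natBeq_self, cond_true, Bool.and_eq_true, natBeq_iff,
          Bool.not_eq_true'] at hok
        obtain ⟨hJq, hfl⟩ := hok
        refine ⟨17 * k, 72 * a + (J * k + t), by omega, by omega, ?_, ?_, ?_⟩
        · rw [show 17 * k = 16 * k + s + 1 by omega]
          exact hA.ver _ _ (by omega) (by omega)
        · rw [lab_cell hI hJ hs ht, h]
          simp only [cellLab]
          have e1 := idx_port_inn k τ s t hs ht (inn_ne_out hI hJ h)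
            (by rw [hinn]; simpa [sdist] using h0)
          rw [hinn] at e1
          simp only [Tile.portFlip, hfl, scoord] at e1
          have e2 := colG_mid k a τ.q t hk (by omega) (by omega)
          rw [show 72 * a + (12 * (τ.q * k) + t) = 72 * a + (J * k + t) by rw [hJq]; ring] at e2
          unfold lab
          rw [if_pos (le_refl _), e1, e2]
          simp
          omega
        · rw [rk_cell hI hJ hs ht]
          unfold rk
          rw [if_pos (le_refl _)]
          omega
      · have : Nat.beq I 16 = false := by
          rw [← Bool.not_eq_true, natBeq_iff]; exact h16
        rw [this] at hok
        simp only [cond_false] at hok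
        refine fin (I + 1) J 0 t Side.T false (by omega) hJ (by omega) ht hok (by simp [sdist])
          (by simp [scoord]) ?_
        rw [show (I + 1) * k + 0 = I * k + s + 1 by rw [Nat.add_mul]; omega]
        exact hA.ver _ _ (by omega) (by omega)
    | T =>
      rw [hinn] at hok h0 fin
      simp only [sdist, scoord] at hok h0 fin
      subst h0
      by_cases hI0 : I = 0
      · subst hI0
        simp only [natBeq_self, cond_true] at hok
        simp only [Nat.zero_mul, Nat.zero_add] at fin ⊢
        have key : ∀ (J' t' : ℕ) (f : Bool), J' < 144 → t' < k → contAt τ 0 J' Side.T f = true →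
            (t' = if f = true then k - 1 - t else t) →
            A 0 (72 * a + (J * k + t)) 0 (72 * a + (J' * k + t')) → _ :=
          fun J' t' f h1 h2 h3 h4 h5 => fin 0 J' 0 t' Side.T f (by omega) h1 hk h2 h3 rfl h4
            (by simpa using h5)
        have bl : ∀ m n : ℕ, ¬ m < n → Nat.blt m n = false := fun m n hmn => by
          rw [← Bool.not_eq_true, Nat.blt_eq]; exact hmn
        -- position inside the quarter
        by_cases c1 : J < 18
        · rw [Nat.blt_eq.mpr c1, cond_true] at hok
          refine key (53 - J) (k - 1 - t) true (by omega) (by omega) hok (by simp) ?_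
          have e := cell_lt c1 ht
          have e2 : (53 - J) * k = 53 * k - J * k := Nat.sub_mul _ _ _
          rw [show (53 - J) * k + (k - 1 - t) = 54 * k - 1 - (J * k + t) by omega]
          exact hA.hdl1 _ e
        · rw [bl _ _ c1, cond_false] at hok
          obtain ⟨J1, rfl⟩ : ∃ J1, J = 18 + J1 := ⟨J - 18, by omega⟩
          by_cases c2 : 18 + J1 < 36
          · rw [Nat.blt_eq.mpr c2, cond_true] at hok
            refine key (89 - (18 + J1)) (k - 1 - t) true (by omega) (by omega) hok (by simp) ?_
            have e := cell_lt (n := 18) (J := J1) (by omega) ht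
            have e2 : (89 - (18 + J1)) * k = 89 * k - (18 + J1) * k := Nat.sub_mul _ _ _
            rw [Nat.add_mul] at e2 ⊢
            rw [show (89 - (18 + J1)) * k + (k - 1 - t) = 72 * k - 1 - (J1 * k + t) by omega,
              Nat.add_assoc]
            exact hA.hdl2 _ e
          · rw [bl _ _ c2, cond_false] at hok
            obtain ⟨J2, rfl⟩ : ∃ J2, J1 = 18 + J2 := ⟨J1 - 18, by omega⟩
            by_cases c3 : 18 + (18 + J2) < 54
            · rw [Nat.blt_eq.mpr c3, cond_true] at hok
              refine key (53 - (18 + (18 + J2))) (k - 1 - t) true (by omega) (by omega) hok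
                (by simp) ?_
              have e := cell_lt (n := 18) (J := 53 - (18 + (18 + J2))) (t := k - 1 - t) (k := k)
                (by omega) (by omega)
              have e2 : (53 - (18 + (18 + J2))) * k = 53 * k - (18 + (18 + J2)) * k :=
                Nat.sub_mul _ _ _
              have e3 := cell_lt c3 ht
              have e5 : (18 + (18 + J2)) * k ≤ 53 * k := Nat.mul_le_mul_right k (by omega)
              have e4 := hA.symm _ _ _ _ (hA.hdl1 _ e)
              rw [show 54 * k - 1 - ((53 - (18 + (18 + J2))) * k + (k - 1 - t)) =
                (18 + (18 + J2)) * k + t by omega] at e4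
              exact e4
            · rw [bl _ _ c3, cond_false] at hok
              obtain ⟨J3, rfl⟩ : ∃ J3, J2 = 18 + J3 := ⟨J2 - 18, by omega⟩
              by_cases c4 : 18 + (18 + (18 + J3)) < 72
              · rw [Nat.blt_eq.mpr c4, cond_true] at hok
                refine key (18 + (17 - J3)) (k - 1 - t) true (by omega) (by omega)
                  (by rw [show 18 + (17 - J3) = 89 - (18 + (18 + (18 + J3))) by omega]
                      exact hok) (by simp) ?_
                have e := cell_lt (n := 18) (J := 17 - J3) (t := k - 1 - t) (k := k)
                  (by omega) (by omega)
                have e2 : (17 - J3) * k = 17 * k - J3 * k := Nat.sub_mul _ _ _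
                have e3 := cell_lt (n := 18) (J := J3) (t := t) (k := k) (by omega) (by omega)
                have e5 : J3 * k ≤ 17 * k := Nat.mul_le_mul_right k (by omega)
                have e4 := hA.symm _ _ _ _ (hA.hdl2 _ e)
                rw [show 72 * k - 1 - ((17 - J3) * k + (k - 1 - t)) =
                  (18 + (18 + (18 + J3))) * k + t by simp only [Nat.add_mul]; omega,
                  ← Nat.add_assoc (18 * k), ← Nat.add_mul] at e4
                exact e4
              · rw [bl _ _ c4, cond_false] at hok
                obtain ⟨J4, rfl⟩ : ∃ J4, J3 = 18 + J4 := ⟨J3 - 18, by omega⟩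
                by_cases c5 : 18 + (18 + (18 + (18 + J4))) < 108
                · rw [Nat.blt_eq.mpr c5, cond_true] at hok
                  refine key _ t false (by omega) ht hok (by simp) ?_
                  have e := cell_lt (n := 36) (J := J4) (t := t) (k := k) (by omega) (by omega)
                  have e4 := hA.crs _ e
                  simp only [Nat.add_mul]
                  convert e4 using 1 <;> omega
                · rw [bl _ _ c5, cond_false] at hok
                  obtain ⟨J5, rfl⟩ : ∃ J5, J4 = 36 + J5 := ⟨J4 - 36, by omega⟩
                  refine key (72 + J5) t false (by omega) ht
                    (by rw [show 72 + J5 = 18 + (18 + (18 + (18 + (36 + J5)))) - 36 by omega]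
                        exact hok) (by simp) ?_
                  have e := cell_lt (n := 36) (J := J5) (t := t) (k := k) (by omega) (by omega)
                  have e4 := hA.symm _ _ _ _ (hA.crs _ e)
                  simp only [Nat.add_mul]
                  convert e4 using 1 <;> omega
      · have : Nat.beq I 0 = false := by
          rw [← Bool.not_eq_true, natBeq_iff]; exact hI0
        rw [this] at hok
        simp only [cond_false] at hok
        obtain ⟨I, rfl⟩ : ∃ I', I = I' + 1 := ⟨I - 1, by omega⟩
        refine fin I J (k - 1) t Side.B false (by omega) hJ (by omega) ht hok (by simp [sdist])
          (by simp [scoord]) ?_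
        rw [show (I + 1) * k + 0 = I * k + (k - 1) + 1 by rw [Nat.add_mul]; omega]
        exact hA.symm _ _ _ _
          (hA.ver _ _ (by rw [Nat.add_mul] at hy; omega) (by omega))
  · obtain ⟨s', t', hs', ht', hadj, hidx, hrk⟩ :=
      idx_step k τ s t hs ht (inn_ne_out hI hJ h) h0
    have hy' := cell_lt hI hs'
    have hx' := cell_lt hJ ht'
    refine ⟨I * k + s', 72 * a + (J * k + t'), by omega, by omega, ?_, ?_, ?_⟩
    · rcases hadj with ⟨rfl, rfl | rfl⟩ | ⟨rfl, rfl | rfl⟩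
      · exact hA.hor (I * k + s') (72 * a + (J * k + t)) (by omega) (by omega)
      · exact hA.symm _ _ _ _
          (hA.hor (I * k + s') (72 * a + (J * k + t')) (by omega) (by omega))
      · exact hA.ver (I * k + s) _ (by omega) (by omega)
      · exact hA.symm _ _ _ _ (hA.ver (I * k + s') _ (by omega) (by omega))
    · rw [lab_cell hI hJ hs ht, lab_cell hI hJ hs' ht', h]
      simp only [cellLab, hidx]
    · rw [rk_cell hI hJ hs ht, rk_cell hI hJ hs' ht', h]
      simp only [cellRank]
      omega

/-- Every host vertex which is not the root of its branch set has a neighbour of smaller rank in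
the same branch set. -/
theorem host_step {k a N : ℕ} {A : ℕ → ℕ → ℕ → ℕ → Prop} (hA : HostAdj k a N A)
    (hk : 1 ≤ k) (hN : 72 * a + 144 * k ≤ N) {y x : ℕ} (hy : y < 18 * k) (hx : x < N)
    {w : ℕ × ℕ} (hw : lab k a y x = some w) :
    (17 * k ≤ y ∧ (x = 0 ∨ colG k a (x - 1) ≠ colG k a x)) ∨
    ∃ y' x', y' < 18 * k ∧ x' < N ∧ A y x y' x' ∧ lab k a y' x' = some w ∧
      rk k a N y' x' < rk k a N y x := by
  by_cases h1 : 17 * k ≤ y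
  · by_cases h2 : x = 0 ∨ colG k a (x - 1) ≠ colG k a x
    · exact Or.inl ⟨h1, h2⟩
    · push Not at h2
      right
      refine ⟨y, x - 1, hy, by omega, ?_, ?_, ?_⟩
      · have := hA.symm _ _ _ _ (hA.hor y (x - 1) hy (by omega))
        rwa [Nat.sub_add_cancel (by omega)] at this
      · rw [← hw]
        unfold lab
        rw [if_pos h1, if_pos h1, h2.2]
      · unfold rk
        rw [if_pos h1, if_pos h1]
        omega
  · right
    by_cases h2 : x < 72 * a ∨ 72 * a + 144 * k ≤ x
    · refine ⟨y + 1, x, by omega, hx, hA.ver _ _ (by omega) hx, ?_, ?_⟩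
      · rw [← hw]
        unfold lab
        rw [if_neg h1, if_pos h2]
        split_ifs with h3
        · rw [show y + 1 - 17 * k = 0 by omega]
        · rfl
      · unfold rk
        rw [if_neg h1, if_pos h2]
        split_ifs <;> omega
    · have hI : y / k < 17 := by rw [Nat.div_lt_iff_lt_mul (by omega)]; omega
      have hJ : (x - 72 * a) / k < 144 := by rw [Nat.div_lt_iff_lt_mul (by omega)]; omega
      have hs : y % k < k := Nat.mod_lt _ (by omega)
      have ht : (x - 72 * a) % k < k := Nat.mod_lt _ (by omega)
      have ey : y / k * k + y % k = y := Nat.div_add_mod' y k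
      have ex : 72 * a + ((x - 72 * a) / k * k + (x - 72 * a) % k) = x := by
        rw [Nat.div_add_mod']; omega
      cases hτ : tile (y / k) ((x - 72 * a) / k) with
      | none =>
        unfold lab at hw
        rw [if_neg h1, if_neg h2, hτ] at hw
        simp [cellLab] at hw
      | some τ =>
        have := mid_step hA hk hN hI hJ hs ht hτ
        rw [ey, ex, hw] at this
        exact this

/-! ### Minors from labellings -/

theorem minor_of_label {α β γ : Type*} (H : SimpleGraph α) (G : SimpleGraph β) (co : α → γ)
    (hco : Function.Injective co) (L : β → Option γ) (rank : β → ℕ) (root : α → β)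
    (hroot : ∀ w, L (root w) = some (co w))
    (hstep : ∀ v w, L v = some (co w) → v ≠ root w →
      ∃ u, G.Adj v u ∧ L u = some (co w) ∧ rank u < rank v)
    (hadj : ∀ u v, H.Adj u v → ∃ x y, L x = some (co u) ∧ L y = some (co v) ∧ G.Adj x y) :
    IsMinorOf H G := by
  refine ⟨fun w => {v | L v = some (co w)}, ?_, ?_, ?_⟩
  · intro u v huv
    rw [Set.disjoint_left]
    intro x hx hy
    simp only [Set.mem_setOf_eq] at hx hy
    rw [hx] at hy
    exact huv (hco (Option.some.inj hy))
  · intro w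
    have key : ∀ (n : ℕ) (v : β) (hv : L v = some (co w)), rank v ≤ n →
        (G.induce {v | L v = some (co w)}).Reachable ⟨v, hv⟩ ⟨root w, hroot w⟩ := by
      intro n
      induction n with
      | zero =>
        intro v hv hn
        by_cases h : v = root w
        · subst h; exact SimpleGraph.Reachable.refl _
        · obtain ⟨u, _, _, h3⟩ := hstep v w hv h
          omega
      | succ n ih =>
        intro v hv hn
        by_cases h : v = root w
        · subst h; exact SimpleGraph.Reachable.refl _
        · obtain ⟨u, h1, h2, h3⟩ := hstep v w hv h
          have e : (G.induce {v | L v = some (co w)}).Adj ⟨v, hv⟩ ⟨u, h2⟩ := by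
            simpa using h1
          exact e.reachable.trans (ih u h2 (by omega))
    haveI : Nonempty ↑{v | L v = some (co w)} := ⟨⟨root w, hroot w⟩⟩
    exact SimpleGraph.Connected.mk
      (fun x y => (key _ x.1 x.2 le_rfl).trans (key _ y.1 y.2 le_rfl).symm)
  · intro u v huv
    obtain ⟨x, y, h1, h2, h3⟩ := hadj u v huv
    exact ⟨x, h1, y, h2, h3⟩

/-! ### Coordinates -/

/-- The zero-based column of a residue class. -/
def colX {N : ℕ} (z : ZMod N) : ℕ := (z - 1).val

theorem colX_lt {N : ℕ} [NeZero N] (z : ZMod N) : colX z < N := ZMod.val_lt _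

theorem colX_cast {N : ℕ} [NeZero N] (z : ZMod N) : ((colX z : ℕ) : ZMod N) + 1 = z := by
  unfold colX
  rw [ZMod.natCast_zmod_val]; ring

theorem colX_of {N x : ℕ} (hx : x < N) : colX ((x : ZMod N) + 1) = x := by
  unfold colX
  rw [add_sub_cancel_right, ZMod.val_cast_of_lt hx]

theorem colX_of_eq {N x m : ℕ} (hx : x < N) (hm : m = x + 1) {z : ZMod N}
    (hz : z = (m : ZMod N)) : colX z = x := by
  rw [hz, hm, Nat.cast_add, Nat.cast_one, colX_of hx]

theorem colX_inj {N : ℕ} [NeZero N] {z w : ZMod N} (h : colX z = colX w) : z = w := by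
  rw [← colX_cast z, h, colX_cast]

theorem colX_succ {N : ℕ} [NeZero N] (z : ZMod N) :
    (colX z + 1 < N ∧ colX (z + 1) = colX z + 1) ∨ (colX z + 1 = N ∧ colX (z + 1) = 0) := by
  have h1 := colX_lt z
  have h2 := colX_cast z
  by_cases h : colX z + 1 < N
  · left
    refine ⟨h, ?_⟩
    conv_lhs => rw [← h2]
    have := colX_of h
    rwa [Nat.cast_add, Nat.cast_one] at this
  · right
    have h3 : colX z + 1 = N := by omega
    refine ⟨h3, ?_⟩
    have h4 : z = 0 := by
      rw [← h2, ← Nat.cast_one (R := ZMod N), ← Nat.cast_add, h3, ZMod.natCast_self]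
    have := colX_of (N := N) (x := 0) (by omega)
    rw [Nat.cast_zero] at this
    rw [h4, this]

/-- Adjacency of a mixed grid in zero-based coordinates. -/
def coAdj (K n : ℕ) (Ih Ic : Finset ℕ) (y x y' x' : ℕ) : Prop :=
  ∃ p q : Fin K × ZMod (4 * n * K), (mixedGrid K n Ih Ic).Adj p q ∧
    (p.1 : ℕ) = y ∧ colX p.2 = x ∧ (q.1 : ℕ) = y' ∧ colX q.2 = x'

theorem coAdj_symm {K n : ℕ} {Ih Ic : Finset ℕ} {y x y' x' : ℕ}
    (h : coAdj K n Ih Ic y x y' x') : coAdj K n Ih Ic y' x' y x := by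
  obtain ⟨p, q, h1, h2, h3, h4, h5⟩ := h
  exact ⟨q, p, h1.symm, h4, h5, h2, h3⟩

theorem coAdj_hor {K n : ℕ} {Ih Ic : Finset ℕ} {y x : ℕ} (hy : y < K) (hx : x + 1 < 4 * n * K) :
    coAdj K n Ih Ic y x y (x + 1) := by
  have e1 := colX_of (N := 4 * n * K) (x := x) (by omega)
  have e2 := colX_of hx
  refine ⟨(⟨y, hy⟩, (x : ZMod _) + 1), (⟨y, hy⟩, ((x + 1 : ℕ) : ZMod _) + 1), ?_, rfl, e1, rfl, e2⟩
  unfold mixedGrid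
  rw [SimpleGraph.fromRel_adj]
  refine ⟨?_, Or.inl (Or.inl ⟨rfl, ?_⟩)⟩
  · intro h
    have := congrArg (fun v => colX v.2) h
    simp only [e1, e2] at this
    omega
  · push_cast; ring

theorem coAdj_wrap {K n : ℕ} {Ih Ic : Finset ℕ} {y : ℕ} (hy : y < K) (hN : 1 < 4 * n * K) :
    coAdj K n Ih Ic y (4 * n * K - 1) y 0 := by
  have e1 := colX_of (N := 4 * n * K) (x := 4 * n * K - 1) (by omega)
  have e2 := colX_of (N := 4 * n * K) (x := 0) (by omega)
  refine ⟨(⟨y, hy⟩, ((4 * n * K - 1 : ℕ) : ZMod _) + 1), (⟨y, hy⟩, ((0 : ℕ) : ZMod _) + 1), ?_, rfl,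
    e1, rfl, e2⟩
  unfold mixedGrid
  rw [SimpleGraph.fromRel_adj]
  refine ⟨?_, Or.inl (Or.inl ⟨rfl, ?_⟩)⟩
  · intro h
    have := congrArg (fun v => colX v.2) h
    simp only [e1, e2] at this
    omega
  · simp only
    rw [← Nat.cast_one (R := ZMod (4 * n * K)), ← Nat.cast_add (4 * n * K - 1),
      Nat.sub_add_cancel (by omega), ZMod.natCast_self, Nat.cast_zero]

theorem coAdj_ver {K n : ℕ} {Ih Ic : Finset ℕ} {y x : ℕ} (hy : y + 1 < K) (hx : x < 4 * n * K) :
    coAdj K n Ih Ic y x (y + 1) x := by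
  have e1 := colX_of hx
  refine ⟨(⟨y, by omega⟩, (x : ZMod _) + 1), (⟨y + 1, hy⟩, (x : ZMod _) + 1), ?_, rfl, e1, rfl, e1⟩
  unfold mixedGrid
  rw [SimpleGraph.fromRel_adj]
  refine ⟨?_, Or.inl (Or.inr (Or.inl ⟨rfl, rfl⟩))⟩
  intro h
  have := congrArg (fun v => (v.1 : ℕ)) h
  simp only at this
  omega

theorem seg_le {K n P : ℕ} (hP : 1 ≤ P) (hPn : P ≤ n) :
    4 * K * (P - 1) + 4 * K ≤ 4 * n * K := by
  obtain ⟨P, rfl⟩ : ∃ P', P = P' + 1 := ⟨P - 1, by omega⟩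
  have : K * (P + 1) ≤ K * n := Nat.mul_le_mul_left K hPn
  calc 4 * K * (P + 1 - 1) + 4 * K = 4 * (K * (P + 1)) := by
        rw [Nat.add_sub_cancel]; ring
    _ ≤ 4 * (K * n) := by omega
    _ = 4 * n * K := by ring

theorem coAdj_hdl1 {K n : ℕ} {Ih Ic : Finset ℕ} {P e : ℕ} (hP : P ∈ Ih) (h1 : 1 ≤ P)
    (hPn : P ≤ n) (he : e < K) :
    coAdj K n Ih Ic 0 (4 * K * (P - 1) + e) 0 (4 * K * (P - 1) + (3 * K - 1 - e)) := by
  have hs := seg_le (K := K) h1 hPn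
  have e1 := colX_of (N := 4 * n * K) (x := 4 * K * (P - 1) + e) (by omega)
  have e2 := colX_of (N := 4 * n * K) (x := 4 * K * (P - 1) + (3 * K - 1 - e)) (by omega)
  refine ⟨(⟨0, by omega⟩, _), (⟨0, by omega⟩, _), ?_, rfl, e1, rfl, e2⟩
  unfold mixedGrid
  rw [SimpleGraph.fromRel_adj]
  refine ⟨?_, Or.inl (Or.inr (Or.inr (Or.inl ⟨rfl, rfl, P, hP, e + 1, ?_, Or.inl ⟨?_, ?_⟩⟩)))⟩
  · intro h
    have := congrArg (fun v => colX v.2) h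
    simp only [e1, e2] at this
    omega
  · rw [Finset.mem_Icc]; omega
  · simp only
    rw [← Nat.cast_succ]; congr 1
  · simp only
    rw [← Nat.cast_succ]; congr 1; omega

theorem coAdj_hdl2 {K n : ℕ} {Ih Ic : Finset ℕ} {P e : ℕ} (hP : P ∈ Ih) (h1 : 1 ≤ P)
    (hPn : P ≤ n) (he : e < K) :
    coAdj K n Ih Ic 0 (4 * K * (P - 1) + (K + e)) 0 (4 * K * (P - 1) + (4 * K - 1 - e)) := by
  have hs := seg_le (K := K) h1 hPn
  have e1 := colX_of (N := 4 * n * K) (x := 4 * K * (P - 1) + (K + e)) (by omega)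
  have e2 := colX_of (N := 4 * n * K) (x := 4 * K * (P - 1) + (4 * K - 1 - e)) (by omega)
  refine ⟨(⟨0, by omega⟩, _), (⟨0, by omega⟩, _), ?_, rfl, e1, rfl, e2⟩
  unfold mixedGrid
  rw [SimpleGraph.fromRel_adj]
  refine ⟨?_, Or.inl (Or.inr (Or.inr (Or.inl ⟨rfl, rfl, P, hP, e + 1, ?_, Or.inr ⟨?_, ?_⟩⟩)))⟩
  · intro h
    have := congrArg (fun v => colX v.2) h
    simp only [e1, e2] at this
    omega
  · rw [Finset.mem_Icc]; omega
  · simp only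
    rw [← Nat.cast_succ]; congr 1; omega
  · simp only
    rw [← Nat.cast_succ]; congr 1; omega

theorem coAdj_crs {K n : ℕ} {Ih Ic : Finset ℕ} {P e : ℕ} (hP : P ∈ Ic) (h1 : 1 ≤ P)
    (hPn : P ≤ n) (he : e < 2 * K) :
    coAdj K n Ih Ic 0 (4 * K * (P - 1) + e) 0 (4 * K * (P - 1) + (2 * K + e)) := by
  have hs := seg_le (K := K) h1 hPn
  have e1 := colX_of (N := 4 * n * K) (x := 4 * K * (P - 1) + e) (by omega)
  have e2 := colX_of (N := 4 * n * K) (x := 4 * K * (P - 1) + (2 * K + e)) (by omega)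
  refine ⟨(⟨0, by omega⟩, _), (⟨0, by omega⟩, _), ?_, rfl, e1, rfl, e2⟩
  unfold mixedGrid
  rw [SimpleGraph.fromRel_adj]
  refine ⟨?_, Or.inl (Or.inr (Or.inr (Or.inr ⟨rfl, rfl, P, hP, e + 1, ?_, ?_, ?_⟩)))⟩
  · intro h
    have := congrArg (fun v => colX v.2) h
    simp only [e1, e2] at this
    omega
  · rw [Finset.mem_Icc]; omega
  · simp only
    rw [← Nat.cast_succ]; congr 1
  · simp only
    rw [← Nat.cast_succ]; congr 1; omega

/-- To show a symmetric property of all edges of a mixed grid, it is enough to consider the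
defining edges, in zero-based coordinates. -/
theorem mixedGrid_edge_cases {k n : ℕ} {Ih Ic : Finset ℕ} (hk : 1 ≤ k)
    (hIh : ∀ P ∈ Ih, 1 ≤ P ∧ P ≤ n) (hIc : ∀ P ∈ Ic, 1 ≤ P ∧ P ≤ n)
    (Q : ℕ → ℕ → ℕ → ℕ → Prop) (hsymm : ∀ y x y' x', Q y x y' x' → Q y' x' y x)
    (hhor : ∀ y x, y < k → x + 1 < 4 * n * k → Q y x y (x + 1))
    (hwrap : ∀ y, y < k → Q y (4 * n * k - 1) y 0)
    (hver : ∀ y x, y + 1 < k → x < 4 * n * k → Q y x (y + 1) x)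
    (hhdl1 : ∀ P ∈ Ih, ∀ e, e < k →
      Q 0 (4 * k * (P - 1) + e) 0 (4 * k * (P - 1) + (3 * k - 1 - e)))
    (hhdl2 : ∀ P ∈ Ih, ∀ e, e < k →
      Q 0 (4 * k * (P - 1) + (k + e)) 0 (4 * k * (P - 1) + (4 * k - 1 - e)))
    (hcrs : ∀ P ∈ Ic, ∀ e, e < 2 * k →
      Q 0 (4 * k * (P - 1) + e) 0 (4 * k * (P - 1) + (2 * k + e)))
    (hn : 1 ≤ n)
    (p q : Fin k × ZMod (4 * n * k)) (h : (mixedGrid k n Ih Ic).Adj p q) :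
    Q p.1 (colX p.2) q.1 (colX q.2) := by
  haveI : NeZero (4 * n * k) := ⟨by positivity⟩
  unfold mixedGrid at h
  rw [SimpleGraph.fromRel_adj] at h
  have key : ∀ p q : Fin k × ZMod (4 * n * k), (
    (p.1 = q.1 ∧ q.2 = p.2 + 1) ∨
    (p.2 = q.2 ∧ (q.1 : ℕ) = (p.1 : ℕ) + 1) ∨
    ((p.1 : ℕ) = 0 ∧ (q.1 : ℕ) = 0 ∧ ∃ i ∈ Ih, ∃ j ∈ Finset.Icc 1 k,
      ((p.2 = ((4 * k * (i - 1) + j : ℕ) : ZMod (4 * n * k)) ∧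
        q.2 = ((4 * k * (i - 1) + 3 * k - j + 1 : ℕ) : ZMod (4 * n * k))) ∨
       (p.2 = ((4 * k * (i - 1) + k + j : ℕ) : ZMod (4 * n * k)) ∧
        q.2 = ((4 * k * (i - 1) + 4 * k - j + 1 : ℕ) : ZMod (4 * n * k))))) ∨
    ((p.1 : ℕ) = 0 ∧ (q.1 : ℕ) = 0 ∧ ∃ i ∈ Ic, ∃ j ∈ Finset.Icc 1 (2 * k),
      p.2 = ((4 * k * (i - 1) + j : ℕ) : ZMod (4 * n * k)) ∧
      q.2 = ((4 * k * (i - 1) + 2 * k + j : ℕ) : ZMod (4 * n * k)))) →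
      Q p.1 (colX p.2) q.1 (colX q.2) := by
    intro p q hr
    rcases hr with ⟨h1, h2⟩ | ⟨h1, h2⟩ | ⟨h1, h2, P, hP, j, hj, h3⟩ | ⟨h1, h2, P, hP, j, hj, h3⟩
    · rw [h2, ← h1]
      rcases colX_succ p.2 with ⟨h3, h4⟩ | ⟨h3, h4⟩
      · rw [h4]; exact hhor _ _ p.1.2 h3
      · rw [h4, show colX p.2 = 4 * n * k - 1 by omega]; exact hwrap _ p.1.2
    · rw [← h1, h2]
      exact hver _ _ (by rw [← h2]; exact q.1.2) (colX_lt _)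
    · rw [Finset.mem_Icc] at hj
      have hs := seg_le (K := k) (hIh P hP).1 (hIh P hP).2
      rw [h1, h2]
      rcases h3 with ⟨h3, h4⟩ | ⟨h3, h4⟩
      · rw [colX_of_eq (x := 4 * k * (P - 1) + (j - 1)) (by omega) (by omega) h3,
          colX_of_eq (x := 4 * k * (P - 1) + (3 * k - 1 - (j - 1))) (by omega) (by omega) h4]
        exact hhdl1 P hP _ (by omega)
      · rw [colX_of_eq (x := 4 * k * (P - 1) + (k + (j - 1))) (by omega) (by omega) h3,
          colX_of_eq (x := 4 * k * (P - 1) + (4 * k - 1 - (j - 1))) (by omega) (by omega) h4]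
        exact hhdl2 P hP _ (by omega)
    · rw [Finset.mem_Icc] at hj
      have hs := seg_le (K := k) (hIc P hP).1 (hIc P hP).2
      rw [h1, h2]
      obtain ⟨h3, h4⟩ := h3
      rw [colX_of_eq (x := 4 * k * (P - 1) + (j - 1)) (by omega) (by omega) h3,
          colX_of_eq (x := 4 * k * (P - 1) + (2 * k + (j - 1))) (by omega) (by omega) h4]
      exact hcrs P hP _ (by omega)
  rcases h.2 with h | h
  · exact key p q h
  · exact hsymm _ _ _ _ (key q p h)

/-! ### The target edges -/

theorem lab_left {k a x : ℕ} (hk : 1 ≤ k) (hx : x < 72 * a) : lab k a 0 x = some (0, x / 18) := by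
  unfold lab
  rw [if_neg (by omega), if_pos (Or.inl hx)]
  unfold colG
  rw [if_pos hx]

theorem lab_right {k a x : ℕ} (hk : 1 ≤ k) (hx : 72 * a + 144 * k ≤ x) :
    lab k a 0 x = some (0, x / 18 + 4 * k) := by
  unfold lab
  rw [if_neg (by omega), if_pos (Or.inr hx)]
  unfold colG
  rw [if_neg (by omega), if_neg (by omega)]

theorem lab_low {k a y x : ℕ} : lab k a (17 * k + y) x = some (y, colG k a x) := by
  unfold lab
  rw [if_pos (by omega), Nat.add_sub_cancel_left]

/-- The last block of each wire. -/
theorem lab_end {k a q u : ℕ} (hq : endOK q = true) (hq9 : q ≤ 9) (hu : u < k) :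
    lab k a (16 * k + (k - 1)) (72 * a + (12 * (q + 2) * k + u)) =
      some (0, 4 * a + (q * k + u)) := by
  rw [lab_cell (by omega) (by omega) (by omega) hu]
  unfold endOK at hq
  cases ht : tile 16 (12 * (q + 2)) with
  | none => rw [ht] at hq; exact absurd hq (by simp)
  | some τ =>
    rw [ht] at hq
    simp only [Bool.and_eq_true, Bool.not_eq_true'] at hq
    obtain ⟨⟨h1, h2⟩, h3⟩ := hq
    have h1 := natBeq_iff.1 h1
    have h2 := Side.eq_of_beq h2
    have h4 := idx_port_out k τ (k - 1) u (by omega) hu (inn_ne_out (by omega) (by omega) ht)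
      (by rw [h2]; simp [sdist])
    rw [h2] at h4
    simp only [Tile.portFlip, h3, scoord] at h4
    simp only [cellLab]
    rw [h4, h1]
    simp [Nat.add_assoc]

/-- The edges of the target grid are present between the branch sets. -/
theorem target_crosscap {k a N q u : ℕ} {A : ℕ → ℕ → ℕ → ℕ → Prop} (hA : HostAdj k a N A)
    (hN : 72 * a + 144 * k ≤ N) (hq : endOK q = true) (hq9 : q ≤ 9) (hu : u < k) :
    ∃ Y X Y' X', A Y X Y' X' ∧ lab k a Y X = some (0, 4 * a + (q * k + u)) ∧
      lab k a Y' X' = some (0, 4 * a + ((q + 2) * k + u)) := by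
  have e : 12 * (q + 2) * k = 12 * ((q + 2) * k) := by ring
  have hb : (q + 2) * k ≤ 11 * k := Nat.mul_le_mul_right k (by omega)
  refine ⟨16 * k + (k - 1), 72 * a + (12 * (q + 2) * k + u), 17 * k + 0,
    72 * a + (12 * (q + 2) * k + u), ?_, lab_end hq hq9 hu, ?_⟩
  · have := hA.ver (16 * k + (k - 1)) (72 * a + (12 * (q + 2) * k + u)) (by omega)
      (by rw [e]; omega)
    rwa [show 16 * k + (k - 1) + 1 = 17 * k + 0 by omega] at this
  · rw [lab_low, e, colG_mid k a (q + 2) u (by omega) (by omega) (by omega),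
      Nat.min_eq_left (by omega), Nat.add_assoc]

theorem target_crosscap_cols {k a N m e : ℕ} {A : ℕ → ℕ → ℕ → ℕ → Prop} (hA : HostAdj k a N A)
    (hN : 72 * a + 144 * k ≤ N) (hm : m < 3) (he : e < 2 * k) :
    ∃ Y X Y' X', A Y X Y' X' ∧ lab k a Y X = some (0, 4 * (a + m * k) + e) ∧
      lab k a Y' X' = some (0, 4 * (a + m * k) + (2 * k + e)) := by
  obtain ⟨h0, h1, h4, h5, h8, h9⟩ := endOK_all
  by_cases hek : e < k
  · have hq : endOK (4 * m) = true := by interval_cases m <;> assumption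
    have := target_crosscap hA hN hq (by omega) hek
    rw [show 4 * (a + m * k) + e = 4 * a + (4 * m * k + e) by ring,
      show 4 * (a + m * k) + (2 * k + e) = 4 * a + ((4 * m + 2) * k + e) by ring]
    exact this
  · have hq : endOK (4 * m + 1) = true := by interval_cases m <;> assumption
    obtain ⟨u, rfl⟩ := Nat.exists_eq_add_of_le (Nat.le_of_not_lt hek)
    have := target_crosscap hA hN hq (by omega) (u := u) (by omega)
    rw [show 4 * (a + m * k) + (k + u) = 4 * a + ((4 * m + 1) * k + u) by ring,
      show 4 * (a + m * k) + (2 * k + (k + u)) = 4 * a + ((4 * m + 1 + 2) * k + u) by ring]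
    exact this

theorem colG_first_unique {k a x x' : ℕ} (hk : 1 ≤ k) (h : colG k a x = colG k a x')
    (hx : x = 0 ∨ colG k a (x - 1) ≠ colG k a x)
    (hx' : x' = 0 ∨ colG k a (x' - 1) ≠ colG k a x') : x = x' := by
  rcases Nat.lt_trichotomy x x' with hl | hl | hl
  · have h1 := colG_mono k a hk (show x ≤ x' - 1 by omega)
    have h2 := colG_mono k a hk (show x' - 1 ≤ x' by omega)
    omega
  · exact hl
  · have h1 := colG_mono k a hk (show x' ≤ x - 1 by omega)
    have h2 := colG_mono k a hk (show x - 1 ≤ x by omega)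
    omega

theorem seg_host (k P : ℕ) : 4 * (18 * k) * (P - 1) = 72 * (k * (P - 1)) := by ring
theorem seg_target (k P : ℕ) : 4 * k * (P - 1) = 4 * (k * (P - 1)) := by ring

theorem seg_mono {k P P' : ℕ} (d : ℕ) (hP : 1 ≤ P) (h : P + d ≤ P') :
    k * (P - 1) + d * k ≤ k * (P' - 1) := by
  have : k * (P - 1 + d) ≤ k * (P' - 1) := Nat.mul_le_mul_left k (by omega)
  rw [Nat.mul_add, Nat.mul_comm k d] at this
  exact this

theorem hostAdj_mixedGrid {k n i : ℕ} {Ih Ic : Finset ℕ} (hi1 : 1 ≤ i) (hin : i + 1 ≤ n)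
    (hih : i ∈ Ih) (hic : i + 1 ∈ Ic) :
    HostAdj k (k * (i - 1)) (4 * n * (18 * k)) (coAdj (18 * k) n Ih Ic) where
  symm := fun _ _ _ _ h => coAdj_symm h
  hor := fun _ _ h1 h2 => coAdj_hor h1 h2
  ver := fun _ _ h1 h2 => coAdj_ver h1 h2
  hdl1 := by
    intro e he
    have := coAdj_hdl1 (K := 18 * k) (n := n) (Ic := Ic) hih hi1 (by omega) he
    rwa [seg_host, show 3 * (18 * k) - 1 - e = 54 * k - 1 - e by omega] at this
  hdl2 := by
    intro e he
    have := coAdj_hdl2 (K := 18 * k) (n := n) (Ic := Ic) hih hi1 (by omega) he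
    rwa [seg_host, show 4 * (18 * k) - 1 - e = 72 * k - 1 - e by omega] at this
  crs := by
    intro e he
    have := coAdj_crs (K := 18 * k) (n := n) (Ih := Ih) hic (by omega) (by omega)
      (e := e) (by omega)
    rw [seg_host] at this
    have e1 : k * (i + 1 - 1) = k * (i - 1) + k := by
      obtain ⟨j, rfl⟩ : ∃ j, i = j + 1 := ⟨i - 1, by omega⟩
      simp only [Nat.add_sub_cancel]; ring
    rwa [e1, show 72 * (k * (i - 1) + k) + e = 72 * (k * (i - 1)) + (72 * k + e) by ring,
      show 72 * (k * (i - 1) + k) + (2 * (18 * k) + e) = 72 * (k * (i - 1)) + (108 * k + e) by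
        ring] at this

/-- The minor part, for index sets described by membership. -/
theorem minor_part {k n i : ℕ} {Ih Ic Jh Jc : Finset ℕ} (hk : 1 ≤ k) (hi1 : 1 ≤ i)
    (hin : i + 1 ≤ n) (hih : i ∈ Ih) (hic : i + 1 ∈ Ic)
    (hIh : ∀ P ∈ Ih, 1 ≤ P ∧ P ≤ n) (hIc : ∀ P ∈ Ic, 1 ≤ P ∧ P ≤ n)
    (hJh : ∀ P ∈ Jh, (P ∈ Ih ∧ P < i) ∨ ∃ P' ∈ Ih, i + 1 < P' ∧ P = P' + 1)
    (hJc : ∀ P ∈ Jc, (P ∈ Ic ∧ P < i) ∨ (∃ m, m < 3 ∧ P = i + m) ∨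
      ∃ P' ∈ Ic, i + 1 < P' ∧ P = P' + 1) :
    IsMinorOf (mixedGrid k (n + 1) Jh Jc) (mixedGrid (18 * k) n Ih Ic) := by
  have hA := hostAdj_mixedGrid (k := k) hi1 hin hih hic
  obtain ⟨a, ha⟩ : ∃ a, a = k * (i - 1) := ⟨_, rfl⟩
  obtain ⟨b, hb⟩ : ∃ b, b = k * n := ⟨_, rfl⟩
  have hN : 4 * n * (18 * k) = 72 * b := by rw [hb]; ring
  have hN' : 4 * (n + 1) * k = 4 * b + 4 * k := by rw [hb]; ring
  have hab : a + 2 * k ≤ b := by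
    have := seg_mono (k := k) 2 hi1 (show i + 2 ≤ n + 1 by omega)
    rw [ha, hb]; exact this
  have hAN : 72 * a + 144 * k ≤ 4 * n * (18 * k) := by rw [hN]; omega
  rw [← ha] at hA
  haveI : NeZero (4 * n * (18 * k)) := ⟨by omega⟩
  haveI : NeZero (4 * (n + 1) * k) := ⟨by omega⟩
  have hfirst : ∀ w : Fin k × ZMod (4 * (n + 1) * k), ∃ x, x < 72 * b ∧ colG k a x = colX w.2 ∧
      (x = 0 ∨ colG k a (x - 1) + 1 = colX w.2) := fun w =>
    colG_first k a b (colX w.2) hk hab (by rw [← hN']; exact colX_lt _)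
  choose X0 hX0 hX1 hX2 using hfirst
  refine minor_of_label _ _ (fun w => ((w.1 : ℕ), colX w.2)) ?_
    (fun v => lab k a v.1 (colX v.2)) (fun v => rk k a (4 * n * (18 * k)) v.1 (colX v.2))
    (fun w => (⟨17 * k + w.1, by have := w.1.2; omega⟩, (X0 w : ZMod _) + 1)) ?_ ?_ ?_
  · intro v w h
    simp only [Prod.mk.injEq] at h
    exact Prod.ext (Fin.ext h.1) (colX_inj h.2)
  · intro w
    simp only
    rw [colX_of (by rw [hN]; exact hX0 w), lab_low, hX1]
  · intro v w hv hne
    rcases host_step hA hk hAN v.1.2 (colX_lt v.2) hv with ⟨h1, h2⟩ | h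
    · exfalso
      apply hne
      obtain ⟨r, hr⟩ := Nat.exists_eq_add_of_le h1
      simp only [hr, lab_low, Option.some.injEq, Prod.mk.injEq] at hv
      have hx : colX v.2 = X0 w := by
        apply colG_first_unique hk (by rw [hv.2, hX1]) h2
        rcases hX2 w with h | h
        · exact Or.inl h
        · right; rw [hX1]; omega
      refine Prod.ext (Fin.ext ?_) (colX_inj ?_)
      · simp only; omega
      · simp only
        rw [colX_of (by rw [hN]; exact hX0 w), hx]
    · obtain ⟨y', x', -, -, ⟨p, q, h3, h4, h5, h6, h7⟩, h8, h9⟩ := h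
      have hp : p = v := Prod.ext (Fin.ext h4) (colX_inj h5)
      subst hp
      refine ⟨q, h3, ?_, ?_⟩
      · rw [h6, h7]; exact h8
      · rw [h6, h7]; exact h9
  · intro u v huv
    have hseg : ∀ P ∈ Ih ∪ Ic, (P < i → k * (P - 1) + k ≤ a) ∧
        (i + 1 < P → a + 2 * k ≤ k * (P - 1)) := by
      intro P hP
      have hP1 : 1 ≤ P := by
        rcases Finset.mem_union.1 hP with h | h
        · exact (hIh P h).1
        · exact (hIc P h).1
      constructor
      · intro h
        have := seg_mono (k := k) 1 hP1 (show P + 1 ≤ i by omega)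
        rw [ha]; omega
      · intro h
        have := seg_mono (k := k) 2 hi1 (show i + 2 ≤ P by omega)
        rw [ha]; omega
    have hshift : ∀ P, 1 ≤ P → k * (P + 1 - 1) = k * (P - 1) + k := by
      intro P hP
      obtain ⟨j, rfl⟩ : ∃ j, P = j + 1 := ⟨P - 1, by omega⟩
      simp only [Nat.add_sub_cancel]; ring
    have key := mixedGrid_edge_cases (k := k) (n := n + 1) (Ih := Jh) (Ic := Jc) hk ?_ ?_
      (fun y x y' x' => ∃ Y X Y' X', coAdj (18 * k) n Ih Ic Y X Y' X' ∧
        lab k a Y X = some (y, x) ∧ lab k a Y' X' = some (y', x')) ?_ ?_ ?_ ?_ ?_ ?_ ?_ (by omega)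
        u v huv
    · obtain ⟨Y, X, Y', X', ⟨p, q, h3, h4, h5, h6, h7⟩, h8, h9⟩ := key
      refine ⟨p, q, ?_, ?_, h3⟩
      · rw [h4, h5]; exact h8
      · rw [h6, h7]; exact h9
    · intro P hP
      rcases hJh P hP with ⟨h, h'⟩ | ⟨P', h, h', rfl⟩
      · have := hIh P h; omega
      · have := hIh P' h; omega
    · intro P hP
      rcases hJc P hP with ⟨h, h'⟩ | ⟨m, h, rfl⟩ | ⟨P', h, h', rfl⟩
      · have := hIc P h; omega
      · omega
      · have := hIc P' h; omega
    · rintro y x y' x' ⟨Y, X, Y', X', h1, h2, h3⟩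
      exact ⟨Y', X', Y, X, coAdj_symm h1, h3, h2⟩
    · intro y x hy hx
      obtain ⟨X, h1, h2, h3⟩ := colG_first k a b (x + 1) hk hab (by rw [← hN']; exact hx)
      have hX : X ≠ 0 := by
        rintro rfl
        rw [colG_zero k a hk] at h2
        omega
      obtain ⟨X, rfl⟩ : ∃ X', X = X' + 1 := ⟨X - 1, by omega⟩
      rw [Nat.add_sub_cancel] at h3
      refine ⟨17 * k + y, X, 17 * k + y, X + 1, coAdj_hor (by omega) (by rw [hN]; exact h1), ?_, ?_⟩
      · rw [lab_low, show colG k a X = x by omega]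
      · rw [lab_low, h2]
    · intro y hy
      refine ⟨17 * k + y, 4 * n * (18 * k) - 1, 17 * k + y, 0,
        coAdj_wrap (by omega) (by omega), ?_, ?_⟩
      · rw [lab_low, hN, colG_last k a b hk hab, hN']
      · rw [lab_low, colG_zero k a hk]
    · intro y x hy hx
      obtain ⟨X, h1, h2, -⟩ := colG_first k a b x hk hab (by rw [← hN']; exact hx)
      refine ⟨17 * k + y, X, 17 * k + y + 1, X, coAdj_ver (by omega) (by rw [hN]; exact h1), ?_, ?_⟩
      · rw [lab_low, h2]
      · rw [Nat.add_assoc, lab_low, h2]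
    · intro P hP e he
      rcases hJh P hP with ⟨h, h'⟩ | ⟨P', h, h', rfl⟩
      · have hs := (hseg P (Finset.mem_union_left _ h)).1 h'
        refine ⟨_, _, _, _, coAdj_hdl1 (K := 18 * k) (n := n) (Ic := Ic) h (hIh P h).1 (hIh P h).2
          (e := 18 * e) (by omega), ?_, ?_⟩
        · rw [seg_host, seg_target, lab_left hk (by omega)]
          congr 2; omega
        · rw [seg_host, seg_target, lab_left hk (by omega)]
          congr 2; omega
      · have hs := (hseg P' (Finset.mem_union_left _ h)).2 h'
        have hs' := hshift P' (hIh P' h).1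
        refine ⟨_, _, _, _, coAdj_hdl1 (K := 18 * k) (n := n) (Ic := Ic) h (hIh P' h).1
          (hIh P' h).2 (e := 18 * e) (by omega), ?_, ?_⟩
        · rw [seg_host, seg_target, lab_right hk (by omega), hs']
          congr 2; omega
        · rw [seg_host, seg_target, lab_right hk (by omega), hs']
          congr 2; omega
    · intro P hP e he
      rcases hJh P hP with ⟨h, h'⟩ | ⟨P', h, h', rfl⟩
      · have hs := (hseg P (Finset.mem_union_left _ h)).1 h'
        refine ⟨_, _, _, _, coAdj_hdl2 (K := 18 * k) (n := n) (Ic := Ic) h (hIh P h).1 (hIh P h).2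
          (e := 18 * e) (by omega), ?_, ?_⟩
        · rw [seg_host, seg_target, lab_left hk (by omega)]
          congr 2; omega
        · rw [seg_host, seg_target, lab_left hk (by omega)]
          congr 2; omega
      · have hs := (hseg P' (Finset.mem_union_left _ h)).2 h'
        have hs' := hshift P' (hIh P' h).1
        refine ⟨_, _, _, _, coAdj_hdl2 (K := 18 * k) (n := n) (Ic := Ic) h (hIh P' h).1
          (hIh P' h).2 (e := 18 * e) (by omega), ?_, ?_⟩
        · rw [seg_host, seg_target, lab_right hk (by omega), hs']
          congr 2; omega
        · rw [seg_host, seg_target, lab_right hk (by omega), hs']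
          congr 2; omega
    · intro P hP e he
      rcases hJc P hP with ⟨h, h'⟩ | ⟨m, hm, rfl⟩ | ⟨P', h, h', rfl⟩
      · have hs := (hseg P (Finset.mem_union_right _ h)).1 h'
        refine ⟨_, _, _, _, coAdj_crs (K := 18 * k) (n := n) (Ih := Ih) h (hIc P h).1 (hIc P h).2
          (e := 18 * e) (by omega), ?_, ?_⟩
        · rw [seg_host, seg_target, lab_left hk (by omega)]
          congr 2; omega
        · rw [seg_host, seg_target, lab_left hk (by omega)]
          congr 2; omega
      · have e1 : k * (i + m - 1) = a + m * k := by
          rw [ha, show i + m - 1 = i - 1 + m by omega]; ring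
        rw [seg_target, e1]
        exact target_crosscap_cols hA hAN hm he
      · have hs := (hseg P' (Finset.mem_union_right _ h)).2 h'
        have hs' := hshift P' (hIc P' h).1
        refine ⟨_, _, _, _, coAdj_crs (K := 18 * k) (n := n) (Ih := Ih) h (hIc P' h).1
          (hIc P' h).2 (e := 18 * e) (by omega), ?_, ?_⟩
        · rw [seg_host, seg_target, lab_right hk (by omega), hs']
          congr 2; omega
        · rw [seg_host, seg_target, lab_right hk (by omega), hs']
          congr 2; omega

/-- Let `k ≥ 1`, `h ≥ 0`, `c ≥ 3` and let `{I''_hdl, I''_crscp}` be a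
partition of `[2, h+c]` with `|I''_hdl| = h+1`, `|I''_crscp| = c−2`, and suppose
`i ∈ I''_hdl` and `i+1 ∈ I''_crscp`.  With
`I'_hdl := {j ∈ I''_hdl | j < i} ∪ {j+1 | j ∈ I''_hdl, j > i+1}` and
`I'_crscp := {j ∈ I''_crscp | j < i} ∪ {i, i+1, i+2} ∪ {j+1 | j ∈ I''_crscp, j > i+1}`,
the pair `{I'_hdl, I'_crscp}` is a partition of `[2, h+c+1]` with `|I'_hdl| = h` and
`|I'_crscp| = c`, and the mixed surface grid of order `18k` with positions
`I''_hdl, I''_crscp` contains the mixed surface grid of order `k` with positions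
`I'_hdl, I'_crscp` as a minor. -/
theorem mixedGrid_handle_to_three_crosscaps (k h c : ℕ) (hk : 1 ≤ k) (hc : 3 ≤ c)
    (I''h I''c : Finset ℕ)
    (hpart : I''h ∪ I''c = Finset.Icc 2 (h + c)) (hdisj : Disjoint I''h I''c)
    (hIh : I''h.card = h + 1) (hIc : I''c.card = c - 2)
    (i : ℕ) (hi : i ∈ I''h) (hi1 : i + 1 ∈ I''c)
    (I'h I'c : Finset ℕ)
    (hI'h : I'h = (I''h.filter (fun j => j < i)) ∪
      ((I''h.filter (fun j => i + 1 < j)).image (fun j => j + 1)))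
    (hI'c : I'c = (I''c.filter (fun j => j < i)) ∪ {i, i + 1, i + 2} ∪
      ((I''c.filter (fun j => i + 1 < j)).image (fun j => j + 1))) :
    (I'h ∪ I'c = Finset.Icc 2 (h + c + 1) ∧ Disjoint I'h I'c ∧
      I'h.card = h ∧ I'c.card = c) ∧
    IsMinorOf (mixedGrid k (h + c + 1) I'h I'c) (mixedGrid (18 * k) (h + c) I''h I''c) := by
  have hmem : ∀ P, (P ∈ I''h ∨ P ∈ I''c) ↔ (2 ≤ P ∧ P ≤ h + c) := by
    intro P
    rw [← Finset.mem_union, hpart, Finset.mem_Icc]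
  have hdis : ∀ P, P ∈ I''h → P ∈ I''c → False := fun P h1 h2 =>
    Finset.disjoint_left.1 hdisj h1 h2
  have hi2 := (hmem i).1 (Or.inl hi)
  have hi3 := (hmem (i + 1)).1 (Or.inr hi1)
  have hnh : i + 1 ∉ I''h := fun h => hdis _ h hi1
  have hmh : ∀ P, P ∈ I'h ↔ (P ∈ I''h ∧ P < i) ∨ ∃ P' ∈ I''h, i + 1 < P' ∧ P = P' + 1 := by
    intro P
    rw [hI'h]
    simp only [Finset.mem_union, Finset.mem_filter, Finset.mem_image]
    constructor
    · rintro (h | ⟨P', ⟨h1, h2⟩, rfl⟩)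
      · exact Or.inl h
      · exact Or.inr ⟨P', h1, h2, rfl⟩
    · rintro (h | ⟨P', h1, h2, rfl⟩)
      · exact Or.inl h
      · exact Or.inr ⟨P', ⟨h1, h2⟩, rfl⟩
  have hmc : ∀ P, P ∈ I'c ↔ (P ∈ I''c ∧ P < i) ∨ (∃ m, m < 3 ∧ P = i + m) ∨
      ∃ P' ∈ I''c, i + 1 < P' ∧ P = P' + 1 := by
    intro P
    rw [hI'c]
    simp only [Finset.mem_union, Finset.mem_filter, Finset.mem_image, Finset.mem_insert,
      Finset.mem_singleton]
    constructor
    · rintro ((h | h) | ⟨P', ⟨h1, h2⟩, rfl⟩)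
      · exact Or.inl h
      · exact Or.inr (Or.inl ⟨P - i, by omega, by omega⟩)
      · exact Or.inr (Or.inr ⟨P', h1, h2, rfl⟩)
    · rintro (h | ⟨m, h1, rfl⟩ | ⟨P', h1, h2, rfl⟩)
      · exact Or.inl (Or.inl h)
      · exact Or.inl (Or.inr (by omega))
      · exact Or.inr ⟨P', ⟨h1, h2⟩, rfl⟩
  have hU : I'h ∪ I'c = Finset.Icc 2 (h + c + 1) := by
    ext P
    rw [Finset.mem_union, Finset.mem_Icc, hmh, hmc]
    constructor
    · rintro ((⟨h1, h2⟩ | ⟨P', h1, h2, rfl⟩) | (⟨h1, h2⟩ | ⟨m, h1, rfl⟩ | ⟨P', h1, h2, rfl⟩))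
      · have := (hmem P).1 (Or.inl h1); omega
      · have := (hmem P').1 (Or.inl h1); omega
      · have := (hmem P).1 (Or.inr h1); omega
      · omega
      · have := (hmem P').1 (Or.inr h1); omega
    · rintro ⟨h1, h2⟩
      by_cases c1 : P < i
      · rcases (hmem P).2 (by omega) with h | h
        · exact Or.inl (Or.inl ⟨h, c1⟩)
        · exact Or.inr (Or.inl ⟨h, c1⟩)
      · by_cases c2 : P < i + 3
        · exact Or.inr (Or.inr (Or.inl ⟨P - i, by omega, by omega⟩))
        · rcases (hmem (P - 1)).2 (by omega) with h | h
          · exact Or.inl (Or.inr ⟨P - 1, h, by omega, by omega⟩)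
          · exact Or.inr (Or.inr (Or.inr ⟨P - 1, h, by omega, by omega⟩))
  have hD : Disjoint I'h I'c := by
    rw [Finset.disjoint_left]
    intro P h1 h2
    rw [hmh] at h1
    rw [hmc] at h2
    rcases h1 with ⟨h1, h1'⟩ | ⟨P', h1, h1', rfl⟩
    · rcases h2 with ⟨h2, h2'⟩ | ⟨m, h2, h2'⟩ | ⟨P'', h2, h2', h2''⟩
      · exact hdis _ h1 h2
      · omega
      · omega
    · rcases h2 with ⟨h2, h2'⟩ | ⟨m, h2, h2'⟩ | ⟨P'', h2, h2', h2''⟩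
      · omega
      · omega
      · have : P' = P'' := by omega
        subst this
        exact hdis _ h1 h2
  have hch : I'h.card = h := by
    have e1 : I''h.erase i = I''h.filter (fun j => j < i) ∪ I''h.filter (fun j => i + 1 < j) := by
      ext P
      simp only [Finset.mem_erase, Finset.mem_union, Finset.mem_filter]
      constructor
      · rintro ⟨h1, h2⟩
        have : P ≠ i + 1 := fun h => hnh (h ▸ h2)
        by_cases hP : P < i
        · exact Or.inl ⟨h2, hP⟩
        · exact Or.inr ⟨h2, by omega⟩
      · rintro (⟨h1, h2⟩ | ⟨h1, h2⟩)
        · exact ⟨by omega, h1⟩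
        · exact ⟨by omega, h1⟩
    have e2 := Finset.card_erase_of_mem hi
    rw [e1, Finset.card_union_of_disjoint, hIh] at e2
    · rw [hI'h, Finset.card_union_of_disjoint,
        Finset.card_image_of_injective _ (fun x y (hxy : x + 1 = y + 1) => by omega)]
      · omega
      · rw [Finset.disjoint_left]
        intro P h1 h2
        rw [Finset.mem_filter] at h1
        obtain ⟨Q, h3, rfl⟩ := Finset.mem_image.1 h2
        rw [Finset.mem_filter] at h3
        omega
    · rw [Finset.disjoint_left]
      intro P h1 h2
      rw [Finset.mem_filter] at h1 h2
      omega
  have hcc : I'c.card = c := by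
    have := Finset.card_union_of_disjoint hD
    rw [hU, Nat.card_Icc, hch] at this
    omega
  refine ⟨⟨hU, hD, hch, hcc⟩, ?_⟩
  refine minor_part hk (by omega) (by omega) hi hi1 ?_ ?_ (fun P hP => (hmh P).1 hP)
    (fun P hP => (hmc P).1 hP)
  · intro P hP
    have := (hmem P).1 (Or.inl hP)
    omega
  · intro P hP
    have := (hmem P).1 (Or.inr hP)
    omega
end

section
/- For all integers k ≥ 1, h ≥ 0 and c ≥ 3, the Dyck-grid D^{(h,c)}_{18k} contains the Dyck-grid D^{(h+1,c−2)}_k as a minor. -/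
open SimpleGraph

/-- Membership of the cell `(r, c)` in the U-shaped arc with feet `l`, `q` and depth `d`. -/
def inArc (l q d r c : ℕ) : Prop :=
  (r ≤ d ∧ (c = l ∨ c = q)) ∨ (r = d ∧ l ≤ c ∧ c ≤ q)

/-- The branch set of the vertex in row `i` and column `p`, in coordinates. -/
def inBranch (K k : ℕ) (φ : ℕ → ℕ) (U : ℕ → ℕ → ℕ → ℕ → ℕ → Prop) (i p r c : ℕ) : Prop :=
  (r + k = K + i ∧ φ p ≤ c ∧ c < φ (p + 1)) ∨
  (i = 0 ∧ r + k < K ∧ c = φ p) ∨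
  (i = 0 ∧ ∃ s l q d, U s p l q d ∧ inArc l q d r c)

/-- Reachability inside a set. -/
def Rch {β : Type*} (G : SimpleGraph β) (S : Set β) (a b : β) : Prop :=
  ∃ (ha : a ∈ S) (hb : b ∈ S), (G.induce S).Reachable ⟨a, ha⟩ ⟨b, hb⟩

lemma Rch.refl {β : Type*} {G : SimpleGraph β} {S : Set β} {a : β} (h : a ∈ S) :
    Rch G S a a := ⟨h, h, SimpleGraph.Reachable.refl _⟩

lemma Rch.symm {β : Type*} {G : SimpleGraph β} {S : Set β} {a b : β} (h : Rch G S a b) :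
    Rch G S b a := by
  obtain ⟨ha, hb, h⟩ := h
  exact ⟨hb, ha, h.symm⟩

lemma Rch.trans {β : Type*} {G : SimpleGraph β} {S : Set β} {a b c : β} (h : Rch G S a b)
    (h' : Rch G S b c) : Rch G S a c := by
  obtain ⟨ha, hb, h⟩ := h
  obtain ⟨hb', hc, h'⟩ := h'
  exact ⟨ha, hc, h.trans h'⟩

lemma Rch.adj {β : Type*} {G : SimpleGraph β} {S : Set β} {a b : β} (ha : a ∈ S) (hb : b ∈ S)
    (h : G.Adj a b) : Rch G S a b :=
  ⟨ha, hb, SimpleGraph.Adj.reachable (by simpa using h)⟩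

/-- A sequence of consecutive adjacent vertices in `S` is connected in `S`. -/
lemma Rch.seq {β : Type*} {G : SimpleGraph β} {S : Set β} (f : ℕ → β) (a b : ℕ) (hab : a ≤ b)
    (hS : ∀ c, a ≤ c → c ≤ b → f c ∈ S)
    (hA : ∀ c, a ≤ c → c < b → G.Adj (f c) (f (c + 1))) : Rch G S (f a) (f b) := by
  induction b, hab using Nat.le_induction with
  | base => exact Rch.refl (hS a le_rfl le_rfl)
  | succ b hab ih =>
    refine Rch.trans (ih (fun c h1 h2 => hS c h1 (by omega)) (fun c h1 h2 => hA c h1 (by omega))) ?_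
    exact Rch.adj (hS _ hab (by omega)) (hS _ (by omega) le_rfl) (hA b hab (by omega))

theorem core {α β : Type*} (H : SimpleGraph α) (G : SimpleGraph β)
    (K k N N' : ℕ) (hkK : k ≤ K)
    (row col : α → ℕ) (hrow : ∀ u, row u < k) (hcol : ∀ u, col u < N')
    (hinj : ∀ u v, row u = row v → col u = col v → u = v)
    (M' : ℕ → ℕ → Prop)
    (hH : ∀ u v, H.Adj u v → ∃ a b, (a = u ∧ b = v ∨ a = v ∧ b = u) ∧
      ((row a = row b ∧ col b = col a + 1) ∨ (row a = row b ∧ col a + 1 = N' ∧ col b = 0) ∨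
        (col a = col b ∧ row b = row a + 1) ∨ (row a = 0 ∧ row b = 0 ∧ M' (col a) (col b))))
    (vtx : ℕ → ℕ → β)
    (vinj : ∀ r c r' c', r < K → c < N → r' < K → c' < N → vtx r c = vtx r' c' → r = r' ∧ c = c')
    (vh : ∀ r c, r < K → G.Adj (vtx r c) (vtx r (c + 1)))
    (vw : ∀ r c, r < K → c + 1 = N → G.Adj (vtx r c) (vtx r 0))
    (vv : ∀ r c, r + 1 < K → G.Adj (vtx r c) (vtx (r + 1) c))
    (φ : ℕ → ℕ) (φ0 : φ 0 = 0) (φN : φ N' = N) (φs : ∀ p, p < N' → φ p < φ (p + 1))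
    (U : ℕ → ℕ → ℕ → ℕ → ℕ → Prop)
    (hU : ∀ s p l q d, U s p l q d → l ≤ q ∧ q < N ∧ d + k < K)
    (hUφ : ∀ s p l q d x, U s p l q d → x < N' → φ x < l ∨ q < φ x)
    (hUU : ∀ s p l q d s' p' l' q' d', U s p l q d → U s' p' l' q' d' → p = p' ∨ q < l' ∨ q' < l ∨
      (l < l' ∧ q' < q ∧ d' < d) ∨ (l' < l ∧ q < q' ∧ d < d'))
    (hpar : ∀ s p l q d, U s p l q d →
      (∃ e, (e = l ∨ e = q) ∧ G.Adj (vtx 0 (φ p)) (vtx 0 e)) ∨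
      (∃ s' l' q' d', s' < s ∧ U s' p l' q' d' ∧ ∃ e e', (e = l ∨ e = q) ∧ (e' = l' ∨ e' = q') ∧
        G.Adj (vtx 0 e') (vtx 0 e)))
    (hM' : ∀ x y, x < N' → y < N' → M' x y → G.Adj (vtx 0 (φ x)) (vtx 0 (φ y)) ∨
      ∃ s l q d e, U s x l q d ∧ (e = l ∨ e = q) ∧ G.Adj (vtx 0 e) (vtx 0 (φ y))) :
    IsMinorOf H G := by
  have φmono : ∀ x y, x < y → y ≤ N' → φ x < φ y := by
    intro x y hxy
    induction y, hxy using Nat.le_induction with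
    | base => intro h; exact φs x h
    | succ y hxy ih => intro h; exact (ih (by omega)).trans (φs y (by omega))
  have φlt : ∀ x, x < N' → φ x < N := fun x hx => φN ▸ φmono x N' hx le_rfl
  have φle : ∀ x, x < N' → φ (x + 1) ≤ N := by
    intro x hx
    rcases Nat.lt_or_ge (x + 1) N' with h | h
    · exact (φlt _ h).le
    · have : x + 1 = N' := by omega
      rw [this, φN]
  -- coordinates of the branch sets
  have bnd : ∀ i p r c, i < k → p < N' → inBranch K k φ U i p r c → r < K ∧ c < N := by
    rintro i p r c hi hp (⟨h1, h2, h3⟩ | ⟨h1, h2, h3⟩ | ⟨h1, s, l, q, d, hu, ha⟩)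
    · have := φle p hp
      omega
    · have := φlt p hp
      omega
    · have := hU _ _ _ _ _ hu
      rcases ha with ha | ha <;> omega
  have dj : ∀ i p i' p' r c, i < k → i' < k → p < N' → p' < N' → inBranch K k φ U i p r c →
      inBranch K k φ U i' p' r c → i = i' ∧ p = p' := by
    have key : ∀ x y c, x < N' → y < N' → φ x ≤ c → c < φ (x + 1) → φ y ≤ c → c < φ (y + 1) →
        x = y := by
      intro x y c hx hy h1 h2 h3 h4
      rcases Nat.lt_trichotomy x y with h | h | h
      · rcases Nat.lt_or_ge (x + 1) y with h' | h'
        · have := φmono (x + 1) y h' hy.le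
          omega
        · have : x + 1 = y := by omega
          subst this
          omega
      · exact h
      · rcases Nat.lt_or_ge (y + 1) x with h' | h'
        · have := φmono (y + 1) x h' hx.le
          omega
        · have : y + 1 = x := by omega
          subst this
          omega
    rintro i p i' p' r c hi hi' hp hp'
      (⟨h1, h2, h3⟩ | ⟨h1, h2, h3⟩ | ⟨h1, s, l, q, d, hu, ha⟩)
      (⟨g1, g2, g3⟩ | ⟨g1, g2, g3⟩ | ⟨g1, s', l', q', d', hu', ha'⟩)
    · exact ⟨by omega, key _ _ _ hp hp' h2 h3 g2 g3⟩
    · omega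
    · have := hU _ _ _ _ _ hu'
      rcases ha' with ha' | ha' <;> omega
    · omega
    · refine ⟨by omega, key _ _ c hp hp' (by omega) ?_ (by omega) ?_⟩
      · rw [h3]; exact φs _ hp
      · rw [g3]; exact φs _ hp'
    · have := hU _ _ _ _ _ hu'
      have := hUφ _ _ _ _ _ p hu' hp
      rcases ha' with ha' | ha' <;> omega
    · have := hU _ _ _ _ _ hu
      rcases ha with ha | ha <;> omega
    · have := hU _ _ _ _ _ hu
      have := hUφ _ _ _ _ _ p' hu hp'
      rcases ha with ha | ha <;> omega
    · have h1 := hU _ _ _ _ _ hu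
      have h2 := hU _ _ _ _ _ hu'
      refine ⟨by omega, ?_⟩
      rcases hUU _ _ _ _ _ _ _ _ _ _ hu hu' with h | h | h | h | h
      · exact h
      all_goals
        exfalso
        rcases ha with ⟨ha, hb | hb⟩ | ⟨ha, hb, hc⟩ <;>
        rcases ha' with ⟨ha', hb' | hb'⟩ | ⟨ha', hb', hc'⟩ <;> omega
  let X : α → Set β := fun u => {b | ∃ r c, inBranch K k φ U (row u) (col u) r c ∧ b = vtx r c}
  have Xmem : ∀ u r c, inBranch K k φ U (row u) (col u) r c → vtx r c ∈ X u :=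
    fun u r c h => ⟨r, c, h, rfl⟩
  have root : ∀ u, inBranch K k φ U (row u) (col u) (K - k + row u) (φ (col u)) := by
    intro u
    exact Or.inl ⟨by omega, le_rfl, φs _ (hcol u)⟩
  have colm : ∀ u r, row u = 0 → r + k ≤ K → inBranch K k φ U (row u) (col u) r (φ (col u)) := by
    intro u r h0 hr
    rcases Nat.lt_or_ge (r + k) K with h | h
    · exact Or.inr (Or.inl ⟨h0, h, rfl⟩)
    · exact Or.inl ⟨by omega, le_rfl, φs _ (hcol u)⟩
  -- the straight column is connected to the root
  have colc : ∀ u r, row u = 0 → r + k ≤ K →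
      Rch G (X u) (vtx r (φ (col u))) (vtx (K - k + row u) (φ (col u))) := by
    intro u r h0 hr
    have hk0 := hrow u
    have := Rch.seq (G := G) (S := X u) (fun r => vtx r (φ (col u))) r (K - k) (by omega)
      (fun x h1 h2 => Xmem u x _ (colm u x h0 (by omega)))
      (fun x h1 h2 => vv x _ (by omega))
    simpa [h0] using this
  -- arcs are connected
  have arcc : ∀ u s l q d r c, row u = 0 → U s (col u) l q d → inArc l q d r c →
      Rch G (X u) (vtx r c) (vtx d l) := by
    intro u s l q d r c h0 hu ha
    have hb := hU _ _ _ _ _ hu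
    have mem : ∀ r c, inArc l q d r c → vtx r c ∈ X u := fun r c h =>
      Xmem u r c (Or.inr (Or.inr ⟨h0, s, l, q, d, hu, h⟩))
    have hor : ∀ c, l ≤ c → c ≤ q → Rch G (X u) (vtx d c) (vtx d l) := by
      intro c h1 h2
      exact (Rch.seq (fun c => vtx d c) l c h1
        (fun x h3 h4 => mem _ _ (Or.inr ⟨rfl, h3, by omega⟩))
        (fun x h3 h4 => vh _ _ (by omega))).symm
    have ver : ∀ r c, r ≤ d → (c = l ∨ c = q) → Rch G (X u) (vtx r c) (vtx d c) := by
      intro r c h1 h2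
      exact (Rch.seq (fun r => vtx r c) r d h1
        (fun x h3 h4 => mem _ _ (Or.inl ⟨h4, h2⟩))
        (fun x h3 h4 => vv _ _ (by omega)))
    rcases ha with ⟨h1, h2⟩ | ⟨h1, h2, h3⟩
    · exact (ver r c h1 h2).trans (hor c (by omega) (by omega))
    · subst h1
      exact hor c h2 h3
  have foot : ∀ l q d e, (e = l ∨ e = q) → inArc l q d 0 e := fun l q d e h => Or.inl ⟨by omega, h⟩
  have arcr : ∀ u s l q d, row u = 0 → U s (col u) l q d →
      Rch G (X u) (vtx d l) (vtx (K - k + row u) (φ (col u))) := by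
    intro u s
    induction s using Nat.strong_induction_on with
    | _ s ih =>
      intro l q d h0 hu
      rcases hpar _ _ _ _ _ hu with ⟨e, he, hadj⟩ | ⟨s', l', q', d', hs, hu', e, e', he, he', hadj⟩
      · refine (arcc u s l q d 0 e h0 hu (foot _ _ _ _ he)).symm.trans ?_
        refine Rch.trans ?_ (colc u 0 h0 (by omega))
        exact Rch.adj (Xmem u _ _ (Or.inr (Or.inr ⟨h0, s, l, q, d, hu, foot _ _ _ _ he⟩)))
          (Xmem u _ _ (colm u 0 h0 (by omega))) hadj.symm
      · refine (arcc u s l q d 0 e h0 hu (foot _ _ _ _ he)).symm.trans ?_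
        refine Rch.trans ?_ (ih s' hs l' q' d' h0 hu')
        refine Rch.trans ?_ (arcc u s' l' q' d' 0 e' h0 hu' (foot _ _ _ _ he'))
        exact Rch.adj (Xmem u _ _ (Or.inr (Or.inr ⟨h0, s, l, q, d, hu, foot _ _ _ _ he⟩)))
          (Xmem u _ _ (Or.inr (Or.inr ⟨h0, s', l', q', d', hu', foot _ _ _ _ he'⟩))) hadj.symm
  have conn : ∀ u r c, inBranch K k φ U (row u) (col u) r c →
      Rch G (X u) (vtx r c) (vtx (K - k + row u) (φ (col u))) := by
    intro u r c h
    have hr := hrow u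
    rcases h with ⟨h1, h2, h3⟩ | ⟨h1, h2, h3⟩ | ⟨h1, s, l, q, d, hu, ha⟩
    · have hr' : r = K - k + row u := by omega
      subst hr'
      exact (Rch.seq (fun c => vtx (K - k + row u) c) _ c h2
        (fun x h4 h5 => Xmem u _ _ (Or.inl ⟨h1, h4, by omega⟩))
        (fun x h4 h5 => vh _ _ (by omega))).symm
    · subst h3
      exact colc u r h1 (by omega)
    · exact (arcc u s l q d r c h1 hu ha).trans (arcr u s l q d h1 hu)
  refine ⟨X, ?_, ?_, ?_⟩
  · intro u v huv
    rw [Set.disjoint_left]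
    rintro b ⟨r, c, h, rfl⟩ ⟨r', c', h', he⟩
    have b1 := bnd _ _ _ _ (hrow u) (hcol u) h
    have b2 := bnd _ _ _ _ (hrow v) (hcol v) h'
    obtain ⟨rfl, rfl⟩ := vinj r c r' c' b1.1 b1.2 b2.1 b2.2 he
    have := dj _ _ _ _ _ _ (hrow u) (hrow v) (hcol u) (hcol v) h h'
    exact huv (hinj _ _ this.1 this.2)
  · intro u
    rw [SimpleGraph.connected_iff_exists_forall_reachable]
    refine ⟨⟨_, Xmem u _ _ (root u)⟩, ?_⟩
    rintro ⟨b, r, c, h, rfl⟩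
    obtain ⟨_, _, hh⟩ := (conn u r c h).symm
    exact hh
  · intro u v huv
    have main : ∀ a b, ((row a = row b ∧ col b = col a + 1) ∨
        (row a = row b ∧ col a + 1 = N' ∧ col b = 0) ∨
        (col a = col b ∧ row b = row a + 1) ∨ (row a = 0 ∧ row b = 0 ∧ M' (col a) (col b))) →
        ∃ x ∈ X a, ∃ y ∈ X b, G.Adj x y := by
      intro a b h
      have ra := hrow a
      have rb := hrow b
      have ca := hcol a
      have cb := hcol b
      have hs := φs _ ca
      rcases h with ⟨h1, h2⟩ | ⟨h1, h2, h3⟩ | ⟨h1, h2⟩ | ⟨h1, h2, h3⟩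
      · refine ⟨_, Xmem a (K - k + row a) (φ (col a + 1) - 1) (Or.inl ⟨by omega, by omega, by omega⟩),
          _, Xmem b _ _ (root b), ?_⟩
        rw [← h1, h2]
        have := vh (K - k + row a) (φ (col a + 1) - 1) (by omega)
        rwa [Nat.sub_add_cancel (by omega)] at this
      · refine ⟨_, Xmem a (K - k + row a) (N - 1)
          (Or.inl ⟨by omega, ?_, ?_⟩), _, Xmem b _ _ (root b), ?_⟩
        · rw [h2, φN] at hs; omega
        · rw [h2, φN] at hs ⊢; omega
        · rw [← h1, h3, φ0]
          refine vw _ _ (by omega) ?_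
          rw [h2, φN] at hs; omega
      · refine ⟨_, Xmem a _ _ (root a), _, Xmem b _ _ (root b), ?_⟩
        rw [h2, ← h1, ← Nat.add_assoc]
        exact vv _ _ (by omega)
      · rcases hM' _ _ ca cb h3 with h | ⟨s, l, q, d, e, hu, he, hadj⟩
        · exact ⟨_, Xmem a _ _ (colm a 0 h1 (by omega)), _, Xmem b _ _ (colm b 0 h2 (by omega)), h⟩
        · exact ⟨_, Xmem a _ _ (Or.inr (Or.inr ⟨h1, s, l, q, d, hu, foot _ _ _ _ he⟩)), _,
            Xmem b _ _ (colm b 0 h2 (by omega)), hadj⟩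
    obtain ⟨a, b, hab, h⟩ := hH u v huv
    obtain ⟨x, hx, y, hy, hxy⟩ := main a b h
    rcases hab with ⟨rfl, rfl⟩ | ⟨rfl, rfl⟩
    · exact ⟨x, hx, y, hy, hxy⟩
    · exact ⟨y, hy, x, hx, hxy.symm⟩

lemma mixedGrid_target (k n : ℕ) (hk : 1 ≤ k) (hn : 1 ≤ n) (Ih Ic : Finset ℕ)
    (hh : ∀ i ∈ Ih, 1 ≤ i ∧ i ≤ n) (hc : ∀ i ∈ Ic, 1 ≤ i ∧ i ≤ n)
    (u v : Fin k × ZMod (4 * n * k)) (huv : (mixedGrid k n Ih Ic).Adj u v) :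
    ∃ a b, (a = u ∧ b = v ∨ a = v ∧ b = u) ∧
      (((a.1 : ℕ) = b.1 ∧ (b.2 - 1).val = (a.2 - 1).val + 1) ∨
       ((a.1 : ℕ) = b.1 ∧ (a.2 - 1).val + 1 = 4 * n * k ∧ (b.2 - 1).val = 0) ∨
       ((a.2 - 1).val = (b.2 - 1).val ∧ (b.1 : ℕ) = a.1 + 1) ∨
       ((a.1 : ℕ) = 0 ∧ (b.1 : ℕ) = 0 ∧
        ((∃ i ∈ Ih, ∃ j < k,
          ((a.2 - 1).val = 4 * (k * (i - 1)) + j ∧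
            (b.2 - 1).val + j + 1 = 4 * (k * (i - 1)) + 3 * k) ∨
          ((a.2 - 1).val = 4 * (k * (i - 1)) + k + j ∧
            (b.2 - 1).val + j + 1 = 4 * (k * (i - 1)) + 4 * k)) ∨
         (∃ i ∈ Ic, ∃ j < 2 * k,
          (a.2 - 1).val = 4 * (k * (i - 1)) + j ∧
            (b.2 - 1).val = 4 * (k * (i - 1)) + 2 * k + j)))) := by
  have hN : 4 ≤ 4 * n * k := by nlinarith [Nat.mul_le_mul hn hk]
  have : NeZero (4 * n * k) := ⟨by omega⟩
  have : Fact (1 < 4 * n * k) := ⟨by omega⟩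
  have hval : ∀ (z : ZMod (4 * n * k)) (x : ℕ), 1 ≤ x → x ≤ 4 * n * k →
      z = (x : ZMod (4 * n * k)) → (z - 1).val = x - 1 := by
    intro z x h1 h2 hz
    have : z - 1 = ((x - 1 : ℕ) : ZMod (4 * n * k)) := by
      rw [hz, Nat.cast_sub h1, Nat.cast_one]
    rw [this, ZMod.val_natCast, Nat.mod_eq_of_lt (by omega)]
  have hb : ∀ i, 1 ≤ i → i ≤ n → 4 * (k * (i - 1)) + 4 * k ≤ 4 * n * k := by
    intro i h1 h2
    obtain ⟨m, rfl⟩ : ∃ m, i = m + 1 := ⟨i - 1, by omega⟩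
    have := Nat.mul_le_mul_left k h2
    simp only [Nat.add_sub_cancel]
    nlinarith
  have hre : ∀ i, 4 * k * (i - 1) = 4 * (k * (i - 1)) := fun i => by ring
  rw [mixedGrid, SimpleGraph.fromRel_adj] at huv
  have key : ∀ a b : Fin k × ZMod (4 * n * k), (
    (a.1 = b.1 ∧ b.2 = a.2 + 1) ∨
    (a.2 = b.2 ∧ (b.1 : ℕ) = (a.1 : ℕ) + 1) ∨
    ((a.1 : ℕ) = 0 ∧ (b.1 : ℕ) = 0 ∧ ∃ i ∈ Ih, ∃ j ∈ Finset.Icc 1 k,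
      ((a.2 = ((4 * k * (i - 1) + j : ℕ) : ZMod (4 * n * k)) ∧
        b.2 = ((4 * k * (i - 1) + 3 * k - j + 1 : ℕ) : ZMod (4 * n * k))) ∨
       (a.2 = ((4 * k * (i - 1) + k + j : ℕ) : ZMod (4 * n * k)) ∧
        b.2 = ((4 * k * (i - 1) + 4 * k - j + 1 : ℕ) : ZMod (4 * n * k))))) ∨
    ((a.1 : ℕ) = 0 ∧ (b.1 : ℕ) = 0 ∧ ∃ i ∈ Ic, ∃ j ∈ Finset.Icc 1 (2 * k),
      a.2 = ((4 * k * (i - 1) + j : ℕ) : ZMod (4 * n * k)) ∧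
      b.2 = ((4 * k * (i - 1) + 2 * k + j : ℕ) : ZMod (4 * n * k)))) →
      (((a.1 : ℕ) = b.1 ∧ (b.2 - 1).val = (a.2 - 1).val + 1) ∨
       ((a.1 : ℕ) = b.1 ∧ (a.2 - 1).val + 1 = 4 * n * k ∧ (b.2 - 1).val = 0) ∨
       ((a.2 - 1).val = (b.2 - 1).val ∧ (b.1 : ℕ) = a.1 + 1) ∨
       ((a.1 : ℕ) = 0 ∧ (b.1 : ℕ) = 0 ∧
        ((∃ i ∈ Ih, ∃ j < k,
          ((a.2 - 1).val = 4 * (k * (i - 1)) + j ∧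
            (b.2 - 1).val + j + 1 = 4 * (k * (i - 1)) + 3 * k) ∨
          ((a.2 - 1).val = 4 * (k * (i - 1)) + k + j ∧
            (b.2 - 1).val + j + 1 = 4 * (k * (i - 1)) + 4 * k)) ∨
         (∃ i ∈ Ic, ∃ j < 2 * k,
          (a.2 - 1).val = 4 * (k * (i - 1)) + j ∧
            (b.2 - 1).val = 4 * (k * (i - 1)) + 2 * k + j)))) := by
    rintro a b (⟨h1, h2⟩ | ⟨h1, h2⟩ | ⟨h1, h2, i, hi, j, hj, h⟩ | ⟨h1, h2, i, hi, j, hj, h3, h4⟩)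
    · have e : b.2 - 1 = (a.2 - 1) + 1 := by rw [h2]; ring
      have hv : (b.2 - 1).val = ((a.2 - 1).val + 1) % (4 * n * k) := by
        rw [e, ZMod.val_add, ZMod.val_one]
      have hlt := ZMod.val_lt (a.2 - 1)
      rcases Nat.lt_or_ge ((a.2 - 1).val + 1) (4 * n * k) with h | h
      · rw [Nat.mod_eq_of_lt h] at hv
        exact Or.inl ⟨by rw [h1], hv⟩
      · have h' : (a.2 - 1).val + 1 = 4 * n * k := by omega
        rw [h', Nat.mod_self] at hv
        exact Or.inr (Or.inl ⟨by rw [h1], h', hv⟩)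
    · exact Or.inr (Or.inr (Or.inl ⟨by rw [h1], h2⟩))
    · have b1 := hb i (hh i hi).1 (hh i hi).2
      rw [Finset.mem_Icc] at hj
      refine Or.inr (Or.inr (Or.inr ⟨h1, h2, Or.inl ⟨i, hi, j - 1, by omega, ?_⟩⟩))
      rw [hre] at h
      generalize k * (i - 1) = Q at *
      rcases h with ⟨h3, h4⟩ | ⟨h3, h4⟩
      · left
        rw [hval _ _ (by omega) (by omega) h3, hval _ _ (by omega) (by omega) h4]
        omega
      · right
        rw [hval _ _ (by omega) (by omega) h3, hval _ _ (by omega) (by omega) h4]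
        omega
    · have b1 := hb i (hc i hi).1 (hc i hi).2
      rw [Finset.mem_Icc] at hj
      refine Or.inr (Or.inr (Or.inr ⟨h1, h2, Or.inr ⟨i, hi, j - 1, by omega, ?_⟩⟩))
      rw [hre] at h3 h4
      generalize k * (i - 1) = Q at *
      rw [hval _ _ (by omega) (by omega) h3, hval _ _ (by omega) (by omega) h4]
      omega
  rcases huv.2 with h | h
  · exact ⟨u, v, Or.inl ⟨rfl, rfl⟩, key u v h⟩
  · exact ⟨v, u, Or.inr ⟨rfl, rfl⟩, key v u h⟩

/-- The vertex in row `r` and column `c` (both counted from `0`). -/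
def gv (K N : ℕ) [NeZero K] (r c : ℕ) : Fin K × ZMod N :=
  (Fin.ofNat K r, ((c + 1 : ℕ) : ZMod N))

lemma gv_inj (K N : ℕ) [NeZero K] (r c r' c' : ℕ) (hr : r < K) (hc : c < N) (hr' : r' < K)
    (hc' : c' < N) (h : gv K N r c = gv K N r' c') : r = r' ∧ c = c' := by
  simp only [gv, Prod.mk.injEq] at h
  obtain ⟨h1, h2⟩ := h
  constructor
  · have := congrArg Fin.val h1
    simpa [Fin.ofNat, Nat.mod_eq_of_lt hr, Nat.mod_eq_of_lt hr'] using this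
  · push_cast at h2
    have h3 := add_right_cancel h2
    rw [ZMod.natCast_eq_natCast_iff'] at h3
    rwa [Nat.mod_eq_of_lt hc, Nat.mod_eq_of_lt hc'] at h3

lemma ofNat_val (K r : ℕ) [NeZero K] (hr : r < K) : ((Fin.ofNat K r : Fin K) : ℕ) = r := by
  simp [Fin.ofNat, Nat.mod_eq_of_lt hr]

lemma gv_h (K n : ℕ) [NeZero K] (hn : 1 ≤ n) (Ih Ic : Finset ℕ) (r c : ℕ) :
    (mixedGrid K n Ih Ic).Adj (gv K (4 * n * K) r c) (gv K (4 * n * K) r (c + 1)) := by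
  have hK : 1 ≤ K := Nat.one_le_iff_ne_zero.mpr (NeZero.ne K)
  have hN : 4 ≤ 4 * n * K := by nlinarith [Nat.mul_le_mul hn hK]
  have : Fact (1 < 4 * n * K) := ⟨by omega⟩
  rw [mixedGrid, SimpleGraph.fromRel_adj]
  refine ⟨?_, Or.inl (Or.inl ⟨rfl, by simp [gv]⟩)⟩
  simp [gv]

lemma gv_w (K n : ℕ) [NeZero K] (hn : 1 ≤ n) (Ih Ic : Finset ℕ) (r c : ℕ)
    (hc : c + 1 = 4 * n * K) :
    (mixedGrid K n Ih Ic).Adj (gv K (4 * n * K) r c) (gv K (4 * n * K) r 0) := by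
  have : gv K (4 * n * K) r 0 = gv K (4 * n * K) r (c + 1) := by
    simp only [gv, Prod.mk.injEq, true_and]
    rw [hc]
    simp only [Nat.cast_add, ZMod.natCast_self, Nat.cast_zero]
  rw [this]
  exact gv_h K n hn Ih Ic r c

lemma gv_v (K n : ℕ) [NeZero K] (Ih Ic : Finset ℕ) (r c : ℕ) (hr : r + 1 < K) :
    (mixedGrid K n Ih Ic).Adj (gv K (4 * n * K) r c) (gv K (4 * n * K) (r + 1) c) := by
  have h1 := ofNat_val K r (by omega)
  have h2 := ofNat_val K (r + 1) hr
  rw [mixedGrid, SimpleGraph.fromRel_adj]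
  refine ⟨?_, Or.inl (Or.inr (Or.inl ⟨rfl, by simp only [gv, h1, h2]⟩))⟩
  intro h
  have := congrArg (fun x => ((x.1 : Fin K) : ℕ)) h
  simp only [gv, h1, h2] at this
  omega

lemma gv_ne (K n x y : ℕ) [NeZero K] (hxy : x < y) (hy : y < 4 * n * K) :
    gv K (4 * n * K) 0 x ≠ gv K (4 * n * K) 0 y := by
  intro h
  have hK : 0 < K := Nat.pos_of_ne_zero (NeZero.ne K)
  have := gv_inj K (4 * n * K) 0 x 0 y hK (by omega) hK hy h
  omega

lemma gv_crosscap (K n : ℕ) [NeZero K] (Ih Ic : Finset ℕ) (i x y Q : ℕ) (hi : i + 1 ∈ Ic)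
    (hin : i + 1 ≤ n) (hQ : Q = K * i)
    (h1 : 4 * Q ≤ x) (h2 : x < 4 * Q + 2 * K) (h3 : y = x + 2 * K) :
    (mixedGrid K n Ih Ic).Adj (gv K (4 * n * K) 0 x) (gv K (4 * n * K) 0 y) := by
  have hK : 0 < K := Nat.pos_of_ne_zero (NeZero.ne K)
  have h0 := ofNat_val K 0 hK
  have hb : 4 * Q + 4 * K ≤ 4 * n * K := by
    have := Nat.mul_le_mul_left K hin
    subst hQ
    nlinarith
  rw [mixedGrid, SimpleGraph.fromRel_adj]
  refine ⟨gv_ne K n x y (by omega) (by omega), Or.inl (Or.inr (Or.inr (Or.inr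
    ⟨h0, h0, i + 1, hi, x - 4 * Q + 1, ?_, ?_, ?_⟩)))⟩
  · rw [Finset.mem_Icc]; omega
  · have : x + 1 = 4 * K * (i + 1 - 1) + (x - 4 * Q + 1) := by
      rw [Nat.add_sub_cancel, mul_assoc, ← hQ]; omega
    simp only [gv, this]
  · have : y + 1 = 4 * K * (i + 1 - 1) + 2 * K + (x - 4 * Q + 1) := by
      rw [Nat.add_sub_cancel, mul_assoc, ← hQ]; omega
    simp only [gv, this]

lemma gv_handle (K n : ℕ) [NeZero K] (Ih Ic : Finset ℕ) (i x y Q : ℕ) (hi : i + 1 ∈ Ih)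
    (hin : i + 1 ≤ n) (hQ : Q = K * i)
    (h : (4 * Q ≤ x ∧ x < 4 * Q + K ∧ x + y + 1 = 8 * Q + 3 * K) ∨
      (4 * Q + K ≤ x ∧ x < 4 * Q + 2 * K ∧ x + y + 1 = 8 * Q + 5 * K)) :
    (mixedGrid K n Ih Ic).Adj (gv K (4 * n * K) 0 x) (gv K (4 * n * K) 0 y) := by
  have hK : 0 < K := Nat.pos_of_ne_zero (NeZero.ne K)
  have h0 := ofNat_val K 0 hK
  have hb : 4 * Q + 4 * K ≤ 4 * n * K := by
    have := Nat.mul_le_mul_left K hin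
    subst hQ
    nlinarith
  rw [mixedGrid, SimpleGraph.fromRel_adj]
  refine ⟨gv_ne K n x y (by omega) (by omega), Or.inl (Or.inr (Or.inr (Or.inl
    ⟨h0, h0, i + 1, hi, ?_⟩)))⟩
  rcases h with ⟨h1, h2, h3⟩ | ⟨h1, h2, h3⟩
  · refine ⟨x - 4 * Q + 1, ?_, Or.inl ⟨?_, ?_⟩⟩
    · rw [Finset.mem_Icc]; omega
    · have : x + 1 = 4 * K * (i + 1 - 1) + (x - 4 * Q + 1) := by
        rw [Nat.add_sub_cancel, mul_assoc, ← hQ]; omega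
      simp only [gv, this]
    · have : y + 1 = 4 * K * (i + 1 - 1) + 3 * K - (x - 4 * Q + 1) + 1 := by
        rw [Nat.add_sub_cancel, mul_assoc, ← hQ]; omega
      simp only [gv, this]
  · refine ⟨x - 4 * Q - K + 1, ?_, Or.inr ⟨?_, ?_⟩⟩
    · rw [Finset.mem_Icc]; omega
    · have : x + 1 = 4 * K * (i + 1 - 1) + K + (x - 4 * Q - K + 1) := by
        rw [Nat.add_sub_cancel, mul_assoc, ← hQ]; omega
      simp only [gv, this]
    · have : y + 1 = 4 * K * (i + 1 - 1) + 4 * K - (x - 4 * Q - K + 1) + 1 := by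
        rw [Nat.add_sub_cancel, mul_assoc, ← hQ]; omega
      simp only [gv, this]

/-- The image of the `t`-th column of block `b` (blocks counted from `0`). -/
def fcol (k h b t : ℕ) : ℕ :=
  if b = 0 then t
  else if b ≤ h then
    72 * (k * b) + (if t < k then t else if t < 2 * k then 17 * k + t
      else if t < 3 * k then 51 * k + t else 68 * k + t)
  else if b = h + 1 then 72 * (k * (h + 1)) + t
  else if b = h + 2 then
    72 * (k * (h + 1)) + (if t < 2 * k then 4 * k + t else 179 * k + t)
  else 72 * (k * (b + 1)) + (if t < 2 * k then t else 34 * k + t)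

/-- The image of the `p`-th column. -/
def phi (k h p : ℕ) : ℕ := fcol k h (p / (4 * k)) (p % (4 * k))

lemma phi_eq (k h b t p : ℕ) (ht : t < 4 * k) (hp : p = 4 * (k * b) + t) :
    phi k h p = fcol k h b t := by
  have h1 : p / (4 * k) = b := by
    rw [hp, ← mul_assoc, Nat.mul_add_div (by omega), Nat.div_eq_of_lt ht, add_zero]
  have h2 : p % (4 * k) = t := by
    rw [hp, ← mul_assoc, Nat.mul_add_mod, Nat.mod_eq_of_lt ht]
  rw [phi, h1, h2]

lemma fcol_step (k h b t : ℕ) (ht : t + 1 < 4 * k) : fcol k h b t < fcol k h b (t + 1) := by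
  unfold fcol
  split_ifs <;> omega

lemma fcol_handle (k h b t : ℕ) (h1 : 1 ≤ b) (h2 : b ≤ h) : fcol k h b t =
    72 * (k * b) + (if t < k then t else if t < 2 * k then 17 * k + t
      else if t < 3 * k then 51 * k + t else 68 * k + t) := by
  unfold fcol
  rw [if_neg (by omega), if_pos h2]

lemma fcol_new (k h t : ℕ) : fcol k h (h + 1) t = 72 * (k * (h + 1)) + t := by
  unfold fcol
  rw [if_neg (by omega), if_neg (by omega), if_pos rfl]

lemma fcol_mid (k h t : ℕ) : fcol k h (h + 2) t =
    72 * (k * (h + 1)) + (if t < 2 * k then 4 * k + t else 179 * k + t) := by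
  unfold fcol
  rw [if_neg (by omega), if_neg (by omega), if_neg (by omega), if_pos rfl]

lemma fcol_late (k h b t : ℕ) (hb : h + 3 ≤ b) : fcol k h b t =
    72 * (k * (b + 1)) + (if t < 2 * k then t else 34 * k + t) := by
  unfold fcol
  rw [if_neg (by omega), if_neg (by omega), if_neg (by omega), if_neg (by omega)]

lemma fcol_block (k h b t : ℕ) (ht : t + 1 = 4 * k) : fcol k h b t < fcol k h (b + 1) 0 := by
  have e1 : k * (b + 1) = k * b + k := by ring
  have e2 : k * (b + 1 + 1) = k * b + 2 * k := by ring
  have e3 : k * (h + 1) = k * h + k := by ring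
  by_cases hb0 : b = 0
  · subst hb0
    have z : fcol k h 0 t = t := by simp [fcol]
    rw [z]
    by_cases hh : h = 0
    · subst hh
      rw [fcol_new]
      omega
    · rw [fcol_handle k h (0 + 1) 0 (by omega) (by omega), if_pos (by omega)]
      omega
  · rcases Nat.lt_or_ge b h with hb | hb
    · rw [fcol_handle k h b t (by omega) (by omega),
        fcol_handle k h (b + 1) 0 (by omega) (by omega)]
      rw [if_neg (by omega), if_neg (by omega), if_neg (by omega), if_pos (by omega)]
      omega
    · obtain rfl | rfl | rfl | hb3 : b = h ∨ b = h + 1 ∨ b = h + 2 ∨ h + 3 ≤ b := by omega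
      · rw [fcol_handle k b b t (by omega) (by omega), fcol_new]
        rw [if_neg (by omega), if_neg (by omega), if_neg (by omega)]
        omega
      · rw [fcol_new, fcol_mid, if_pos (by omega)]
        omega
      · rw [fcol_mid, fcol_late k h (h + 2 + 1) 0 (by omega), if_neg (by omega),
          if_pos (by omega)]
        have e4 : k * (h + 2) = k * h + 2 * k := by ring
        omega
      · rw [fcol_late k h b t hb3, fcol_late k h (b + 1) 0 (by omega), if_neg (by omega),
          if_pos (by omega)]
        omega

lemma phi_step (k h p : ℕ) (hk : 1 ≤ k) : phi k h p < phi k h (p + 1) := by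
  have h1 := Nat.div_add_mod p (4 * k)
  have h2 := Nat.mod_lt p (show 0 < 4 * k by omega)
  generalize p / (4 * k) = b at *
  generalize p % (4 * k) = t at *
  rw [mul_assoc] at h1
  rw [phi_eq k h b t p h2 h1.symm]
  rcases Nat.lt_or_ge (t + 1) (4 * k) with h3 | h3
  · rw [phi_eq k h b (t + 1) (p + 1) h3 (by omega)]
    exact fcol_step k h b t h3
  · have e1 : k * (b + 1) = k * b + k := by ring
    rw [phi_eq k h (b + 1) 0 (p + 1) (by omega) (by rw [e1]; omega)]
    exact fcol_block k h b t (by omega)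

/-- The eight bundles of U-shaped arcs.  `P` is the first column of the new handle in the target,
`S` is the first column of the three crosscaps in the source. -/
def arcs (k P S s p l q d : ℕ) : Prop :=
  ∃ t, (t < k ∧ s = 0 ∧ p = P + t ∧ l + t + 1 = S + 7 * k ∧ q = S + 36 * k + t ∧ d = t) ∨
    (t < k ∧ s = 1 ∧ p = P + t ∧ l + t + 1 = S + 43 * k ∧ q = S + 72 * k + t ∧ d = t) ∨
    (t < k ∧ s = 2 ∧ p = P + t ∧ l + t + 1 = S + 39 * k ∧ q = S + 108 * k + t ∧ d = 4 * k + t) ∨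
    (t < k ∧ s = 3 ∧ p = P + k + t ∧ l = S + 37 * k + t ∧ q + t + 1 = S + 181 * k ∧
      d + t + 1 = 6 * k) ∨
    (t < k ∧ s = 4 ∧ p = P + k + t ∧ l = S + 111 * k + t ∧ q + t + 1 = S + 145 * k ∧
      d + t + 1 = k) ∨
    (t < k ∧ s = 5 ∧ p = P + k + t ∧ l + t + 1 = S + 40 * k ∧ q = S + 75 * k + t ∧
      d = 3 * k + t) ∨
    (t < 2 * k ∧ s = 6 ∧ p = P + 4 * k + t ∧ l = S + 40 * k + t ∧ q + t + 1 = S + 75 * k ∧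
      d + t + 1 = 3 * k) ∨
    (t < 2 * k ∧ s = 7 ∧ p = P + 4 * k + t ∧ l + t + 1 = S + 111 * k ∧ q = S + 145 * k + t ∧
      d = k + t)

lemma arcs_bound (k P S s p l q d : ℕ) (h : arcs k P S s p l q d) :
    S + 6 * k ≤ l ∧ l ≤ q ∧ q < S + 181 * k ∧ d + k < 18 * k ∧ P ≤ p ∧ p < P + 6 * k := by
  obtain ⟨t, h | h | h | h | h | h | h | h⟩ := h <;> omega

set_option maxHeartbeats 4000000 in
lemma arcs_arcs (k P S s p l q d s' p' l' q' d' : ℕ) (h : arcs k P S s p l q d)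
    (h' : arcs k P S s' p' l' q' d') : p = p' ∨ q < l' ∨ q' < l ∨
      (l < l' ∧ q' < q ∧ d' < d) ∨ (l' < l ∧ q < q' ∧ d < d') := by
  obtain ⟨t, h | h | h | h | h | h | h | h⟩ := h <;>
  obtain ⟨t', h' | h' | h' | h' | h' | h' | h' | h'⟩ := h' <;> omega

lemma arcs_phi (k h x S : ℕ) (hS : S = 72 * (k * (h + 1))) (hk : 1 ≤ k) :
    phi k h x < S + 6 * k ∨ S + 181 * k ≤ phi k h x := by
  have h1 := Nat.div_add_mod x (4 * k)
  have h2 := Nat.mod_lt x (show 0 < 4 * k by omega)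
  generalize x / (4 * k) = b at *
  generalize x % (4 * k) = t at *
  rw [mul_assoc] at h1
  rw [phi_eq k h b t x h2 h1.symm]
  subst hS
  have e3 : k * (h + 1) = k * h + k := by ring
  unfold fcol
  rw [e3]
  by_cases hb : b ≤ h
  · have := Nat.mul_le_mul_left k hb
    split_ifs <;> omega
  · by_cases hb2 : b ≤ h + 2
    · split_ifs <;> omega
    · have := Nat.mul_le_mul_left k (show h + 4 ≤ b + 1 by omega)
      have e4 : k * (h + 4) = k * h + 4 * k := by ring
      split_ifs <;> omega

set_option maxHeartbeats 4000000 in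
/-- For all integers `k ≥ 1`, `h ≥ 0` and `c ≥ 3`, the Dyck grid
`D_{18k}^{(h,c)}` contains the Dyck grid `D_k^{(h+1,c−2)}` as a minor. -/
theorem dyckGrid_trade_crosscaps_for_handle (k h c : ℕ) (hk : 1 ≤ k) (hc : 3 ≤ c) :
    IsMinorOf (dyckGrid k (h + 1) (c - 2)) (dyckGrid (18 * k) h c) := by
  have : NeZero (18 * k) := ⟨by omega⟩
  have : NeZero (4 * (h + 1 + (c - 2) + 1) * k) :=
    ⟨by positivity⟩
  unfold dyckGrid
  obtain ⟨S, hS⟩ : ∃ S, S = 72 * (k * (h + 1)) := ⟨_, rfl⟩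
  obtain ⟨P, hP⟩ : ∃ P, P = 4 * (k * (h + 1)) := ⟨_, rfl⟩
  have hNN : S + 216 * k ≤ 4 * (h + c + 1) * (18 * k) := by
    have := Nat.mul_le_mul_left k (show h + 4 ≤ h + c + 1 by omega)
    subst hS
    nlinarith
  -- columns of the special region
  have phiS : ∀ x, x < 6 * k → phi k h (P + x) = S + x := by
    intro x hx
    rcases Nat.lt_or_ge x (4 * k) with h1 | h1
    · rw [phi_eq k h (h + 1) x (P + x) h1 (by omega), hS, fcol_new]
    · have e : k * (h + 2) = k * (h + 1) + k := by ring
      rw [phi_eq k h (h + 2) (x - 4 * k) (P + x) (by omega) (by rw [e]; omega), hS, fcol_mid,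
        if_pos (by omega)]
      omega
  have phiZ : ∀ x, 6 * k ≤ x → x < 8 * k → phi k h (P + x) = S + 175 * k + x := by
    intro x hx hx'
    have e : k * (h + 2) = k * (h + 1) + k := by ring
    rw [phi_eq k h (h + 2) (x - 4 * k) (P + x) (by omega) (by rw [e]; omega), hS, fcol_mid,
      if_neg (by omega)]
    omega
  -- edges of the three special crosscaps
  have cross : ∀ x y, ((S ≤ x ∧ x < S + 36 * k) ∨ (S + 72 * k ≤ x ∧ x < S + 108 * k) ∨
      (S + 144 * k ≤ x ∧ x < S + 180 * k)) → y = x + 36 * k →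
      (mixedGrid (18 * k) (h + c + 1) (Finset.Icc 2 (h + 1))
        (Finset.Icc (h + 2) (h + c + 1))).Adj (gv (18 * k) (4 * (h + c + 1) * (18 * k)) 0 x)
        (gv (18 * k) (4 * (h + c + 1) * (18 * k)) 0 y) := by
    intro x y hx hy
    rcases hx with hx | hx | hx
    · refine gv_crosscap (18 * k) (h + c + 1) _ _ (h + 1) x y (18 * (k * (h + 1))) ?_ (by omega)
        (by ring) (by omega) (by omega) (by omega)
      rw [Finset.mem_Icc]; omega
    · refine gv_crosscap (18 * k) (h + c + 1) _ _ (h + 2) x y (18 * (k * (h + 1)) + 18 * k) ?_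
        (by omega) (by ring) (by omega) (by omega) (by omega)
      rw [Finset.mem_Icc]; omega
    · refine gv_crosscap (18 * k) (h + c + 1) _ _ (h + 3) x y (18 * (k * (h + 1)) + 36 * k) ?_
        (by omega) (by ring) (by omega) (by omega) (by omega)
      rw [Finset.mem_Icc]; omega
  refine core _ _ (18 * k) k (4 * (h + c + 1) * (18 * k)) (4 * (h + 1 + (c - 2) + 1) * k)
    (by omega) (fun u => (u.1 : ℕ)) (fun u => (u.2 - 1).val) (fun u => u.1.2)
    (fun u => ZMod.val_lt _) ?_
    (fun x y => (∃ i ∈ Finset.Icc 2 (h + 1 + 1), ∃ j < k,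
          (x = 4 * (k * (i - 1)) + j ∧ y + j + 1 = 4 * (k * (i - 1)) + 3 * k) ∨
          (x = 4 * (k * (i - 1)) + k + j ∧ y + j + 1 = 4 * (k * (i - 1)) + 4 * k)) ∨
         (∃ i ∈ Finset.Icc (h + 1 + 2) (h + 1 + (c - 2) + 1), ∃ j < 2 * k,
          x = 4 * (k * (i - 1)) + j ∧ y = 4 * (k * (i - 1)) + 2 * k + j))
    (fun u v huv => mixedGrid_target k (h + 1 + (c - 2) + 1) hk (by omega) _ _ ?_ ?_ u v huv)
    (gv (18 * k) (4 * (h + c + 1) * (18 * k)))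
    (gv_inj _ _) (fun r c' _ => gv_h _ _ (by omega) _ _ r c')
    (fun r c' _ hc' => gv_w _ _ (by omega) _ _ r c' hc')
    (fun r c' hr => gv_v _ _ _ _ r c' hr)
    (phi k h) ?_ ?_ (fun p _ => phi_step k h p hk) (arcs k P S) ?_ ?_
    (fun s p l q d s' p' l' q' d' => arcs_arcs k P S s p l q d s' p' l' q' d') ?_ ?_
  · intro u v h1 h2
    exact Prod.ext (Fin.ext h1) (sub_left_injective (ZMod.val_injective _ h2))
  · intro i hi
    rw [Finset.mem_Icc] at hi
    omega
  · intro i hi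
    rw [Finset.mem_Icc] at hi
    omega
  · rw [phi_eq k h 0 0 0 (by omega) (by simp)]
    simp [fcol]
  · rw [phi_eq k h (h + 1 + (c - 2) + 1) 0 _ (by omega) (by ring)]
    have e : h + 1 + (c - 2) + 1 = h + c := by omega
    rw [e]
    unfold fcol
    rw [if_neg (by omega), if_neg (by omega), if_neg (by omega), if_neg (by omega),
      if_pos (by omega)]
    ring
  · intro s p l q d hu
    have := arcs_bound _ _ _ _ _ _ _ _ hu
    omega
  · intro s p l q d x hu _
    have h1 := arcs_bound _ _ _ _ _ _ _ _ hu
    have h2 := arcs_phi k h x S hS hk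
    omega
  · -- every arc is attached to its predecessor
    rintro s p l q d ⟨t, h | h | h | h | h | h | h | h⟩
    · left
      obtain ⟨ht, hs, rfl, hl, hq, hd⟩ := h
      refine ⟨q, Or.inr rfl, ?_⟩
      rw [phiS t (by omega)]
      exact cross _ _ (by omega) (by omega)
    · right
      refine ⟨0, S + 7 * k - 1 - t, S + 36 * k + t, t, by omega, ⟨t, Or.inl (by omega)⟩,
        l, S + 7 * k - 1 - t, by omega, by omega, cross _ _ (by omega) (by omega)⟩
    · right
      refine ⟨1, S + 43 * k - 1 - t, S + 72 * k + t, t, by omega, ⟨t, Or.inr (Or.inl (by omega))⟩,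
        q, S + 72 * k + t, by omega, by omega, cross _ _ (by omega) (by omega)⟩
    · left
      obtain ⟨ht, hs, rfl, hl, hq, hd⟩ := h
      refine ⟨l, Or.inl rfl, ?_⟩
      rw [add_assoc P k t, phiS (k + t) (by omega)]
      exact cross _ _ (by omega) (by omega)
    · right
      refine ⟨3, S + 37 * k + t, S + 181 * k - 1 - t, 6 * k - 1 - t, by omega, ⟨t, Or.inr (Or.inr (Or.inr (Or.inl (by omega))))⟩,
        q, S + 181 * k - 1 - t, by omega, by omega, (cross _ _ (by omega) (by omega)).symm⟩
    · right
      refine ⟨4, S + 111 * k + t, S + 145 * k - 1 - t, k - 1 - t, by omega, ⟨t, Or.inr (Or.inr (Or.inr (Or.inr (Or.inl (by omega)))))⟩,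
        q, S + 111 * k + t, by omega, by omega, (cross _ _ (by omega) (by omega)).symm⟩
    · left
      obtain ⟨ht, hs, rfl, hl, hq, hd⟩ := h
      refine ⟨l, Or.inl rfl, ?_⟩
      rw [add_assoc P (4 * k) t, phiS (4 * k + t) (by omega)]
      exact cross _ _ (by omega) (by omega)
    · right
      refine ⟨6, S + 40 * k + t, S + 75 * k - 1 - t, 3 * k - 1 - t, by omega, ⟨t, Or.inr (Or.inr (Or.inr (Or.inr (Or.inr (Or.inr (Or.inl (by omega)))))))⟩,
        l, S + 75 * k - 1 - t, by omega, by omega, cross _ _ (by omega) (by omega)⟩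
  · -- edges of the target
    rintro x y hx hy (⟨i, hi, j, hj, hxy⟩ | ⟨i, hi, j, hj, hxy⟩)
    · rw [Finset.mem_Icc] at hi
      obtain ⟨b, rfl⟩ : ∃ b, i = b + 1 := ⟨i - 1, by omega⟩
      rw [Nat.add_sub_cancel] at hxy
      by_cases hb : b = h + 1
      · right
        subst hb
        rcases hxy with hxy | hxy
        · have ex : x = P + j := by omega
          have ey : y = P + (3 * k - 1 - j) := by omega
          refine ⟨2, S + 39 * k - 1 - j, S + 108 * k + j, 4 * k + j, S + 39 * k - 1 - j,
            ⟨j, Or.inr (Or.inr (Or.inl (by omega)))⟩, by omega, ?_⟩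
          rw [ey, phiS _ (by omega)]
          exact (cross _ _ (by omega) (by omega)).symm
        · have ex : x = P + k + j := by omega
          have ey : y = P + (4 * k - 1 - j) := by omega
          refine ⟨5, S + 40 * k - 1 - j, S + 75 * k + j, 3 * k + j, S + 40 * k - 1 - j,
            ⟨j, Or.inr (Or.inr (Or.inr (Or.inr (Or.inr (Or.inl (by omega))))))⟩, by omega, ?_⟩
          rw [ey, phiS _ (by omega)]
          exact (cross _ _ (by omega) (by omega)).symm
      · left
        refine gv_handle (18 * k) (h + c + 1) _ _ b _ _ (18 * (k * b)) ?_ (by omega) (by ring) ?_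
        · rw [Finset.mem_Icc]; omega
        · rcases hxy with hxy | hxy
          · left
            rw [phi_eq k h b j x (by omega) (by omega),
              phi_eq k h b (3 * k - 1 - j) y (by omega) (by omega)]
            rw [fcol_handle k h b _ (by omega) (by omega), fcol_handle k h b _ (by omega) (by omega)]
            rw [if_pos (by omega), if_neg (by omega), if_neg (by omega), if_pos (by omega)]
            omega
          · right
            rw [phi_eq k h b (k + j) x (by omega) (by omega),
              phi_eq k h b (4 * k - 1 - j) y (by omega) (by omega)]
            rw [fcol_handle k h b _ (by omega) (by omega), fcol_handle k h b _ (by omega) (by omega)]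
            rw [if_neg (by omega), if_pos (by omega), if_neg (by omega), if_neg (by omega),
              if_neg (by omega)]
            omega
    · rw [Finset.mem_Icc] at hi
      obtain ⟨b, rfl⟩ : ∃ b, i = b + 1 := ⟨i - 1, by omega⟩
      rw [Nat.add_sub_cancel] at hxy
      by_cases hb : b = h + 2
      · right
        subst hb
        have e : k * (h + 2) = k * (h + 1) + k := by ring
        rw [e] at hxy
        have ex : x = P + 4 * k + j := by omega
        have ey : y = P + (6 * k + j) := by omega
        refine ⟨7, S + 111 * k - 1 - j, S + 145 * k + j, k + j, S + 145 * k + j,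
          ⟨j, Or.inr (Or.inr (Or.inr (Or.inr (Or.inr (Or.inr (Or.inr (by omega)))))))⟩, by omega, ?_⟩
        rw [ey, phiZ _ (by omega) (by omega)]
        exact cross _ _ (by omega) (by omega)
      · left
        refine gv_crosscap (18 * k) (h + c + 1) _ _ (b + 1) _ _ (18 * (k * (b + 1))) ?_ (by omega)
          (by ring) ?_ ?_ ?_
        · rw [Finset.mem_Icc]; omega
        · rw [phi_eq k h b j x (by omega) (by omega), fcol_late _ _ _ _ (by omega),
            if_pos (by omega)]
          omega
        · rw [phi_eq k h b j x (by omega) (by omega), fcol_late _ _ _ _ (by omega),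
            if_pos (by omega)]
          omega
        · rw [phi_eq k h b j x (by omega) (by omega), fcol_late _ _ _ _ (by omega),
            if_pos (by omega), phi_eq k h b (2 * k + j) y (by omega) (by omega),
            fcol_late _ _ _ _ (by omega), if_neg (by omega)]
          omega
end
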